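/- arXiv:1503.04411 — 2 statements merged into one kernel-verified Lean document; each statement's English description precedes it below -/
import Mathlib

section
/- For every δ ∈ (0, 1) there exists a constant C_δ > 0 such that for every real ε with |ε| > δ and |ε − 1| > δ, and every Schwartz function f : ℝ → ℂ, one has ‖C_ε^{even} f‖_{L²(ℝ)} ≤ C_δ ‖f‖_{L²(ℝ)}. -/
open MeasureTheory Filter Set
open scoped ENNReal Topology

/-- Principal value integral: the limit, as `δ → 0⁺` and `R → ∞`, of
`∫_{δ ≤ |y| ≤ R} g(y) dy`. -/
noncomputable def pvIntegral (g : ℝ → ℂ) : ℂ :=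
  limUnder ((nhdsWithin (0 : ℝ) (Set.Ioi 0)) ×ˢ Filter.atTop)
    (fun p : ℝ × ℝ => ∫ y in {y : ℝ | p.1 ≤ |y| ∧ |y| ≤ p.2}, g y)

/-- The even fractional Carleson operator
`C_ε^{even} f(x) = sup_{A ∈ ℝ} | p.v. ∫ e^{i A |y|^ε} f(x-y) dy/y |`. -/
noncomputable def carlesonEven (ε : ℝ) (f : ℝ → ℂ) (x : ℝ) : ℝ≥0∞ :=
  ⨆ A : ℝ, (‖pvIntegral (fun y =>
    Complex.exp (Complex.I * (A : ℂ) * ((|y| ^ ε : ℝ) : ℂ)) * f (x - y) / (y : ℂ))‖₊ : ℝ≥0∞)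


namespace CE

lemma le_of_sq_le {a b : ℝ≥0∞} (h : a ^ 2 ≤ b ^ 2) : a ≤ b := by
  rw [← ENNReal.rpow_two, ← ENNReal.rpow_two] at h
  exact (ENNReal.rpow_le_rpow_iff (by norm_num)).1 h

/-- Cauchy–Schwarz, squared form. -/
lemma cs_sq {α : Type*} [MeasurableSpace α] {μ : Measure α} {f g : α → ℝ≥0∞}
    (hf : AEMeasurable f μ) (hg : AEMeasurable g μ) :
    (∫⁻ a, f a * g a ∂μ) ^ 2 ≤ (∫⁻ a, f a ^ 2 ∂μ) * (∫⁻ a, g a ^ 2 ∂μ) := by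
  have h := ENNReal.lintegral_mul_le_Lp_mul_Lq μ (Real.HolderConjugate.two_two) hf hg
  have h2 := pow_le_pow_left' h 2
  simp only [Pi.mul_apply, ENNReal.rpow_two] at h2
  refine h2.trans (le_of_eq ?_)
  rw [mul_pow, ← ENNReal.rpow_two, ← ENNReal.rpow_two, ← ENNReal.rpow_mul, ← ENNReal.rpow_mul]
  norm_num

/-- Poisson-type kernel. -/
noncomputable def pk (r y : ℝ) : ℝ := r / (r ^ 2 + y ^ 2)

lemma pk_nonneg {r : ℝ} (hr : 0 < r) (y : ℝ) : 0 ≤ pk r y := by unfold pk; positivity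

@[fun_prop]
lemma measurable_pk {α : Type*} [MeasurableSpace α] {f g : α → ℝ} (hf : Measurable f)
    (hg : Measurable g) : Measurable (fun a => pk (f a) (g a)) := by
  unfold pk; fun_prop

lemma pk_neg (r y : ℝ) : pk r (-y) = pk r y := by unfold pk; simp

lemma pk_sub_comm (r x y : ℝ) : pk r (x - y) = pk r (y - x) := by
  rw [← pk_neg, neg_sub]

lemma pk_eq {r : ℝ} (hr : 0 < r) (y : ℝ) : pk r y = r⁻¹ * (1 + (r⁻¹ * y) ^ 2)⁻¹ := by
  unfold pk; field_simp

lemma integrable_pk {r : ℝ} (hr : 0 < r) : Integrable (pk r) := by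
  have h := (integrable_inv_one_add_sq.comp_mul_left' (inv_ne_zero hr.ne')).const_mul r⁻¹
  exact h.congr (ae_of_all _ fun y => (pk_eq hr y).symm)

lemma integral_pk {r : ℝ} (hr : 0 < r) : ∫ y, pk r y = Real.pi := by
  simp_rw [pk_eq hr]
  rw [integral_const_mul, Measure.integral_comp_mul_left (fun y => (1 + y ^ 2)⁻¹),
    integral_univ_inv_one_add_sq]
  simp [abs_of_pos hr]; field_simp

lemma lintegral_pk {r : ℝ} (hr : 0 < r) : ∫⁻ y, ENNReal.ofReal (pk r y) = ENNReal.ofReal Real.pi := by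
  rw [← ofReal_integral_eq_lintegral_ofReal (integrable_pk hr) (ae_of_all _ (pk_nonneg hr)),
    integral_pk hr]

lemma lintegral_pk_sub_left {r : ℝ} (hr : 0 < r) (x : ℝ) :
    ∫⁻ y, ENNReal.ofReal (pk r (x - y)) = ENNReal.ofReal Real.pi := by
  rw [lintegral_sub_left_eq_self (fun y => ENNReal.ofReal (pk r y)) x, lintegral_pk hr]

lemma lintegral_pk_sub_right {r : ℝ} (hr : 0 < r) (x : ℝ) :
    ∫⁻ y, ENNReal.ofReal (pk r (y - x)) = ENNReal.ofReal Real.pi := by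
  simp_rw [pk_sub_comm r _ x]; exact lintegral_pk_sub_left hr x

lemma pk_le_four {r : ℝ} (hr : 0 < r) {y u : ℝ} (h : |u| ≤ 2 * |y|) : pk r y ≤ 4 * pk r u := by
  unfold pk
  have : u ^ 2 ≤ 4 * y ^ 2 := by
    have := pow_le_pow_left₀ (abs_nonneg u) h 2
    rw [mul_pow, sq_abs, sq_abs] at this; linarith
  rw [← mul_div_assoc, div_le_div_iff₀ (by positivity) (by positivity)]
  nlinarith [sq_nonneg r]

lemma pk_mul_le {r s : ℝ} (hr : 0 < r) (hs : 0 < s) (a b : ℝ) :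
    pk r a * pk s b ≤ 4 * pk r (a - b) * pk s b + 4 * pk s (a - b) * pk r a := by
  have h1 := pk_nonneg hr a
  have h2 := pk_nonneg hs b
  have h3 := pk_nonneg hr (a - b)
  have h4 := pk_nonneg hs (a - b)
  have : |a - b| ≤ 2 * |a| ∨ |a - b| ≤ 2 * |b| := by
    have := abs_sub a b
    rcases le_total |a| |b| with h | h
    · right; linarith
    · left; linarith
  rcases this with h | h
  · have := mul_le_mul_of_nonneg_right (pk_le_four hr h) h2
    nlinarith [mul_nonneg h4 h1]
  · have := mul_le_mul_of_nonneg_left (pk_le_four hs h) h1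
    nlinarith [mul_nonneg h3 h2]

lemma lintegral_pk_mul_pk {r s : ℝ} (hr : 0 < r) (hs : 0 < s) (x x' : ℝ) :
    ∫⁻ z, ENNReal.ofReal (pk r (x - z)) * ENNReal.ofReal (pk s (x' - z)) ≤
      ENNReal.ofReal (4 * Real.pi) *
        (ENNReal.ofReal (pk r (x - x')) + ENNReal.ofReal (pk s (x - x'))) := by
  calc ∫⁻ z, ENNReal.ofReal (pk r (x - z)) * ENNReal.ofReal (pk s (x' - z))
      ≤ ∫⁻ z, (ENNReal.ofReal (4 * pk r (x - x')) * ENNReal.ofReal (pk s (x' - z))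
        + ENNReal.ofReal (4 * pk s (x - x')) * ENNReal.ofReal (pk r (x - z))) := by
        refine lintegral_mono fun z => ?_
        have h := pk_mul_le hr hs (x - z) (x' - z)
        rw [sub_sub_sub_cancel_right] at h
        have h3 := pk_nonneg hr (x - x')
        have h4 := pk_nonneg hs (x - x')
        have h1 := pk_nonneg hr (x - z)
        have h2 := pk_nonneg hs (x' - z)
        rw [← ENNReal.ofReal_mul h1, ← ENNReal.ofReal_mul (by positivity),
          ← ENNReal.ofReal_mul (by positivity), ← ENNReal.ofReal_add (by positivity) (by positivity)]
        exact ENNReal.ofReal_le_ofReal h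
    _ = _ := by
        rw [lintegral_add_left (by fun_prop), lintegral_const_mul _ (by fun_prop),
          lintegral_const_mul _ (by fun_prop), lintegral_pk_sub_left hr, lintegral_pk_sub_left hs,
          ENNReal.ofReal_mul (by norm_num), ENNReal.ofReal_mul (by norm_num),
          ENNReal.ofReal_mul (by norm_num)]
        ring

/-- linearised Poisson maximal operator -/
noncomputable def PM (ρ : ℝ → ℝ) (g : ℝ → ℝ≥0∞) (x : ℝ) : ℝ≥0∞ :=
  ∫⁻ z, ENNReal.ofReal (pk (ρ x) (x - z)) * g z

lemma measurable_PM {ρ : ℝ → ℝ} (hρ : Measurable ρ) {g : ℝ → ℝ≥0∞} (hg : Measurable g) :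
    Measurable (PM ρ g) := by
  unfold PM
  apply Measurable.lintegral_prod_right' (f := fun p : ℝ × ℝ =>
    ENNReal.ofReal (pk (ρ p.1) (p.1 - p.2)) * g p.2)
  fun_prop

def PB (ρ : ℝ → ℝ) (c : ℝ≥0∞) : Prop :=
  ∀ g : ℝ → ℝ≥0∞, Measurable g → ∫⁻ x, PM ρ g x ^ 2 ≤ c * ∫⁻ x, g x ^ 2

lemma PB_apriori {ρ : ℝ → ℝ} {a b : ℝ} (ha : 0 < a) (hab : ∀ x, a ≤ ρ x ∧ ρ x ≤ b) :
    PB ρ (ENNReal.ofReal ((b / a) ^ 2 * Real.pi ^ 2)) := by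
  intro g hg
  have hb : 0 < b := ha.trans_le ((hab 0).1.trans (hab 0).2)
  have key : ∀ x, PM ρ g x ^ 2 ≤ ENNReal.ofReal ((b / a) ^ 2 * Real.pi) *
      ∫⁻ z, ENNReal.ofReal (pk a (x - z)) * g z ^ 2 := by
    intro x
    have h1 : PM ρ g x ≤ ENNReal.ofReal (b / a) *
        ∫⁻ z, ENNReal.ofReal (pk a (x - z)) * g z := by
      unfold PM
      rw [← lintegral_const_mul _ (by fun_prop)]
      refine lintegral_mono fun z => ?_
      simp only
      rw [← mul_assoc, ← ENNReal.ofReal_mul (by positivity)]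
      gcongr
      unfold pk
      have h0 : 0 < ρ x := ha.trans_le (hab x).1
      rw [div_mul_div_comm, mul_comm b a, mul_div_mul_left _ _ ha.ne']
      gcongr
      · exact (hab x).2
      · exact (hab x).1
    have h2 := cs_sq (μ := volume) (f := fun z => ENNReal.ofReal (pk a (x - z)) ^ (1/2 : ℝ))
      (g := fun z => ENNReal.ofReal (pk a (x - z)) ^ (1/2 : ℝ) * g z) (by fun_prop) (by fun_prop)
    have e : ∀ t : ℝ≥0∞, t ^ (1/2 : ℝ) * t ^ (1/2:ℝ) = t := by
      intro t
      rw [← ENNReal.rpow_add_of_nonneg _ _ (by norm_num) (by norm_num)]; norm_num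
    simp only [mul_pow, ← mul_assoc, e, sq (_ ^ (1/2:ℝ) : ℝ≥0∞)] at h2
    rw [lintegral_pk_sub_left ha] at h2
    calc _ ≤ (ENNReal.ofReal (b / a) * ∫⁻ z, ENNReal.ofReal (pk a (x - z)) * g z) ^ 2 := by gcongr
      _ ≤ ENNReal.ofReal (b / a) ^ 2 * (ENNReal.ofReal Real.pi *
        ∫⁻ z, ENNReal.ofReal (pk a (x - z)) * g z ^ 2) := by rw [mul_pow]; gcongr
      _ = _ := by
        rw [ENNReal.ofReal_mul (by positivity), ENNReal.ofReal_pow (by positivity), mul_assoc]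
  calc _ ≤ ∫⁻ x, ENNReal.ofReal ((b / a) ^ 2 * Real.pi) *
      ∫⁻ z, ENNReal.ofReal (pk a (x - z)) * g z ^ 2 := lintegral_mono key
    _ = ENNReal.ofReal ((b / a) ^ 2 * Real.pi) *
      ∫⁻ z, ∫⁻ x, ENNReal.ofReal (pk a (x - z)) * g z ^ 2 := by
        rw [lintegral_const_mul', lintegral_lintegral_swap (by fun_prop)]
        exact ENNReal.ofReal_ne_top
    _ = _ := by
        have : ∀ z, ∫⁻ x, ENNReal.ofReal (pk a (x - z)) * g z ^ 2 =
            ENNReal.ofReal Real.pi * g z ^ 2 := by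
          intro z
          rw [lintegral_mul_const _ (by fun_prop), lintegral_pk_sub_right ha]
        simp_rw [this]
        rw [lintegral_const_mul _ (by fun_prop), ← mul_assoc, ← ENNReal.ofReal_mul (by positivity)]
        congr 2; ring

/-- bilinear form bound from an operator bound -/
lemma PB_bilin {ρ : ℝ → ℝ} (hρ : Measurable ρ) {c : ℝ≥0∞} (h : PB ρ (c ^ 2)) {g : ℝ → ℝ≥0∞}
    (hg : Measurable g) :
    ∫⁻ x, ∫⁻ x', g x * g x' * (ENNReal.ofReal (pk (ρ x) (x - x')) +
      ENNReal.ofReal (pk (ρ x') (x - x'))) ≤ 2 * c * ∫⁻ x, g x ^ 2 := by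
  have h1 : ∫⁻ x, ∫⁻ x', g x * g x' * ENNReal.ofReal (pk (ρ x) (x - x')) ≤ c * ∫⁻ x, g x ^ 2 := by
    have : ∀ x, ∫⁻ x', g x * g x' * ENNReal.ofReal (pk (ρ x) (x - x')) = g x * PM ρ g x := by
      intro x
      unfold PM
      rw [← lintegral_const_mul _ (by fun_prop)]
      congr 1; ext z; ring
    simp_rw [this]
    have h2 := cs_sq (μ := volume) hg.aemeasurable (measurable_PM hρ hg).aemeasurable
    have h3 := h2.trans (mul_le_mul_right (h g hg) _)
    rw [← mul_assoc, mul_comm _ (c ^ 2), mul_assoc, ← sq, ← mul_pow] at h3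
    exact le_of_sq_le h3
  have h2 : ∫⁻ x, ∫⁻ x', g x * g x' * ENNReal.ofReal (pk (ρ x') (x - x')) ≤ c * ∫⁻ x, g x ^ 2 := by
    rw [lintegral_lintegral_swap (by fun_prop)]
    refine le_trans (le_of_eq ?_) h1
    congr 1; ext x; congr 1; ext x'
    rw [pk_sub_comm]; ring
  calc _ = ∫⁻ x, ((∫⁻ x', g x * g x' * ENNReal.ofReal (pk (ρ x) (x - x'))) +
        ∫⁻ x', g x * g x' * ENNReal.ofReal (pk (ρ x') (x - x'))) := by
        congr 1; ext x
        rw [← lintegral_add_left (by fun_prop)]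
        simp_rw [mul_add]
    _ = _ := by
        rw [lintegral_add_left]
        apply Measurable.lintegral_prod_right' (f := fun p : ℝ × ℝ =>
          g p.1 * g p.2 * ENNReal.ofReal (pk (ρ p.1) (p.1 - p.2)))
        fun_prop
    _ ≤ c * (∫⁻ x, g x ^ 2) + c * ∫⁻ x, g x ^ 2 := add_le_add h1 h2
    _ = _ := by ring

lemma PB_improve {ρ : ℝ → ℝ} (hρ : Measurable ρ) (h0 : ∀ x, 0 < ρ x) {c : ℝ≥0∞} (hc : c ≠ ∞)
    (h : PB ρ (c ^ 2)) :
    PB ρ (ENNReal.ofReal (8 * Real.pi) * c) := by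
  intro g hg
  set G := PM ρ g with hG
  have mG : Measurable G := measurable_PM hρ hg
  by_cases hfin : ∫⁻ x, g x ^ 2 = ∞
  · by_cases hc0 : c = 0
    · have := h g hg
      simp only [hc0] at this ⊢
      simpa using this
    · rw [hfin, ENNReal.mul_top]
      · exact le_top
      · simp [hc0, Real.pi_pos]
  set I := ∫⁻ x, G x ^ 2 with hI
  have hIfin : I ≠ ∞ := ne_top_of_le_ne_top (ENNReal.mul_ne_top (by simp [hc]) hfin) (h g hg)
  -- the adjoint
  set S : ℝ → ℝ≥0∞ := fun z => ∫⁻ x, ENNReal.ofReal (pk (ρ x) (x - z)) * G x with hS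
  have mS : Measurable S := by
    apply Measurable.lintegral_prod_right' (f := fun p : ℝ × ℝ =>
      ENNReal.ofReal (pk (ρ p.2) (p.2 - p.1)) * G p.2)
    fun_prop
  have e1 : I = ∫⁻ z, g z * S z := by
    calc I = ∫⁻ x, ∫⁻ z, G x * (ENNReal.ofReal (pk (ρ x) (x - z)) * g z) := by
          rw [hI]; congr 1; ext x
          rw [lintegral_const_mul _ (by fun_prop), sq]; rfl
      _ = ∫⁻ z, ∫⁻ x, G x * (ENNReal.ofReal (pk (ρ x) (x - z)) * g z) :=
          lintegral_lintegral_swap (by fun_prop)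
      _ = _ := by
          congr 1; ext z
          rw [hS, ← lintegral_const_mul _ (by fun_prop)]
          congr 1; ext x; ring
  have e2 : ∫⁻ z, S z ^ 2 ≤ ENNReal.ofReal (4 * Real.pi) * (2 * c * I) := by
    calc ∫⁻ z, S z ^ 2 = ∫⁻ z, ∫⁻ x, ∫⁻ x', (ENNReal.ofReal (pk (ρ x) (x - z)) * G x) *
            (ENNReal.ofReal (pk (ρ x') (x' - z)) * G x') := by
          congr 1; ext z
          rw [sq]
          conv_lhs => rw [hS]
          simp only
          rw [← lintegral_mul_const _ (by fun_prop)]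
          congr 1; ext x
          rw [← lintegral_const_mul _ (by fun_prop)]
      _ = ∫⁻ x, ∫⁻ z, ∫⁻ x', (ENNReal.ofReal (pk (ρ x) (x - z)) * G x) *
            (ENNReal.ofReal (pk (ρ x') (x' - z)) * G x') := by
          rw [lintegral_lintegral_swap]
          apply Measurable.aemeasurable
          apply Measurable.lintegral_prod_right' (f := fun p : (ℝ × ℝ) × ℝ =>
            (ENNReal.ofReal (pk (ρ p.1.2) (p.1.2 - p.1.1)) * G p.1.2) *
            (ENNReal.ofReal (pk (ρ p.2) (p.2 - p.1.1)) * G p.2))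
          fun_prop
      _ = ∫⁻ x, ∫⁻ x', G x * G x' * ∫⁻ z, (ENNReal.ofReal (pk (ρ x) (x - z))) *
            (ENNReal.ofReal (pk (ρ x') (x' - z))) := by
          congr 1; ext x
          rw [lintegral_lintegral_swap (by fun_prop)]
          congr 1; ext x'
          rw [← lintegral_const_mul _ (by fun_prop)]
          congr 1; ext z; ring
      _ ≤ ∫⁻ x, ∫⁻ x', G x * G x' * (ENNReal.ofReal (4 * Real.pi) *
        (ENNReal.ofReal (pk (ρ x) (x - x')) + ENNReal.ofReal (pk (ρ x') (x - x')))) := by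
          gcongr with x x'
          exact lintegral_pk_mul_pk (h0 x) (h0 x') x x'
      _ = ENNReal.ofReal (4 * Real.pi) * ∫⁻ x, ∫⁻ x', G x * G x' *
        (ENNReal.ofReal (pk (ρ x) (x - x')) + ENNReal.ofReal (pk (ρ x') (x - x'))) := by
          rw [← lintegral_const_mul' _ _ ENNReal.ofReal_ne_top]
          congr 1; ext x
          rw [← lintegral_const_mul' _ _ ENNReal.ofReal_ne_top]
          congr 1; ext x'; ring
      _ ≤ _ := by
          gcongr
          exact PB_bilin hρ h mG
  have e3 : I * I ≤ (ENNReal.ofReal (8 * Real.pi) * c * ∫⁻ x, g x ^ 2) * I := by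
    calc I * I = (∫⁻ z, g z * S z) ^ 2 := by rw [← e1, sq]
      _ ≤ (∫⁻ z, g z ^ 2) * ∫⁻ z, S z ^ 2 := cs_sq hg.aemeasurable mS.aemeasurable
      _ ≤ (∫⁻ z, g z ^ 2) * (ENNReal.ofReal (4 * Real.pi) * (2 * c * I)) := by gcongr
      _ = _ := by
        have : ENNReal.ofReal (8 * Real.pi) = ENNReal.ofReal (4 * Real.pi) * 2 := by
          rw [← ENNReal.ofReal_ofNat 2, ← ENNReal.ofReal_mul (by positivity)]; congr 1; ring
        rw [this]; ring
  by_cases hI0 : I = 0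
  · rw [hI0]; exact zero_le
  · exact (ENNReal.mul_le_mul_iff_left hI0 hIfin).1 e3

/-- The Poisson maximal theorem (linearised), with an absolute constant. -/
lemma PB_main {ρ : ℝ → ℝ} (hρ : Measurable ρ) {a b : ℝ} (ha : 0 < a)
    (hab : ∀ x, a ≤ ρ x ∧ ρ x ≤ b) : PB ρ (ENNReal.ofReal (60 ^ 2)) := by
  have h0 : ∀ x, 0 < ρ x := fun x => ha.trans_le (hab x).1
  -- bounds (30 * 2^n)^2
  have step : ∀ n : ℕ, PB ρ (ENNReal.ofReal (30 * 2 ^ (n + 2)) ^ 2) →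
      PB ρ (ENNReal.ofReal (30 * 2 ^ (n + 1)) ^ 2) := by
    intro n h g hg
    refine (PB_improve hρ h0 ENNReal.ofReal_ne_top h g hg).trans ?_
    gcongr
    rw [← ENNReal.ofReal_mul (by positivity), ← ENNReal.ofReal_pow (by positivity)]
    apply ENNReal.ofReal_le_ofReal
    have hp : Real.pi ≤ 3.15 := Real.pi_lt_d2.le
    have h2 : (1:ℝ) ≤ 2 ^ n := one_le_pow₀ (by norm_num)
    have : (30 * 2 ^ (n + 1) : ℝ) ^ 2 = 30 * 2 ^ (n+2) * (30 * 2 ^ n) := by ring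
    rw [this, mul_comm]
    refine mul_le_mul_of_nonneg_left ?_ (by positivity)
    nlinarith
  have all : ∀ n : ℕ, PB ρ (ENNReal.ofReal (30 * 2 ^ (n + 1)) ^ 2) →
      PB ρ (ENNReal.ofReal (30 * 2 ^ (0 + 1)) ^ 2) := by
    intro n
    induction n with
    | zero => exact id
    | succ k ih => intro h; exact ih (step k h)
  obtain ⟨n, hn⟩ := pow_unbounded_of_one_lt (b / a * Real.pi) (one_lt_two)
  have hb : 0 < b := ha.trans_le ((hab 0).1.trans (hab 0).2)
  have := all n (by
    intro g hg
    refine (PB_apriori ha hab g hg).trans ?_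
    gcongr
    rw [← ENNReal.ofReal_pow (by positivity), ← mul_pow]
    apply ENNReal.ofReal_le_ofReal
    have hpi := Real.pi_pos
    refine pow_le_pow_left₀ (by positivity) ?_ 2
    rw [pow_succ]
    have : (0:ℝ) < 2 ^ n := by positivity
    linarith)
  rw [← ENNReal.ofReal_pow (by positivity)] at this
  norm_num at this ⊢
  exact this

end CE


namespace CE

lemma lintegral_enorm_sq_eq {α : Type*} [MeasurableSpace α] {μ : Measure α} {w : α → ℂ}
    (h : Integrable (fun x => w x * (starRingEnd ℂ) (w x)) μ) :
    ∫⁻ x, ‖w x‖ₑ ^ 2 ∂μ = ‖∫ x, w x * (starRingEnd ℂ) (w x) ∂μ‖ₑ := by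
  have h1 : ∀ x, ‖w x * (starRingEnd ℂ) (w x)‖ₑ = ‖w x‖ₑ ^ 2 := by
    intro x; rw [enorm_mul, sq]; congr 1
    rw [← ofReal_norm, ← ofReal_norm, RCLike.norm_conj]
  simp_rw [← h1]
  rw [← ofReal_integral_norm_eq_lintegral_enorm h]
  have h2 : ∀ x, w x * (starRingEnd ℂ) (w x) = ((‖w x * (starRingEnd ℂ) (w x)‖ : ℝ) : ℂ) := by
    intro x
    rw [norm_mul, RCLike.norm_conj, Complex.mul_conj', ← sq]; push_cast; rfl
  conv_rhs => rw [integral_congr_ae (ae_of_all _ h2), integral_complex_ofReal]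
  rw [← ofReal_norm, Complex.norm_real, Real.norm_of_nonneg]
  exact integral_nonneg fun _ => norm_nonneg _

lemma master {K : ℝ → ℝ → ℂ} (hK : Measurable (Function.uncurry K)) {H : ℝ≥0∞} (hH : H ≠ ∞)
    (hKH : ∀ x, ∫⁻ z, ‖K x z‖ₑ ^ 2 ≤ H) {Φ : ℝ → ℝ → ℝ≥0∞}
    (hΦ : ∀ x x', ‖∫ z, K x z * (starRingEnd ℂ) (K x' z)‖ₑ ≤ Φ x x') {N : ℝ≥0∞}
    (hN : ∀ g : ℝ → ℝ≥0∞, Measurable g →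
      ∫⁻ x, ∫⁻ x', g x * g x' * Φ x x' ≤ N * ∫⁻ x, g x ^ 2)
    {f : ℝ → ℂ} (hf : Measurable f) (hf2 : ∫⁻ z, ‖f z‖ₑ ^ 2 ≠ ∞) :
    ∫⁻ x, ‖∫ z, K x z * f z‖ₑ ^ 2 ≤ N * ∫⁻ z, ‖f z‖ₑ ^ 2 := by
  set F : ℝ → ℂ := fun x => ∫ z, K x z * f z with hF
  set Ef := ∫⁻ z, ‖f z‖ₑ ^ 2 with hEf
  have mKx : ∀ x, Measurable (K x) := fun x => hK.of_uncurry_left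
  have mKz : ∀ z, Measurable (fun x => K x z) := fun z => hK.of_uncurry_right
  have mF : Measurable F := by
    have : StronglyMeasurable (Function.uncurry (fun x z => K x z * f z)) := by
      apply Measurable.stronglyMeasurable
      exact hK.mul (hf.comp measurable_snd)
    exact this.integral_prod_right.measurable
  have b1 : ∀ x, (∫⁻ z, ‖K x z‖ₑ * ‖f z‖ₑ) ^ 2 ≤ H * Ef := fun x =>
    (cs_sq (mKx x).enorm.aemeasurable hf.enorm.aemeasurable).trans (by gcongr; exact hKH x)
  set B : ℝ≥0∞ := (H * Ef) ^ (1/2 : ℝ) with hB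
  have hB2 : B ^ 2 = H * Ef := by
    rw [hB, ← ENNReal.rpow_two, ← ENNReal.rpow_mul]; norm_num
  have hBtop : B ≠ ∞ := ENNReal.rpow_ne_top_of_nonneg (by norm_num) (ENNReal.mul_ne_top hH hf2)
  have b1' : ∀ x, ∫⁻ z, ‖K x z‖ₑ * ‖f z‖ₑ ≤ B := fun x => le_of_sq_le ((b1 x).trans hB2.ge)
  have b2 : ∀ x, ‖F x‖ₑ ≤ B := by
    intro x
    refine (enorm_integral_le_lintegral_enorm _).trans ?_
    simp_rw [enorm_mul]; exact b1' x
  have bKK : ∀ x x', ∫⁻ z, ‖K x z‖ₑ * ‖K x' z‖ₑ ≤ H := by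
    intro x x'
    apply le_of_sq_le
    refine (cs_sq (mKx x).enorm.aemeasurable (mKx x').enorm.aemeasurable).trans ?_
    rw [sq]; exact mul_le_mul' (hKH x) (hKH x')
  -- main estimate on truncations
  have main : ∀ R : ℕ, ∫⁻ x, ‖(Icc (-(R:ℝ)) R).indicator F x‖ₑ ^ 2 ≤ N * Ef := by
    intro R
    set g : ℝ → ℂ := (Icc (-(R:ℝ)) R).indicator F with hg
    have mg : Measurable g := mF.indicator measurableSet_Icc
    have gle : ∀ x, ‖g x‖ₑ ≤ (Icc (-(R:ℝ)) R).indicator (fun _ => B) x := by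
      intro x
      by_cases hx : x ∈ Icc (-(R:ℝ)) R
      · simp only [hg, indicator_of_mem hx]; exact b2 x
      · simp [hg, indicator_of_notMem hx]
    have g1 : ∫⁻ x, ‖g x‖ₑ ≠ ∞ := by
      refine ne_top_of_le_ne_top ?_ (lintegral_mono gle)
      rw [lintegral_indicator measurableSet_Icc]
      simp only [lintegral_const, Measure.restrict_apply MeasurableSet.univ, univ_inter,
        Real.volume_Icc]
      exact ENNReal.mul_ne_top hBtop ENNReal.ofReal_ne_top
    have g2 : ∫⁻ x, ‖g x‖ₑ ^ 2 ≠ ∞ := by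
      refine ne_top_of_le_ne_top (ENNReal.mul_ne_top hBtop g1) ?_
      rw [← lintegral_const_mul' _ _ hBtop]
      refine lintegral_mono fun x => ?_
      rw [sq]; gcongr
      exact (gle x).trans (indicator_le_self' (fun _ _ => zero_le) x)
    set I := ∫⁻ x, ‖g x‖ₑ ^ 2 with hI
    set G : ℝ → ℂ := fun z => ∫ x, (starRingEnd ℂ) (g x) * K x z with hG
    have mcg : Measurable (fun x => (starRingEnd ℂ) (g x)) :=
      (Complex.continuous_conj.measurable).comp mg
    have ecg : ∀ x, ‖(starRingEnd ℂ) (g x)‖ₑ = ‖g x‖ₑ := fun x => by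
      rw [← ofReal_norm, ← ofReal_norm, RCLike.norm_conj]
    have mG : Measurable G := by
      have : StronglyMeasurable (Function.uncurry (fun z x => (starRingEnd ℂ) (g x) * K x z)) := by
        apply Measurable.stronglyMeasurable
        exact (mcg.comp measurable_snd).mul (hK.comp measurable_swap)
      exact this.integral_prod_right.measurable
    -- step 1
    have s1 : I ^ 2 ≤ Ef * ∫⁻ z, ‖G z‖ₑ ^ 2 := by
      have intU : Integrable (Function.uncurry fun x z => (starRingEnd ℂ) (g x) * (K x z * f z))
          (volume.prod volume) := by
        refine ⟨((mcg.comp measurable_fst).mul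
          (hK.mul (hf.comp measurable_snd))).aestronglyMeasurable, ?_⟩
        rw [hasFiniteIntegral_iff_enorm, lintegral_prod]
        · refine lt_of_le_of_lt (b := ∫⁻ x, ‖g x‖ₑ * B) (lintegral_mono fun x => ?_) ?_
          · simp only [Function.uncurry_apply_pair, enorm_mul, ecg]
            rw [lintegral_const_mul'' _ (by fun_prop)]
            gcongr; exact b1' x
          · rw [lintegral_mul_const' _ _ hBtop]
            exact (ENNReal.mul_ne_top g1 hBtop).lt_top
        · exact ((mcg.comp measurable_fst).mul
            (hK.mul (hf.comp measurable_snd))).enorm.aemeasurable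
      have gF : ∀ x, g x * (starRingEnd ℂ) (g x) = (starRingEnd ℂ) (g x) * F x := by
        intro x
        rw [mul_comm]
        by_cases hx : x ∈ Icc (-(R:ℝ)) R
        · simp only [hg, indicator_of_mem hx]
        · simp [hg, indicator_of_notMem hx]
      have intg : Integrable (fun x => g x * (starRingEnd ℂ) (g x)) := by
        refine ⟨(mg.mul mcg).aestronglyMeasurable, ?_⟩
        rw [hasFiniteIntegral_iff_enorm]
        simp_rw [enorm_mul, ecg, ← sq]; exact g2.lt_top
      have e : ∫ x, g x * (starRingEnd ℂ) (g x) = ∫ z, f z * G z := by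
        simp_rw [gF]
        calc ∫ x, (starRingEnd ℂ) (g x) * F x
            = ∫ x, ∫ z, (starRingEnd ℂ) (g x) * (K x z * f z) := by
              congr 1; ext x; rw [integral_const_mul]
          _ = ∫ z, ∫ x, (starRingEnd ℂ) (g x) * (K x z * f z) := integral_integral_swap intU
          _ = _ := by
              congr 1; ext z
              rw [hG, ← integral_const_mul]; congr 1; ext x; ring
      rw [hI, lintegral_enorm_sq_eq intg, e]
      refine le_trans ?_ (cs_sq hf.enorm.aemeasurable mG.enorm.aemeasurable)
      gcongr
      refine (enorm_integral_le_lintegral_enorm _).trans ?_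
      simp_rw [enorm_mul]; exact le_rfl
    -- step 2
    have s2 : ∫⁻ z, ‖G z‖ₑ ^ 2 ≤ N * I := by
      set T : (ℝ × ℝ) → ℝ → ℂ := fun p z => ((starRingEnd ℂ) (g p.1) * K p.1 z) *
        (starRingEnd ℂ) ((starRingEnd ℂ) (g p.2) * K p.2 z) with hT
      have mT : Measurable (Function.uncurry T) := by
        have a1 : Measurable fun q : (ℝ × ℝ) × ℝ => (starRingEnd ℂ) (g q.1.1) * K q.1.1 q.2 :=
          (mcg.comp (by fun_prop)).mul (hK.comp (g := Function.uncurry K)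
            (f := fun q : (ℝ × ℝ) × ℝ => (q.1.1, q.2)) (by fun_prop))
        have a2 : Measurable fun q : (ℝ × ℝ) × ℝ => (starRingEnd ℂ) (g q.1.2) * K q.1.2 q.2 :=
          (mcg.comp (by fun_prop)).mul (hK.comp (g := Function.uncurry K)
            (f := fun q : (ℝ × ℝ) × ℝ => (q.1.2, q.2)) (by fun_prop))
        exact a1.mul (Complex.continuous_conj.measurable.comp a2)
      have eT : ∀ p z, ‖T p z‖ₑ = ‖g p.1‖ₑ * ‖g p.2‖ₑ * (‖K p.1 z‖ₑ * ‖K p.2 z‖ₑ) := by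
        intro p z
        have : ∀ w : ℂ, ‖(starRingEnd ℂ) w‖ₑ = ‖w‖ₑ := fun w => by
          rw [← ofReal_norm, ← ofReal_norm, RCLike.norm_conj]
        simp only [hT, enorm_mul, this]; ring
      have intT : Integrable (Function.uncurry T) ((volume.prod volume).prod volume) := by
        refine ⟨mT.aestronglyMeasurable, ?_⟩
        rw [hasFiniteIntegral_iff_enorm, lintegral_prod _ mT.enorm.aemeasurable]
        refine lt_of_le_of_lt (b := ∫⁻ p : ℝ × ℝ, ‖g p.1‖ₑ * ‖g p.2‖ₑ * H ∂(volume.prod volume)) ?_ ?_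
        · refine lintegral_mono fun p => ?_
          simp only [Function.uncurry_apply_pair, eT]
          rw [lintegral_const_mul'' _ (by fun_prop)]
          gcongr; exact bKK _ _
        · rw [lintegral_mul_const' _ _ hH, lintegral_prod_mul mg.enorm.aemeasurable
            mg.enorm.aemeasurable]
          exact (ENNReal.mul_ne_top (ENNReal.mul_ne_top g1 g1) hH).lt_top
      have eG : ∀ z, G z * (starRingEnd ℂ) (G z) = ∫ p, T p z ∂(volume.prod volume) := by
        intro z
        rw [hG]; simp only
        rw [← integral_conj, ← integral_prod_mul]
      have intG : Integrable (fun z => G z * (starRingEnd ℂ) (G z)) := by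
        simp_rw [eG]
        exact intT.integral_prod_right
      rw [lintegral_enorm_sq_eq intG]
      simp_rw [eG]
      rw [← integral_integral_swap (f := T) intT]
      refine (enorm_integral_le_lintegral_enorm _).trans ?_
      have mTT : Measurable fun p : ℝ × ℝ => ‖∫ z, T p z‖ₑ :=
        (mT.stronglyMeasurable.integral_prod_right).measurable.enorm
      rw [lintegral_prod _ mTT.aemeasurable]
      refine le_trans ?_ (hN (fun x => ‖g x‖ₑ) mg.enorm)
      gcongr with x x'
      have : ∫ z, T (x, x') z = ((starRingEnd ℂ) (g x) * g x') *
          ∫ z, K x z * (starRingEnd ℂ) (K x' z) := by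
        rw [← integral_const_mul]
        congr 1; ext z
        simp only [hT, map_mul, Complex.conj_conj]; ring
      rw [this, enorm_mul, enorm_mul, ecg]
      gcongr; exact hΦ x x'
    by_cases hI0 : I = 0
    · rw [hI0]; exact zero_le
    · refine (ENNReal.mul_le_mul_iff_left hI0 g2).1 ?_
      calc I * I = I ^ 2 := (sq I).symm
        _ ≤ Ef * (N * I) := s1.trans (by gcongr)
        _ = _ := by ring
  have lim : ∫⁻ x, ‖F x‖ₑ ^ 2 = ⨆ R : ℕ, ∫⁻ x, ‖(Icc (-(R:ℝ)) R).indicator F x‖ₑ ^ 2 := by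
    rw [← lintegral_iSup]
    · congr 1; ext x
      apply le_antisymm
      · obtain ⟨R, hR⟩ := exists_nat_ge |x|
        refine le_iSup_of_le R ?_
        rw [indicator_of_mem (mem_Icc.2 (abs_le.1 hR))]
      · refine iSup_le fun R => ?_
        by_cases hx : x ∈ Icc (-(R:ℝ)) R
        · rw [indicator_of_mem hx]
        · simp [indicator_of_notMem hx]
    · intro R
      exact (mF.indicator measurableSet_Icc).enorm.pow_const 2
    · intro R S hRS x
      have hRS' : (R:ℝ) ≤ S := by exact_mod_cast hRS
      by_cases hx : x ∈ Icc (-(R:ℝ)) R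
      · have hx' : x ∈ Icc (-(S:ℝ)) S := ⟨by linarith [hx.1], by linarith [hx.2]⟩
        simp only [indicator_of_mem hx, indicator_of_mem hx']; exact le_rfl
      · simp [indicator_of_notMem hx]
  rw [lim]
  exact iSup_le main

end CE


namespace CE

lemma bilin_two {ρ ρ' : ℝ → ℝ} (hρ : Measurable ρ) (hρ' : Measurable ρ')
    {a b a' b' : ℝ} (ha : 0 < a) (ha' : 0 < a') (hab : ∀ x, a ≤ ρ x ∧ ρ x ≤ b)
    (hab' : ∀ x, a' ≤ ρ' x ∧ ρ' x ≤ b') {α β : ℝ} (hα : 0 ≤ α) (hβ : 0 ≤ β)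
    {g : ℝ → ℝ≥0∞} (hg : Measurable g) :
    ∫⁻ x, ∫⁻ x', g x * g x' * ENNReal.ofReal (α * (pk (ρ x) (x - x') + pk (ρ x') (x - x')) +
      β * (pk (ρ' x) (x - x') + pk (ρ' x') (x - x'))) ≤
      ENNReal.ofReal (120 * (α + β)) * ∫⁻ x, g x ^ 2 := by
  have p1 := PB_main hρ ha hab
  have p2 := PB_main hρ' ha' hab'
  rw [ENNReal.ofReal_pow (by norm_num)] at p1 p2
  have q1 := PB_bilin hρ p1 hg
  have q2 := PB_bilin hρ' p2 hg
  have h0 : ∀ x, 0 < ρ x := fun x => ha.trans_le (hab x).1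
  have h0' : ∀ x, 0 < ρ' x := fun x => ha'.trans_le (hab' x).1
  set A : ℝ → ℝ → ℝ≥0∞ := fun x x' => g x * g x' * (ENNReal.ofReal (pk (ρ x) (x - x')) +
      ENNReal.ofReal (pk (ρ x') (x - x'))) with hA
  set A' : ℝ → ℝ → ℝ≥0∞ := fun x x' => g x * g x' * (ENNReal.ofReal (pk (ρ' x) (x - x')) +
      ENNReal.ofReal (pk (ρ' x') (x - x'))) with hA'
  have e : ∀ x x', g x * g x' * ENNReal.ofReal (α * (pk (ρ x) (x - x') + pk (ρ x') (x - x')) +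
      β * (pk (ρ' x) (x - x') + pk (ρ' x') (x - x'))) =
      ENNReal.ofReal α * A x x' + ENNReal.ofReal β * A' x x' := by
    intro x x'
    have i1 := pk_nonneg (h0 x) (x - x')
    have i2 := pk_nonneg (h0 x') (x - x')
    have i3 := pk_nonneg (h0' x) (x - x')
    have i4 := pk_nonneg (h0' x') (x - x')
    rw [ENNReal.ofReal_add (by positivity) (by positivity), ENNReal.ofReal_mul hα,
      ENNReal.ofReal_mul hβ, ENNReal.ofReal_add i1 i2, ENNReal.ofReal_add i3 i4]
    simp only [hA, hA']; ring
  simp_rw [e]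
  have mA : Measurable (Function.uncurry A) := by
    simp only [hA, Function.uncurry_def]; fun_prop
  have mA' : Measurable (Function.uncurry A') := by
    simp only [hA', Function.uncurry_def]; fun_prop
  have mA1 : ∀ x, Measurable (A x) := fun x => mA.of_uncurry_left
  have mA2 : ∀ x, Measurable (A' x) := fun x => mA'.of_uncurry_left
  calc ∫⁻ x, ∫⁻ x', ENNReal.ofReal α * A x x' + ENNReal.ofReal β * A' x x'
      = ∫⁻ x, (ENNReal.ofReal α * ∫⁻ x', A x x') + ENNReal.ofReal β * ∫⁻ x', A' x x' := by
        congr 1; ext x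
        rw [lintegral_add_left ((mA1 x).const_mul _), lintegral_const_mul _ (mA1 x),
          lintegral_const_mul _ (mA2 x)]
    _ = ENNReal.ofReal α * (∫⁻ x, ∫⁻ x', A x x') + ENNReal.ofReal β * ∫⁻ x, ∫⁻ x', A' x x' := by
        have mm : Measurable fun x => ∫⁻ x', A x x' := mA.lintegral_prod_right'
        rw [lintegral_add_left (mm.const_mul _),
          lintegral_const_mul' _ _ ENNReal.ofReal_ne_top,
          lintegral_const_mul' _ _ ENNReal.ofReal_ne_top]
    _ ≤ ENNReal.ofReal α * (2 * ENNReal.ofReal 60 * ∫⁻ x, g x ^ 2) +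
        ENNReal.ofReal β * (2 * ENNReal.ofReal 60 * ∫⁻ x, g x ^ 2) := by gcongr
    _ = _ := by
        rw [mul_add, ENNReal.ofReal_add (by positivity) (by positivity),
          ENNReal.ofReal_mul (by norm_num), ENNReal.ofReal_mul (by norm_num)]
        have : (ENNReal.ofReal 120 : ℝ≥0∞) = 2 * ENNReal.ofReal 60 := by
          rw [← ENNReal.ofReal_ofNat 2, ← ENNReal.ofReal_mul (by norm_num)]; norm_num
        rw [this]; ring

lemma master_pk {K : ℝ → ℝ → ℂ} (hK : Measurable (Function.uncurry K)) {H : ℝ≥0∞} (hH : H ≠ ∞)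
    (hKH : ∀ x, ∫⁻ z, ‖K x z‖ₑ ^ 2 ≤ H)
    {ρ ρ' : ℝ → ℝ} (hρ : Measurable ρ) (hρ' : Measurable ρ')
    {a b a' b' : ℝ} (ha : 0 < a) (ha' : 0 < a') (hab : ∀ x, a ≤ ρ x ∧ ρ x ≤ b)
    (hab' : ∀ x, a' ≤ ρ' x ∧ ρ' x ≤ b') {α β : ℝ} (hα : 0 ≤ α) (hβ : 0 ≤ β)
    (hΦ : ∀ x x', ‖∫ z, K x z * (starRingEnd ℂ) (K x' z)‖ ≤
      α * (pk (ρ x) (x - x') + pk (ρ x') (x - x')) +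
      β * (pk (ρ' x) (x - x') + pk (ρ' x') (x - x')))
    {f : ℝ → ℂ} (hf : Measurable f) (hf2 : ∫⁻ z, ‖f z‖ₑ ^ 2 ≠ ∞) :
    ∫⁻ x, ‖∫ z, K x z * f z‖ₑ ^ 2 ≤ ENNReal.ofReal (120 * (α + β)) * ∫⁻ z, ‖f z‖ₑ ^ 2 := by
  refine master hK hH hKH (Φ := fun x x' => ENNReal.ofReal
    (α * (pk (ρ x) (x - x') + pk (ρ x') (x - x')) +
      β * (pk (ρ' x) (x - x') + pk (ρ' x') (x - x')))) ?_ ?_ hf hf2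
  · intro x x'
    rw [← ofReal_norm]
    exact ENNReal.ofReal_le_ofReal (hΦ x x')
  · intro g hg
    exact bilin_two hρ hρ' ha ha' hab hab' hα hβ hg

/-- conjugate Poisson kernel -/
noncomputable def qk (r y : ℝ) : ℝ := y / (r ^ 2 + y ^ 2)

@[fun_prop]
lemma measurable_qk {α : Type*} [MeasurableSpace α] {f g : α → ℝ} (hf : Measurable f)
    (hg : Measurable g) : Measurable (fun a => qk (f a) (g a)) := by
  unfold qk; fun_prop

lemma qk_sq_le {r : ℝ} (hr : 0 < r) (y : ℝ) : qk r y ^ 2 ≤ r⁻¹ * pk r y := by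
  unfold qk pk
  rw [div_pow, ← mul_div_assoc, inv_mul_cancel₀ hr.ne', div_le_div_iff₀ (by positivity) (by positivity)]
  nlinarith [sq_nonneg (r*y), sq_nonneg r, sq_nonneg (r^2), sq_nonneg y]

lemma integrable_qk_sq {r : ℝ} (hr : 0 < r) : Integrable (fun y => qk r y ^ 2) := by
  refine ((integrable_pk hr).const_mul r⁻¹).mono' (by fun_prop) (ae_of_all _ fun y => ?_)
  rw [Real.norm_of_nonneg (sq_nonneg _)]
  exact qk_sq_le hr y

lemma integrable_qk_mul {r s : ℝ} (hr : 0 < r) (hs : 0 < s) (u : ℝ) :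
    Integrable (fun y => qk r y * qk s (y - u)) := by
  refine ((integrable_qk_sq hr).add ((integrable_qk_sq hs).comp_sub_right u)).mono'
    (by fun_prop) (ae_of_all _ fun y => ?_)
  simp only [Pi.add_apply, Real.norm_eq_abs, abs_mul]
  nlinarith [sq_nonneg (|qk r y| - |qk s (y - u)|), sq_abs (qk r y), sq_abs (qk s (y - u)),
    abs_nonneg (qk r y), abs_nonneg (qk s (y-u))]

lemma pk_le_inv {r : ℝ} (hr : 0 < r) (y : ℝ) : pk r y ≤ r⁻¹ := by
  unfold pk
  rw [div_le_iff₀ (by positivity)]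
  have : r⁻¹ * (r^2 + y^2) = r + r⁻¹ * y^2 := by field_simp
  rw [this]
  have : 0 ≤ r⁻¹ * y^2 := by positivity
  linarith

lemma integrable_pk_mul {r s : ℝ} (hr : 0 < r) (hs : 0 < s) (u : ℝ) :
    Integrable (fun y => pk r y * pk s (y - u)) := by
  refine ((integrable_pk hr).mul_const s⁻¹).mono'
    (by fun_prop) (ae_of_all _ fun y => ?_)
  rw [Real.norm_of_nonneg (mul_nonneg (pk_nonneg hr _) (pk_nonneg hs _))]
  exact mul_le_mul_of_nonneg_left (pk_le_inv hs _) (pk_nonneg hr _)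

lemma tendsto_log_aux {l : Filter ℝ} (h1 : Tendsto (fun y : ℝ => y⁻¹) l (𝓝 0))
    (h2 : ∀ᶠ y in l, y ≠ 0) {r s : ℝ} (hr : 0 < r) (hs : 0 < s) (u : ℝ) :
    Tendsto (fun y => Real.log (r ^ 2 + y ^ 2) - Real.log (s ^ 2 + (y - u) ^ 2)) l (𝓝 0) := by
  have h3 : Tendsto (fun y : ℝ => Real.log ((r ^ 2 * (y⁻¹) ^ 2 + 1) /
      (s ^ 2 * (y⁻¹) ^ 2 + (1 - u * y⁻¹) ^ 2))) l (𝓝 0) := by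
    have : ContinuousAt (fun t : ℝ => Real.log ((r ^ 2 * t ^ 2 + 1) /
      (s ^ 2 * t ^ 2 + (1 - u * t) ^ 2))) 0 := by
      apply ContinuousAt.log
      · apply ContinuousAt.div (by fun_prop) (by fun_prop)
        simp
      · simp
    have h := this.tendsto.comp h1
    simpa [Function.comp_def] using h
  refine h3.congr' ?_
  filter_upwards [h2] with y hy
  rw [← Real.log_div (by positivity) (by positivity)]
  congr 1
  have : 0 < s ^ 2 + (y - u) ^ 2 := by positivity
  have h5 : s ^ 2 * (y⁻¹) ^ 2 + (1 - u * y⁻¹) ^ 2 = (s ^ 2 + (y - u) ^ 2) * (y⁻¹)^2 := by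
    field_simp
  have h6 : r ^ 2 * (y⁻¹) ^ 2 + 1 = (r ^ 2 + y ^ 2) * (y⁻¹)^2 := by field_simp
  rw [h5, h6, mul_div_mul_right]
  positivity

lemma integral_qk_mul {r s : ℝ} (hr : 0 < r) (hs : 0 < s) (u : ℝ) :
    ∫ y, qk r y * qk s (y - u) = ∫ y, pk r y * pk s (y - u) := by
  rw [← sub_eq_zero, ← integral_sub (integrable_qk_mul hr hs u) (integrable_pk_mul hr hs u)]
  have hint := (integrable_qk_mul hr hs u).sub (integrable_pk_mul hr hs u)
  have dy : ∀ y : ℝ, HasDerivAt (fun y : ℝ => r^2 + y^2) (2*y) y := fun y => by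
    simpa using ((hasDerivAt_id y).pow 2).const_add (r^2)
  by_cases hdeg : u = 0 ∧ s = r
  · obtain ⟨rfl, rfl⟩ := hdeg
    have hd : ∀ y, HasDerivAt (fun y => - qk s y)
        (qk s y * qk s (y - 0) - pk s y * pk s (y - 0)) y := by
      intro y
      have hne : s^2 + y^2 ≠ 0 := by positivity
      refine HasDerivAt.congr_deriv ((hasDerivAt_id y).div (dy y) hne).neg ?_
      simp only [qk, pk, sub_zero, id]; field_simp; ring
    have hlim : ∀ l : Filter ℝ, Tendsto (fun y : ℝ => y⁻¹) l (𝓝 0) → (∀ᶠ y in l, y ≠ 0) →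
        Tendsto (fun y => - qk s y) l (𝓝 0) := by
      intro l h1 h2
      have : ContinuousAt (fun t : ℝ => - (t / (s ^ 2 * t ^ 2 + 1))) 0 := by
        apply ContinuousAt.neg
        apply ContinuousAt.div (by fun_prop) (by fun_prop)
        simp
      have h := this.tendsto.comp h1
      simp only [Function.comp_def, zero_div, neg_zero] at h
      refine h.congr' ?_
      filter_upwards [h2] with y hy
      unfold qk; field_simp
    rw [integral_of_hasDerivAt_of_tendsto hd hint
      (hlim _ tendsto_inv_atBot_zero (eventually_ne_atBot 0))
      (hlim _ tendsto_inv_atTop_zero (eventually_ne_atTop 0)), sub_zero]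
  · have hc : 0 < u^2 + (s-r)^2 := by
      rcases not_and_or.1 hdeg with h | h
      · positivity
      · have := sub_ne_zero.2 h; positivity
    set L : ℝ → ℝ := fun y => -(u^2 + (s-r)^2)⁻¹ *
      (u * ((Real.log (r ^ 2 + y ^ 2) - Real.log (s ^ 2 + (y - u) ^ 2)) / 2) +
        (s - r) * (Real.arctan (y / r) - Real.arctan ((y - u) / s))) with hL
    have hd : ∀ y, HasDerivAt L
        (qk r y * qk s (y - u) - pk r y * pk s (y - u)) y := by
      intro y
      have hne : r^2 + y^2 ≠ 0 := by positivity
      have hne2 : s^2 + (y-u)^2 ≠ 0 := by positivity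
      have d2 : HasDerivAt (fun y : ℝ => s^2 + (y-u)^2) (2*(y-u)) y := by
        simpa using (((hasDerivAt_id y).sub_const u).pow 2).const_add (s^2)
      have d3 := ((hasDerivAt_id y).div_const r).arctan
      have d4 := (((hasDerivAt_id y).sub_const u).div_const s).arctan
      have d := (((((dy y).log hne).sub (d2.log hne2)).div_const 2).const_mul u).add
        ((d3.sub d4).const_mul (s - r))
      refine HasDerivAt.congr_deriv (d.const_mul (-(u^2 + (s-r)^2)⁻¹)) ?_
      simp only [qk, pk, id]
      have h7 : 1 + (y / r)^2 = (r^2+y^2) / r^2 := by field_simp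
      have h8 : 1 + ((y-u) / s)^2 = (s^2+(y-u)^2) / s^2 := by field_simp
      rw [h7, h8]
      field_simp
      ring
    have ptop : Tendsto Real.arctan atTop (𝓝 (Real.pi / 2)) :=
      Real.tendsto_arctan_atTop.mono_right nhdsWithin_le_nhds
    have pbot : Tendsto Real.arctan atBot (𝓝 (-(Real.pi / 2))) :=
      Real.tendsto_arctan_atBot.mono_right nhdsWithin_le_nhds
    have lim : ∀ (l : Filter ℝ) (m : ℝ), Tendsto (fun y : ℝ => y⁻¹) l (𝓝 0) → (∀ᶠ y in l, y ≠ 0) →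
        Tendsto Real.arctan l (𝓝 m) → Tendsto (fun y : ℝ => y / r) l l →
        Tendsto (fun y : ℝ => (y - u) / s) l l → Tendsto L l (𝓝 0) := by
      intro l m h1 h2 h3 h4 h5
      have := ((((tendsto_log_aux h1 h2 hr hs u).div_const 2).const_mul u).add
        (((h3.comp h4).sub (h3.comp h5)).const_mul (s - r))).const_mul (-(u^2 + (s-r)^2)⁻¹)
      simpa [hL] using this
    rw [integral_of_hasDerivAt_of_tendsto hd hint
      (lim _ _ tendsto_inv_atBot_zero (eventually_ne_atBot 0) pbot
        (tendsto_id.atBot_div_const hr)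
        ((tendsto_atBot_add_const_right _ (-u) tendsto_id).atBot_div_const hs))
      (lim _ _ tendsto_inv_atTop_zero (eventually_ne_atTop 0) ptop
        (tendsto_id.atTop_div_const hr)
        ((tendsto_atTop_add_const_right _ (-u) tendsto_id).atTop_div_const hs)), sub_zero]

lemma abs_integral_qk_mul_le {r s : ℝ} (hr : 0 < r) (hs : 0 < s) (u : ℝ) :
    |∫ y, qk r y * qk s (y - u)| ≤ 4 * Real.pi * (pk r u + pk s u) := by
  rw [integral_qk_mul hr hs u, abs_of_nonneg
    (integral_nonneg fun y => mul_nonneg (pk_nonneg hr _) (pk_nonneg hs _))]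
  have hi1 := ((integrable_pk hs).comp_sub_right u).const_mul (4 * pk r u)
  have hi2 := (integrable_pk hr).const_mul (4 * pk s u)
  calc _ ≤ ∫ y, (4 * pk r u * pk s (y - u) + 4 * pk s u * pk r y) := by
        refine integral_mono (integrable_pk_mul hr hs u) (hi1.add hi2) fun y => ?_
        have := pk_mul_le hr hs y (y - u)
        rwa [sub_sub_cancel] at this
    _ = _ := by
        rw [integral_add hi1 hi2, integral_const_mul, integral_const_mul,
          integral_sub_right_eq_self (pk s) u, integral_pk hr, integral_pk hs]
        ring

lemma qk_bound {ρ : ℝ → ℝ} (hρ : Measurable ρ) {a b : ℝ} (ha : 0 < a)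
    (hab : ∀ x, a ≤ ρ x ∧ ρ x ≤ b) {f : ℝ → ℂ} (hf : Measurable f) (hf2 : ∫⁻ z, ‖f z‖ₑ ^ 2 ≠ ∞) :
    ∫⁻ x, ‖∫ z, (qk (ρ x) (x - z) : ℂ) * f z‖ₑ ^ 2 ≤
      ENNReal.ofReal (120 * (4 * Real.pi + 0)) * ∫⁻ z, ‖f z‖ₑ ^ 2 := by
  have h0 : ∀ x, 0 < ρ x := fun x => ha.trans_le (hab x).1
  refine master_pk (K := fun x z => (qk (ρ x) (x - z) : ℂ)) (by fun_prop)
    (H := ENNReal.ofReal (a⁻¹ * Real.pi)) ENNReal.ofReal_ne_top ?_ hρ hρ ha ha hab hab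
    (by positivity) le_rfl ?_ hf hf2
  · intro x
    calc ∫⁻ z, ‖(qk (ρ x) (x - z) : ℂ)‖ₑ ^ 2 ≤
        ∫⁻ z, ENNReal.ofReal (a⁻¹) * ENNReal.ofReal (pk (ρ x) (x - z)) := by
          refine lintegral_mono fun z => ?_
          simp only
          rw [← ofReal_norm, Complex.norm_real, ← ENNReal.ofReal_pow (norm_nonneg _),
            Real.norm_eq_abs, sq_abs, ← ENNReal.ofReal_mul (by positivity)]
          apply ENNReal.ofReal_le_ofReal
          refine (qk_sq_le (h0 x) _).trans ?_
          have := pk_nonneg (h0 x) (x - z)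
          gcongr
          exact (hab x).1
      _ = _ := by
          rw [lintegral_const_mul _ (by fun_prop), lintegral_pk_sub_left (h0 x),
            ENNReal.ofReal_mul (by positivity)]
  · intro x x'
    simp only [Complex.conj_ofReal, ← Complex.ofReal_mul, integral_complex_ofReal,
      Complex.norm_real, Real.norm_eq_abs, zero_mul, add_zero]
    have e : ∫ z, qk (ρ x) (x - z) * qk (ρ x') (x' - z) =
        ∫ y, qk (ρ x) y * qk (ρ x') (y - (x - x')) := by
      rw [← integral_sub_left_eq_self (fun y => qk (ρ x) y * qk (ρ x') (y - (x - x'))) _ x]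
      congr 1; ext z
      rw [show x - z - (x - x') = x' - z by ring]
    rw [e]
    exact abs_integral_qk_mul_le (h0 x) (h0 x') (x - x')

end CE

namespace CE

lemma osc_abs {α β μ c B0 B1 σ : ℝ} (hαβ : α ≤ β) (hβ : β ≤ α + 1) (hμ : 0 < μ) (hc : 0 ≤ c)
    {φ φ' F F' h h' G : ℝ → ℝ}
    (dφ : ∀ s ∈ Icc α β, HasDerivAt φ (φ' s) s) (dF : ∀ s ∈ Icc α β, HasDerivAt F (F' s) s)
    (dh : ∀ s ∈ Icc α β, HasDerivAt h (h' s) s)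
    (cφ : ContinuousOn φ' (Icc α β)) (cF : ContinuousOn F' (Icc α β))
    (ch : ContinuousOn h' (Icc α β)) (cG : ContinuousOn G (Icc α β))
    (hG : ∀ s ∈ Icc α β, |G s| ≤ 1) (hF : ∀ s ∈ Icc α β, |F s| ≤ B0)
    (hF' : ∀ s ∈ Icc α β, |F' s| ≤ B1)
    (hσ : |σ| ≤ 1)
    (hrel : ∀ s ∈ Icc α β, F s * φ' s = G s * ((h s)^2 / ((h s)^2 + μ^2)))
    (hlow : ∀ s ∈ Icc α β, μ^2 / ((h s)^2 + μ^2) ≤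
      4 * μ^2 + c * (μ^2 * (σ * h' s) / ((h s)^2 + μ^2))) :
    ‖∫ s in α..β, Complex.exp (Complex.I * (φ s : ℂ)) * (G s : ℂ)‖ ≤
      2 * B0 + B1 + 4 * μ^2 + c * (Real.pi * μ) := by
  have hu : uIcc α β = Icc α β := uIcc_of_le hαβ
  have cφ0 : ContinuousOn φ (Icc α β) := fun s hs => (dφ s hs).continuousAt.continuousWithinAt
  have cF0 : ContinuousOn F (Icc α β) := fun s hs => (dF s hs).continuousAt.continuousWithinAt
  have ch0 : ContinuousOn h (Icc α β) := fun s hs => (dh s hs).continuousAt.continuousWithinAt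
  have hpos : ∀ s, 0 < (h s)^2 + μ^2 := fun s => by positivity
  have cq : ContinuousOn (fun s => μ^2 / ((h s)^2 + μ^2)) (Icc α β) :=
    ContinuousOn.div (by fun_prop) (by fun_prop) fun s _ => (hpos s).ne'
  have cq' : ContinuousOn (fun s => μ^2 * (σ * h' s) / ((h s)^2 + μ^2)) (Icc α β) :=
    ContinuousOn.div (by fun_prop) (by fun_prop) fun s _ => (hpos s).ne'
  have cE : ContinuousOn (fun s => Complex.exp (Complex.I * (φ s : ℂ))) (Icc α β) := by fun_prop
  have nE : ∀ s, ‖Complex.exp (Complex.I * (φ s : ℂ))‖ = 1 := fun s => by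
    rw [mul_comm]; exact Complex.norm_exp_ofReal_mul_I _
  have dE : ∀ s ∈ uIcc α β, HasDerivAt (fun s => Complex.exp (Complex.I * (φ s : ℂ)) * (F s : ℂ))
      (Complex.I * (Complex.exp (Complex.I * (φ s : ℂ)) * ((F s * φ' s : ℝ) : ℂ)) +
        Complex.exp (Complex.I * (φ s : ℂ)) * (F' s : ℂ)) s := by
    intro s hs
    rw [hu] at hs
    have := (((dφ s hs).ofReal_comp.const_mul Complex.I).cexp).mul (dF s hs).ofReal_comp
    refine HasDerivAt.congr_deriv this ?_
    push_cast; ring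
  have i1 : IntervalIntegrable
      (fun s => Complex.exp (Complex.I * (φ s : ℂ)) * ((F s * φ' s : ℝ) : ℂ)) volume α β := by
    apply ContinuousOn.intervalIntegrable; rw [hu]; fun_prop
  have i2 : IntervalIntegrable
      (fun s => Complex.exp (Complex.I * (φ s : ℂ)) * (F' s : ℂ)) volume α β := by
    apply ContinuousOn.intervalIntegrable; rw [hu]; fun_prop
  have i3 : IntervalIntegrable
      (fun s => Complex.exp (Complex.I * (φ s : ℂ)) * ((G s * (μ^2 / ((h s)^2 + μ^2)) : ℝ) : ℂ))
      volume α β := by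
    apply ContinuousOn.intervalIntegrable; rw [hu]
    refine cE.mul ?_
    exact Complex.continuous_ofReal.comp_continuousOn (cG.mul cq)
  have i4 : IntervalIntegrable (fun s => μ^2 / ((h s)^2 + μ^2)) volume α β := by
    apply ContinuousOn.intervalIntegrable; rw [hu]; exact cq
  have i5 : IntervalIntegrable (fun s => μ^2 * (σ * h' s) / ((h s)^2 + μ^2)) volume α β := by
    apply ContinuousOn.intervalIntegrable; rw [hu]; exact cq'
  have ibp := intervalIntegral.integral_eq_sub_of_hasDerivAt dE ((i1.const_mul _).add i2)
  rw [intervalIntegral.integral_add (i1.const_mul _) i2,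
    intervalIntegral.integral_const_mul] at ibp
  have b2 : ‖∫ s in α..β, Complex.exp (Complex.I * (φ s : ℂ)) * (F' s : ℂ)‖ ≤ B1 := by
    have := intervalIntegral.norm_integral_le_of_norm_le_const (a := α) (b := β)
      (f := fun s => Complex.exp (Complex.I * (φ s : ℂ)) * (F' s : ℂ)) (C := B1) ?_
    · refine this.trans ?_
      have h0 : 0 ≤ B1 := (abs_nonneg _).trans (hF' α ⟨le_rfl, hαβ⟩)
      rw [abs_of_nonneg (by linarith)]
      nlinarith
    · intro s hs
      rw [uIoc_of_le hαβ] at hs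
      rw [norm_mul, nE, one_mul, Complex.norm_real]
      exact hF' s ⟨hs.1.le, hs.2⟩
  have nF : ∀ s ∈ Icc α β, ‖Complex.exp (Complex.I * (φ s : ℂ)) * (F s : ℂ)‖ ≤ B0 := by
    intro s hs
    rw [norm_mul, nE, one_mul, Complex.norm_real]; exact hF s hs
  have b1 : ‖∫ s in α..β, Complex.exp (Complex.I * (φ s : ℂ)) * ((F s * φ' s : ℝ) : ℂ)‖ ≤
      2 * B0 + B1 := by
    have e := eq_sub_of_add_eq ibp
    have : ‖∫ s in α..β, Complex.exp (Complex.I * (φ s : ℂ)) * ((F s * φ' s : ℝ) : ℂ)‖ =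
      ‖Complex.I * ∫ s in α..β, Complex.exp (Complex.I * (φ s : ℂ)) * ((F s * φ' s : ℝ) : ℂ)‖ := by
      simp
    rw [this, e]
    refine (norm_sub_le _ _).trans ?_
    refine add_le_add ((norm_sub_le _ _).trans ?_) b2
    linarith [nF β ⟨hαβ, le_rfl⟩, nF α ⟨le_rfl, hαβ⟩]
  have b3 : ‖∫ s in α..β, Complex.exp (Complex.I * (φ s : ℂ)) *
      ((G s * (μ^2 / ((h s)^2 + μ^2)) : ℝ) : ℂ)‖ ≤ 4 * μ^2 + c * (Real.pi * μ) := by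
    calc _ ≤ ∫ s in α..β, μ^2 / ((h s)^2 + μ^2) := by
          refine intervalIntegral.norm_integral_le_of_norm_le hαβ ?_ i4
          refine Eventually.of_forall fun s hs => ?_
          rw [norm_mul, nE, one_mul, Complex.norm_real, Real.norm_eq_abs, abs_mul,
            abs_of_nonneg (a := μ^2 / ((h s)^2 + μ^2)) (by positivity)]
          exact mul_le_of_le_one_left (by positivity) (hG s ⟨hs.1.le, hs.2⟩)
      _ ≤ ∫ s in α..β, (4 * μ^2 + c * (μ^2 * (σ * h' s) / ((h s)^2 + μ^2))) :=
          intervalIntegral.integral_mono_on hαβ i4 ((by simp : IntervalIntegrable _ _ _ _).add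
            (i5.const_mul _)) hlow
      _ = (β - α) * (4 * μ^2) + c * (σ * μ * Real.arctan (h β / μ) -
            σ * μ * Real.arctan (h α / μ)) := by
          rw [intervalIntegral.integral_add (by simp) (i5.const_mul _),
            intervalIntegral.integral_const, intervalIntegral.integral_const_mul, smul_eq_mul]
          congr 2
          refine intervalIntegral.integral_eq_sub_of_hasDerivAt
            (f := fun s => σ * μ * Real.arctan (h s / μ)) (fun s hs => ?_) i5
          rw [hu] at hs
          refine HasDerivAt.congr_deriv ((((dh s hs).div_const μ).arctan).const_mul (σ * μ)) ?_
          have : 1 + (h s / μ)^2 = ((h s)^2 + μ^2) / μ^2 := by field_simp; ring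
          rw [this]; field_simp
      _ ≤ _ := by
          have e1 : (β - α) * (4 * μ^2) ≤ 4 * μ^2 := by nlinarith [sq_nonneg μ]
          have a1 := Real.arctan_lt_pi_div_two (h β / μ)
          have a2 := Real.neg_pi_div_two_lt_arctan (h β / μ)
          have a3 := Real.arctan_lt_pi_div_two (h α / μ)
          have a4 := Real.neg_pi_div_two_lt_arctan (h α / μ)
          have e2 : σ * (Real.arctan (h β / μ) - Real.arctan (h α / μ)) ≤ Real.pi := by
            refine (le_abs_self _).trans ?_
            rw [abs_mul]
            calc _ ≤ 1 * |Real.arctan (h β / μ) - Real.arctan (h α / μ)| := by gcongr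
              _ ≤ _ := by rw [one_mul, abs_le]; constructor <;> linarith
          have e3 : σ * μ * Real.arctan (h β / μ) - σ * μ * Real.arctan (h α / μ) ≤
              Real.pi * μ := by nlinarith
          gcongr
  have esp : ∫ s in α..β, Complex.exp (Complex.I * (φ s : ℂ)) * (G s : ℂ) =
      (∫ s in α..β, Complex.exp (Complex.I * (φ s : ℂ)) * ((F s * φ' s : ℝ) : ℂ)) +
      ∫ s in α..β, Complex.exp (Complex.I * (φ s : ℂ)) *
      ((G s * (μ^2 / ((h s)^2 + μ^2)) : ℝ) : ℂ) := by
    rw [← intervalIntegral.integral_add i1 i3]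
    refine intervalIntegral.integral_congr fun s hs => ?_
    rw [hu] at hs
    rw [hrel s hs, ← mul_add, ← Complex.ofReal_add, ← mul_add, ← add_div, div_self (hpos s).ne',
      mul_one]
  rw [esp]
  refine (norm_add_le _ _).trans ?_
  linarith

end CE

namespace CE

lemma rpow_le_D {s e ε : ℝ} (h1 : 1 ≤ s) (h2 : s ≤ 2) (he : e ≤ |ε| + 1) :
    s ^ e ≤ (2:ℝ) ^ (|ε| + 1) :=
  (Real.rpow_le_rpow_of_exponent_le h1 he).trans
    (Real.rpow_le_rpow (by linarith) h2 (by positivity))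

lemma le_two_rpow (x : ℝ) : x ≤ (2:ℝ) ^ x := by
  have h2 : (2:ℝ) ^ x = Real.exp (x * Real.log 2) := by
    rw [Real.rpow_def_of_pos two_pos, mul_comm]
  rw [h2]
  by_cases hx : x ≤ 0
  · exact hx.trans (Real.exp_pos _).le
  push Not at hx
  have hl := Real.log_two_gt_d9
  have := Real.quadratic_le_exp_of_nonneg (x := x * Real.log 2) (by positivity)
  nlinarith [sq_nonneg (x * Real.log 2 - 1), sq_nonneg (x-2), sq_nonneg (Real.log 2 - 0.69)]

lemma aux_q1 {μ : ℝ} (hμ0 : 0 < μ) (h : ℝ) : |h / (h^2 + μ^2)| ≤ 1 / μ := by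
  have hpos : 0 < h^2 + μ^2 := by positivity
  rw [abs_div, abs_of_pos hpos, div_le_div_iff₀ hpos hμ0]
  nlinarith [sq_abs h, sq_nonneg (|h| - μ), sq_nonneg μ, sq_nonneg h, abs_nonneg h]

lemma aux_q2 {μ : ℝ} (hμ0 : 0 < μ) (h : ℝ) : |(μ^2 - h^2) / (h^2 + μ^2)^2| ≤ 1 / μ^2 := by
  have hpos : 0 < h^2 + μ^2 := by positivity
  rw [abs_div, abs_of_pos (by positivity : 0 < (h^2 + μ^2)^2),
    div_le_div_iff₀ (by positivity) (by positivity)]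
  have : |μ^2 - h^2| ≤ h^2 + μ^2 := by
    rw [abs_le]; constructor <;> nlinarith [sq_nonneg μ, sq_nonneg h]
  calc |μ^2 - h^2| * μ^2 ≤ (h^2 + μ^2) * (h^2 + μ^2) := by
        gcongr; linarith [sq_nonneg h]
    _ = _ := by ring

set_option maxHeartbeats 2000000 in
lemma osc_main {δ ε m Λ κ v α β : ℝ} (hδ : 0 < δ) (hδ1 : δ < 1) (hε : δ < |ε|) (hε1 : δ < |ε - 1|)
    (hm : 1 ≤ m) (hΛ : |Λ| = m ^ 8) (hκ : 1 ≤ κ) (hv : κ / m ≤ |v|) (hαβ : α ≤ β)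
    (hα : 1 ≤ α) (hβ : β ≤ 2) (ht : ∀ s ∈ Icc α β, 1 ≤ (s + v) / κ ∧ (s + v) / κ ≤ 2) :
    ‖∫ s in α..β, Complex.exp (Complex.I * ((Λ * (((s + v) / κ) ^ ε - s ^ ε) : ℝ) : ℂ)) *
      (((s * ((s + v) / κ))⁻¹ : ℝ) : ℂ)‖ ≤ 10 * ((2:ℝ) ^ (|ε| + 1)) ^ 3 / δ / m := by
  set D : ℝ := (2:ℝ) ^ (|ε| + 1) with hD
  have hm0 : 0 < m := by linarith
  have hκ0 : 0 < κ := by linarith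
  have hD2 : 2 ≤ D := by
    calc (2:ℝ) = 2 ^ (1:ℝ) := by simp
      _ ≤ D := Real.rpow_le_rpow_of_exponent_le (by norm_num) (by linarith [abs_nonneg ε])
  have hεD : |ε| + 1 ≤ D := le_two_rpow _
  have hε1D : |ε - 1| ≤ D := by
    have := abs_sub ε 1
    rw [abs_one] at this
    linarith
  have hε0 : ε ≠ 0 := by rintro rfl; simp at hε; linarith
  have hΛ0 : Λ ≠ 0 := by rintro rfl; simp only [abs_zero] at hΛ; exact absurd hΛ (by positivity)
  set μ : ℝ := (m^2)⁻¹ with hμ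
  have hμ0 : 0 < μ := by positivity
  have hμ1 : μ ≤ 1 := inv_le_one_of_one_le₀ (by nlinarith)
  set t : ℝ → ℝ := fun s => (s + v) / κ with htd
  have dt : ∀ s, HasDerivAt t (1 / κ) s := fun s => ((hasDerivAt_id s).add_const v).div_const κ
  have s0 : ∀ s ∈ Icc α β, 0 < s := fun s hs => by linarith [hs.1]
  have t0 : ∀ s ∈ Icc α β, 0 < t s := fun s hs => by linarith [(ht s hs).1]
  have hvt : ∀ s, v = κ * t s - s := fun s => by simp only [htd]; field_simp; ring
  set H : ℝ → ℝ := fun s => κ⁻¹ * (t s ^ (ε - 1) * s ^ (1 - ε)) with hH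
  have dtp : ∀ s ∈ Icc α β, ∀ p : ℝ, HasDerivAt (fun s => t s ^ p) (p * t s ^ (p-1) / κ) s := by
    intro s hs p
    refine HasDerivAt.congr_deriv ((dt s).rpow_const (p := p) (Or.inl (t0 s hs).ne')) ?_
    ring
  have dsp : ∀ s ∈ Icc α β, ∀ p : ℝ, HasDerivAt (fun s : ℝ => s ^ p) (p * s ^ (p-1)) s := by
    intro s hs p
    exact Real.hasDerivAt_rpow_const (Or.inl (s0 s hs).ne')
  have ct : ContinuousOn t (Icc α β) := fun s hs => (dt s).continuousAt.continuousWithinAt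
  have ctp : ∀ p : ℝ, ContinuousOn (fun s => t s ^ p) (Icc α β) := fun p s hs =>
    (dtp s hs p).continuousAt.continuousWithinAt
  have csp : ∀ p : ℝ, ContinuousOn (fun s : ℝ => s ^ p) (Icc α β) := fun p s hs =>
    (dsp s hs p).continuousAt.continuousWithinAt
  have H0 : ∀ s ∈ Icc α β, 0 < H s := fun s hs => by
    have := s0 s hs; have := t0 s hs; positivity
  have dH : ∀ s ∈ Icc α β, HasDerivAt H (-(H s * (ε - 1) * v / (κ * (t s) * s))) s := by
    intro s hs
    have h1 := s0 s hs
    have h2 := t0 s hs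
    refine HasDerivAt.congr_deriv (((dtp s hs (ε-1)).mul (dsp s hs (1-ε))).const_mul κ⁻¹) ?_
    simp only [hH]
    rw [Real.rpow_sub_one h2.ne' (ε-1), Real.rpow_sub_one h1.ne' (1-ε)]
    rw [hvt s]
    field_simp
    ring
  have cH : ContinuousOn H (Icc α β) := fun s hs => (dH s hs).continuousAt.continuousWithinAt
  have cs' : ContinuousOn (fun s : ℝ => s) (Icc α β) := continuousOn_id
  have ch' : ContinuousOn (fun s => -(H s * (ε - 1) * v / (κ * (t s) * s))) (Icc α β) := by
    refine (ContinuousOn.div (by fun_prop) (by fun_prop) fun s hs => ?_).neg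
    have := s0 s hs; have := t0 s hs; positivity
  set h : ℝ → ℝ := fun s => H s - 1 with hh
  have dh : ∀ s ∈ Icc α β, HasDerivAt h (-(H s * (ε - 1) * v / (κ * (t s) * s))) s :=
    fun s hs => (dH s hs).sub_const 1
  have ch : ContinuousOn h (Icc α β) := fun s hs => (dh s hs).continuousAt.continuousWithinAt
  set h' : ℝ → ℝ := fun s => -(H s * (ε - 1) * v / (κ * (t s) * s)) with hh'
  have hpos : ∀ s, 0 < (h s)^2 + μ^2 := fun s => by positivity
  -- bounds
  have hab' : ∀ s ∈ Icc α β, |h' s| = H s * |ε - 1| * |v| / (κ * t s * s) := by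
    intro s hs
    have h1 := s0 s hs
    have h2 := t0 s hs
    simp only [hh']
    rw [abs_neg, abs_div, abs_mul, abs_mul, abs_of_pos (H0 s hs),
      abs_of_pos (by positivity : 0 < κ * t s * s)]
  have hup : ∀ s ∈ Icc α β, |h' s| ≤ 2 * D ^ 2 := by
    intro s hs
    have h1 := s0 s hs
    have h2 := t0 s hs
    have t1 := ht s hs
    change 1 ≤ t s ∧ t s ≤ 2 at t1
    have hHD : H s ≤ D := by
      simp only [hH]
      have e : t s ^ (ε - 1) * s ^ (1 - ε) ≤ D := by
        have e1 : s ^ (1 - ε) = (s ^ (ε - 1))⁻¹ := by rw [← Real.rpow_neg h1.le]; congr 1; ring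
        rw [e1, ← div_eq_mul_inv, ← Real.div_rpow h2.le h1.le]
        have q0 : 0 < t s / s := by positivity
        have q2 : t s / s ≤ 2 := by rw [div_le_iff₀ h1]; linarith [hs.1]
        have q3 : (t s / s)⁻¹ ≤ 2 := by
          rw [inv_div, div_le_iff₀ h2]; linarith [hs.2]
        by_cases q1 : 1 ≤ t s / s
        · exact rpow_le_D q1 q2 (by linarith [le_abs_self ε])
        · push Not at q1
          rw [← inv_inv (t s / s), Real.inv_rpow (by positivity), ← Real.rpow_neg (by positivity)]
          refine rpow_le_D (one_le_inv_iff₀.2 ⟨q0, q1.le⟩) q3 (by linarith [neg_abs_le ε])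
      have e0 : 0 ≤ t s ^ (ε - 1) * s ^ (1 - ε) := by positivity
      calc _ ≤ 1 * (t s ^ (ε - 1) * s ^ (1 - ε)) := by
            gcongr; exact inv_le_one_of_one_le₀ hκ
        _ ≤ D := by rw [one_mul]; exact e
    have hvk : |v| ≤ 2 * κ := by
      rw [abs_le, hvt s]
      constructor <;> nlinarith [hs.1, hs.2]
    rw [hab' s hs, div_le_iff₀ (by positivity)]
    calc H s * |ε - 1| * |v| ≤ D * D * (2 * κ) := by
          have := (H0 s hs).le
          gcongr
      _ = 2 * D ^ 2 * (κ * 1 * 1) := by ring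
      _ ≤ _ := by gcongr; exact t1.1; linarith [hs.1]
  have hdn : ∀ s ∈ Icc α β, H s * (δ / (4 * m)) ≤ |h' s| := by
    intro s hs
    have h1 := s0 s hs
    have h2 := t0 s hs
    have h3 := H0 s hs
    have t1 := ht s hs
    change 1 ≤ t s ∧ t s ≤ 2 at t1
    rw [hab' s hs, le_div_iff₀ (by positivity)]
    calc H s * (δ / (4 * m)) * (κ * t s * s) ≤ H s * (δ / (4 * m)) * (κ * 2 * 2) := by
          gcongr
          · exact t1.2
          · linarith [hs.2]
      _ = H s * δ * (κ / m) := by field_simp; ring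
      _ ≤ _ := by gcongr
  set σ : ℝ := if 0 ≤ -((ε - 1) * v) then 1 else -1 with hσ
  have hσ1 : |σ| ≤ 1 := by rw [hσ]; split_ifs <;> simp
  have hσh : ∀ s ∈ Icc α β, σ * h' s = |h' s| := by
    intro s hs
    have h1 := s0 s hs
    have h2 := t0 s hs
    have h3 := H0 s hs
    have e : h' s = -((ε - 1) * v) * (H s / (κ * t s * s)) := by simp only [hh']; ring
    have e2 : 0 < H s / (κ * t s * s) := by positivity
    rw [e, abs_mul, abs_of_pos e2, hσ]
    split_ifs with q
    · rw [abs_of_nonneg q]; ring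
    · rw [abs_of_neg (not_le.1 q)]; ring
  set φ : ℝ → ℝ := fun s => Λ * (t s ^ ε - s ^ ε) with hφ
  set F : ℝ → ℝ := fun s => (Λ * ε)⁻¹ * (s ^ (-ε) * (t s) ^ (-1 : ℝ) * (h s / ((h s)^2 + μ^2)))
    with hF
  set q' : ℝ → ℝ := fun s => (h' s * ((h s)^2 + μ^2) - h s * (2 * h s * h' s)) /
    ((h s)^2 + μ^2)^2 with hq'
  have dq : ∀ s ∈ Icc α β, HasDerivAt (fun s => h s / ((h s)^2 + μ^2)) (q' s) s := by
    intro s hs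
    have d1 : HasDerivAt (fun s => (h s)^2 + μ^2) (2 * h s * h' s) s := by
      refine HasDerivAt.congr_deriv (((dh s hs).pow 2).add_const (μ^2)) ?_
      simp [hh']
    exact (dh s hs).div d1 (hpos s).ne'
  have cq' : ContinuousOn q' (Icc α β) :=
    ContinuousOn.div (by fun_prop) (by fun_prop) fun s _ => pow_ne_zero 2 (hpos s).ne'
  have cq : ContinuousOn (fun s => h s / ((h s)^2 + μ^2)) (Icc α β) :=
    fun s hs => (dq s hs).continuousAt.continuousWithinAt
  set F' : ℝ → ℝ := fun s => (Λ * ε)⁻¹ * ((-ε * s ^ (-ε - 1) * (t s) ^ (-1 : ℝ) +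
    s ^ (-ε) * (-1 * (t s) ^ (-1 - 1 : ℝ) / κ)) * (h s / ((h s)^2 + μ^2)) +
    s ^ (-ε) * (t s) ^ (-1 : ℝ) * q' s) with hF'
  have dF : ∀ s ∈ Icc α β, HasDerivAt F (F' s) s := fun s hs =>
    ((((dsp s hs (-ε)).mul (dtp s hs (-1))).mul (dq s hs)).const_mul (Λ * ε)⁻¹)
  have dφ : ∀ s ∈ Icc α β, HasDerivAt φ (Λ * (ε * t s ^ (ε - 1) / κ - ε * s ^ (ε - 1))) s :=
    fun s hs => ((dtp s hs ε).sub (dsp s hs ε)).const_mul Λ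
  have hq : ∀ s, |h s / ((h s)^2 + μ^2)| ≤ 1 / μ := by
    intro s
    exact aux_q1 hμ0 _
  have hq'b : ∀ s ∈ Icc α β, |q' s| ≤ 2 * D^2 / μ^2 := by
    intro s hs
    have e : q' s = h' s * ((μ^2 - (h s)^2) / ((h s)^2 + μ^2)^2) := by
      simp only [hq']; ring
    rw [e, abs_mul]
    have e2 : |(μ^2 - (h s)^2) / ((h s)^2 + μ^2)^2| ≤ 1 / μ^2 := by
      exact aux_q2 hμ0 _
    calc _ ≤ (2 * D^2) * (1 / μ^2) := by
          gcongr; exact hup s hs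
      _ = _ := by ring
  have hsD : ∀ s ∈ Icc α β, s ^ (-ε) ≤ D := fun s hs =>
    rpow_le_D (by linarith [hs.1]) (by linarith [hs.2]) (by linarith [neg_abs_le ε])
  have hsD' : ∀ s ∈ Icc α β, s ^ (-ε - 1) ≤ D := fun s hs =>
    rpow_le_D (by linarith [hs.1]) (by linarith [hs.2]) (by linarith [neg_abs_le ε])
  have ht1 : ∀ s ∈ Icc α β, t s ^ (-1 : ℝ) ≤ 1 := fun s hs =>
    Real.rpow_le_one_of_one_le_of_nonpos (ht s hs).1 (by norm_num)
  have ht2 : ∀ s ∈ Icc α β, t s ^ (-1 - 1 : ℝ) ≤ 1 := fun s hs =>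
    Real.rpow_le_one_of_one_le_of_nonpos (ht s hs).1 (by norm_num)
  have hΛε : |(Λ * ε)⁻¹| ≤ 1 / (m ^ 8 * δ) := by
    rw [abs_inv, abs_mul, hΛ, one_div]
    gcongr
  have key := osc_abs (α := α) (β := β) (μ := μ) (c := 8 * m / δ)
    (B0 := 1 / (m ^ 8 * δ) * (D * 1 * (1 / μ)))
    (B1 := 1 / (m ^ 8 * δ) * ((D * D * 1 + D * 1) * (1 / μ) + D * 1 * (2 * D ^ 2 / μ ^ 2)))
    (σ := σ) hαβ (by linarith) hμ0 (by positivity)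
    (G := fun s => (s * t s)⁻¹) dφ dF dh (by fun_prop) (by fun_prop) ch' ?_ ?_ ?_ ?_ hσ1 ?_ ?_
  · refine key.trans ?_
    have hμm : μ = 1 / m^2 := by rw [hμ]; simp
    have e1 : 1 / (m ^ 8 * δ) * (D * 1 * (1 / μ)) = D / δ * (1 / m ^ 6) := by
      rw [hμm]; field_simp
    have e2 : 1 / (m ^ 8 * δ) * ((D * D * 1 + D * 1) * (1 / μ) + D * 1 * (2 * D ^ 2 / μ ^ 2)) =
      (D * D + D) / δ * (1 / m ^ 6) + 2 * D ^ 3 / δ * (1 / m ^ 4) := by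
      rw [hμm]; field_simp
    have e3 : 4 * μ ^ 2 = 4 * (1 / m ^ 4) := by rw [hμm]; ring
    have e4 : 8 * m / δ * (Real.pi * μ) = 8 * Real.pi / δ * (1 / m) := by rw [hμm]; field_simp
    rw [e1, e2, e3, e4]
    have f6 : 1 / m ^ 6 ≤ 1 / m := by
      apply one_div_le_one_div_of_le hm0; exact le_self_pow₀ hm (by norm_num)
    have f4 : 1 / m ^ 4 ≤ 1 / m := by
      apply one_div_le_one_div_of_le hm0; exact le_self_pow₀ hm (by norm_num)
    have p1 : 0 ≤ 1 / m := by positivity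
    calc _ ≤ 2 * (D / δ * (1 / m)) + ((D * D + D) / δ * (1 / m) + 2 * D ^ 3 / δ * (1 / m)) +
          4 * (1 / m) + 8 * Real.pi / δ * (1 / m) := by gcongr
      _ = (2 * D + D * D + D + 2 * D ^ 3 + 4 * δ + 8 * Real.pi) / δ * (1 / m) := by
          field_simp; ring
      _ ≤ (10 * D ^ 3) / δ * (1 / m) := by
          gcongr
          have := Real.pi_lt_four
          have q2 : 4 ≤ D ^ 2 := by nlinarith
          have q3 : 2 * D ^ 2 ≤ D ^ 3 := by nlinarith [sq_nonneg D]
          have := Real.pi_lt_d2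
          nlinarith
      _ = _ := by ring
  · refine ContinuousOn.inv₀ (by fun_prop) fun s hs => ?_
    have := s0 s hs; have := t0 s hs; positivity
  · intro s hs
    have h1 := s0 s hs
    have h2 := t0 s hs
    have t1 := ht s hs
    rw [abs_of_pos (by positivity)]
    apply inv_le_one_of_one_le₀
    change 1 ≤ t s ∧ t s ≤ 2 at t1
    nlinarith [hs.1, t1.1]
  · intro s hs
    have h1 := s0 s hs
    have h2 := t0 s hs
    simp only [hF]
    rw [abs_mul, abs_mul, abs_of_pos (by positivity : 0 < s ^ (-ε) * t s ^ (-1:ℝ))]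
    gcongr
    · exact hsD s hs
    · exact ht1 s hs
    · exact hq s
  · intro s hs
    have h1 := s0 s hs
    have h2 := t0 s hs
    simp only [hF']
    rw [abs_mul]
    gcongr
    refine (abs_add_le _ _).trans ?_
    rw [abs_mul, abs_mul (s ^ (-ε) * t s ^ (-1:ℝ)),
      abs_of_pos (by positivity : 0 < s ^ (-ε) * t s ^ (-1:ℝ))]
    gcongr
    · refine (abs_add_le _ _).trans ?_
      rw [abs_mul, abs_mul, abs_neg, abs_mul, abs_of_pos (by positivity : 0 < s ^ (-ε - 1)),
        abs_of_pos (by positivity : 0 < t s ^ (-1:ℝ)), abs_of_pos (by positivity : 0 < s ^ (-ε))]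
      have z : |-1 * t s ^ (-1 - 1 : ℝ) / κ| ≤ 1 := by
        rw [abs_div, abs_mul, abs_neg, abs_one, one_mul, abs_of_pos (by positivity),
          abs_of_pos hκ0]
        exact div_le_one_of_le₀ ((ht2 s hs).trans hκ) hκ0.le
      gcongr
      · linarith
      · exact hsD' s hs
      · exact ht1 s hs
      · exact hsD s hs
    · exact hq s
    · exact hsD s hs
    · exact ht1 s hs
    · exact hq'b s hs
  · intro s hs
    have h1 := s0 s hs
    have h2 := t0 s hs
    have e1 : t s ^ (ε - 1) / κ = s ^ (ε - 1) * (h s + 1) := by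
      simp only [hh, hH]
      have : s ^ (1 - ε) = (s ^ (ε - 1))⁻¹ := by rw [← Real.rpow_neg h1.le]; congr 1; ring
      rw [this]; field_simp; ring
    have e2 : s ^ (-ε) * s ^ (ε - 1) = s⁻¹ := by
      rw [← Real.rpow_add h1, ← Real.rpow_neg_one]; congr 1; ring
    have e3 : t s ^ (-1 : ℝ) = (t s)⁻¹ := Real.rpow_neg_one _
    have := hpos s
    calc F s * (Λ * (ε * t s ^ (ε - 1) / κ - ε * s ^ (ε - 1)))
        = F s * (Λ * ε * (t s ^ (ε - 1) / κ - s ^ (ε - 1))) := by ring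
      _ = (s ^ (-ε) * s ^ (ε - 1)) * t s ^ (-1 : ℝ) * ((h s)^2 / ((h s)^2 + μ^2)) := by
          rw [e1]; simp only [hF]; field_simp; ring
      _ = _ := by rw [e2, e3, mul_inv]
  · intro s hs
    have := hpos s
    rw [hσh s hs]
    have hd := hdn s hs
    have hHs := H0 s hs
    by_cases hc : (1/2 : ℝ) ≤ |h s|
    · have : μ^2 / ((h s)^2 + μ^2) ≤ 4 * μ^2 := by
        rw [div_le_iff₀ (hpos s)]
        have : (1/4 : ℝ) ≤ (h s)^2 := by rw [← sq_abs]; nlinarith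
        nlinarith [sq_nonneg μ, sq_nonneg (μ^2)]
      have : 0 ≤ 8 * m / δ * (μ^2 * |h' s| / ((h s)^2 + μ^2)) := by positivity
      linarith
    · push Not at hc
      have hH2 : 1/2 ≤ H s := by
        have := (abs_lt.1 hc).1
        simp only [hh] at this
        linarith
      have : 1 ≤ 8 * m / δ * |h' s| := by
        calc (1:ℝ) = 8 * m / δ * (1/2 * (δ / (4 * m))) := by field_simp; norm_num
          _ ≤ 8 * m / δ * (H s * (δ / (4 * m))) := by gcongr
          _ ≤ _ := by gcongr
      calc μ^2 / ((h s)^2 + μ^2) = 1 * (μ^2 / ((h s)^2 + μ^2)) := by ring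
        _ ≤ 8 * m / δ * |h' s| * (μ^2 / ((h s)^2 + μ^2)) := by gcongr
        _ = 8 * m / δ * (μ^2 * |h' s| / ((h s)^2 + μ^2)) := by ring
        _ ≤ _ := by linarith [sq_nonneg μ]

end CE

namespace CE

noncomputable def kk (Λ ε ρ y : ℝ) : ℂ :=
  if ρ < y ∧ y ≤ 2 * ρ then
    Complex.exp (Complex.I * ((Λ * (y / ρ) ^ ε : ℝ) : ℂ)) * ((y⁻¹ : ℝ) : ℂ) else 0

lemma norm_exp_I_mul (a : ℝ) : ‖Complex.exp (Complex.I * (a : ℂ))‖ = 1 := by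
  rw [mul_comm]; exact Complex.norm_exp_ofReal_mul_I _

@[fun_prop]
lemma measurable_kk {α : Type*} [MeasurableSpace α] {Λ ε : ℝ} {f g : α → ℝ} (hf : Measurable f)
    (hg : Measurable g) : Measurable fun x => kk Λ ε (f x) (g x) := by
  unfold kk
  refine Measurable.ite ?_ (by fun_prop) measurable_const
  exact (measurableSet_lt hf hg).inter (measurableSet_le hg (by fun_prop))

lemma norm_kk_le {Λ ε ρ : ℝ} (hρ : 0 < ρ) (y : ℝ) : ‖kk Λ ε ρ y‖ ≤ (Ioc ρ (2*ρ)).indicator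
    (fun _ => ρ⁻¹) y := by
  unfold kk
  by_cases h : ρ < y ∧ y ≤ 2 * ρ
  · rw [if_pos h, indicator_of_mem (show y ∈ Ioc ρ (2*ρ) from h), norm_mul, norm_exp_I_mul, one_mul,
      Complex.norm_real, Real.norm_eq_abs, abs_of_pos (inv_pos.2 (hρ.trans h.1))]
    exact inv_anti₀ hρ h.1.le
  · rw [if_neg h, indicator_of_notMem (show y ∉ Ioc ρ (2*ρ) from h)]; simp

lemma inv_le_pk5 {ρ u : ℝ} (hρ : 0 < ρ) (hu : |u| ≤ 2 * ρ) : ρ⁻¹ ≤ 5 * pk ρ u := by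
  unfold pk
  have h : u^2 ≤ 4 * ρ^2 := by
    rw [← sq_abs]; nlinarith [abs_nonneg u]
  rw [inv_eq_one_div, mul_div_assoc', div_le_div_iff₀ hρ (by positivity)]
  nlinarith

lemma inv_le_pkm {ρ u m : ℝ} (hρ : 0 < ρ) (hm : 0 < m) (hu : |u| ≤ ρ / m) :
    ρ⁻¹ ≤ 2 / m * pk (ρ / m) u := by
  unfold pk
  have h0 : 0 < ρ / m := by positivity
  have h : u^2 ≤ (ρ/m)^2 := by
    rw [← sq_abs]; gcongr
  calc ρ⁻¹ = 2 / m * ((ρ / m) / ((ρ / m)^2 + (ρ/m)^2)) := by field_simp; norm_num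
    _ ≤ _ := by gcongr

lemma norm_kk_le_pk {Λ ε ρ : ℝ} (hρ : 0 < ρ) (y : ℝ) : ‖kk Λ ε ρ y‖ ≤ 5 * pk ρ y := by
  refine (norm_kk_le hρ y).trans ?_
  by_cases h : y ∈ Ioc ρ (2*ρ)
  · rw [indicator_of_mem h]
    exact inv_le_pk5 hρ (by rw [abs_of_pos (hρ.trans h.1)]; exact h.2)
  · rw [indicator_of_notMem h]
    have := pk_nonneg hρ y; positivity

lemma J_triv {Λ ε ρ ρ' : ℝ} (hρ : 0 < ρ) (hρ' : 0 < ρ') (u : ℝ) :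
    ‖∫ y, kk Λ ε ρ y * (starRingEnd ℂ) (kk Λ ε ρ' (y - u))‖ ≤ ρ⁻¹ := by
  have hi : Integrable ((Ioc ρ' (2*ρ')).indicator (fun _ : ℝ => ρ'⁻¹)) := by
    refine IntegrableOn.integrable_indicator ?_ measurableSet_Ioc
    exact integrableOn_const (by simp) (by simp)
  calc _ ≤ ∫ y, ρ⁻¹ * (Ioc ρ' (2*ρ')).indicator (fun _ : ℝ => ρ'⁻¹) (y - u) := by
        refine norm_integral_le_of_norm_le ((hi.comp_sub_right u).const_mul _)
          (ae_of_all _ fun y => ?_)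
        rw [norm_mul, RCLike.norm_conj]
        refine mul_le_mul ((norm_kk_le hρ y).trans ?_) (norm_kk_le hρ' _) (norm_nonneg _)
          (by positivity)
        exact indicator_le_self' (fun _ _ => by positivity) y
    _ = ρ⁻¹ := by
        rw [integral_const_mul, integral_sub_right_eq_self
          ((Ioc ρ' (2*ρ')).indicator (fun _ : ℝ => ρ'⁻¹)) u,
          integral_indicator measurableSet_Ioc, setIntegral_const]
        simp [Measure.real, show 2 * ρ' - ρ' = ρ' by ring, hρ'.le, hρ'.ne']

lemma J_zero {Λ ε ρ ρ' : ℝ} (hρ' : 0 < ρ') (hle : ρ' ≤ ρ) {u : ℝ} (hu : 2 * ρ < |u|) :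
    ∫ y, kk Λ ε ρ y * (starRingEnd ℂ) (kk Λ ε ρ' (y - u)) = 0 := by
  have : ∀ y, kk Λ ε ρ y * (starRingEnd ℂ) (kk Λ ε ρ' (y - u)) = 0 := by
    intro y
    unfold kk
    by_cases h1 : ρ < y ∧ y ≤ 2 * ρ
    · by_cases h2 : ρ' < y - u ∧ y - u ≤ 2 * ρ'
      · exfalso
        have : |u| ≤ 2 * ρ := by rw [abs_le]; constructor <;> linarith [h1.1, h1.2, h2.1, h2.2]
        linarith
      · rw [if_neg h2]; simp
    · rw [if_neg h1]; simp
  simp [this]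

lemma J_big {δ ε m Λ ρ ρ' u : ℝ} (hδ : 0 < δ) (hδ1 : δ < 1) (hε : δ < |ε|) (hε1 : δ < |ε - 1|)
    (hm : 1 ≤ m) (hΛ : |Λ| = m ^ 8) (hρ' : 0 < ρ') (hle : ρ' ≤ ρ) (hu : ρ / m ≤ |u|) :
    ‖∫ y, kk Λ ε ρ y * (starRingEnd ℂ) (kk Λ ε ρ' (y - u))‖ ≤
      (10 * ((2:ℝ) ^ (|ε| + 1)) ^ 3 / δ / m) * ρ⁻¹ := by
  have hρ : 0 < ρ := hρ'.trans_le hle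
  set a := max ρ (ρ' + u)
  set b := min (2 * ρ) (2 * ρ' + u)
  set g : ℝ → ℂ := fun y => Complex.exp (Complex.I *
    ((Λ * ((y / ρ) ^ ε - ((y - u) / ρ') ^ ε) : ℝ) : ℂ)) * (((y * (y - u))⁻¹ : ℝ) : ℂ) with hg
  have e1 : ∀ y, kk Λ ε ρ y * (starRingEnd ℂ) (kk Λ ε ρ' (y - u)) = (Ioc a b).indicator g y := by
    intro y
    by_cases h : y ∈ Ioc a b
    · rw [indicator_of_mem h]
      have h1 := max_lt_iff.1 h.1
      have h2 := le_min_iff.1 h.2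
      unfold kk
      rw [if_pos ⟨h1.1, h2.1⟩, if_pos ⟨by linarith, by linarith⟩]
      simp only [map_mul, ← Complex.exp_conj, Complex.conj_I, Complex.conj_ofReal, hg]
      rw [mul_mul_mul_comm, ← Complex.exp_add]
      push_cast
      rw [mul_inv]
      congr 2
      ring
    · rw [indicator_of_notMem h]
      unfold kk
      by_cases h1 : ρ < y ∧ y ≤ 2 * ρ
      · by_cases h2 : ρ' < y - u ∧ y - u ≤ 2 * ρ'
        · exfalso; apply h
          exact ⟨max_lt h1.1 (by linarith), le_min h1.2 (by linarith)⟩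
        · rw [if_neg h2]; simp
      · rw [if_neg h1]; simp
  simp_rw [e1]
  rw [integral_indicator measurableSet_Ioc]
  by_cases hab : a ≤ b
  swap
  · rw [Ioc_eq_empty (fun h => hab h.le)]; simp; positivity
  have hab1 := hab
  rw [← intervalIntegral.integral_of_le hab]
  have sub := intervalIntegral.integral_comp_mul_add (a := (a - u) / ρ') (b := (b - u) / ρ')
    g hρ'.ne' u
  have ea : ρ' * ((a - u) / ρ') + u = a := by field_simp; ring
  have eb : ρ' * ((b - u) / ρ') + u = b := by field_simp; ring
  rw [ea, eb] at sub
  have e2 : ∀ s, g (ρ' * s + u) = ((ρ⁻¹ * ρ'⁻¹ : ℝ) : ℂ) * (Complex.exp (Complex.I *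
      ((Λ * (((s + u / ρ') / (ρ / ρ')) ^ ε - s ^ ε) : ℝ) : ℂ)) *
      (((s * ((s + u / ρ') / (ρ / ρ')))⁻¹ : ℝ) : ℂ)) := by
    intro s
    simp only [hg]
    have q1 : (ρ' * s + u) / ρ = (s + u / ρ') / (ρ / ρ') := by field_simp
    have q2 : (ρ' * s + u - u) / ρ' = s := by field_simp; ring
    have q3 : ((ρ' * s + u) * (ρ' * s + u - u))⁻¹ =
        (ρ⁻¹ * ρ'⁻¹) * (s * ((s + u / ρ') / (ρ / ρ')))⁻¹ := by
      rw [← q1, ← mul_inv, ← mul_inv]; congr 1; field_simp; ring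
    rw [q1, q2, q3]; push_cast; ring
  simp_rw [e2] at sub
  rw [intervalIntegral.integral_const_mul] at sub
  have key := osc_main (κ := ρ / ρ') (v := u / ρ') (α := (a - u) / ρ') (β := (b - u) / ρ')
    hδ hδ1 hε hε1 hm hΛ ((one_le_div hρ').2 hle) ?_ ?_ ?_ ?_ ?_
  · have e3 : ∫ y in a..b, g y = ((ρ⁻¹ : ℝ) : ℂ) * ∫ s in (a - u) / ρ'..(b - u) / ρ',
      (Complex.exp (Complex.I * ((Λ * (((s + u / ρ') / (ρ / ρ')) ^ ε - s ^ ε) : ℝ) : ℂ)) *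
      (((s * ((s + u / ρ') / (ρ / ρ')))⁻¹ : ℝ) : ℂ)) := by
      have := congrArg (fun z => (ρ' : ℂ) * z) sub
      simp only [Complex.real_smul] at this
      rw [← mul_assoc, ← mul_assoc, ← Complex.ofReal_mul, ← Complex.ofReal_mul] at this
      have w1 : ρ' * ρ'⁻¹ = 1 := by field_simp
      have w2 : ρ' * (ρ⁻¹ * ρ'⁻¹) = ρ⁻¹ := by field_simp
      rw [w1, w2, Complex.ofReal_one, one_mul] at this
      exact this.symm
    rw [e3, norm_mul, Complex.norm_real, Real.norm_eq_abs, abs_of_pos (by positivity), mul_comm]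
    gcongr
  · rw [abs_div, abs_of_pos hρ', div_right_comm]; gcongr
  · gcongr
  · rw [le_div_iff₀ hρ']; linarith [le_max_right ρ (ρ' + u)]
  · rw [div_le_iff₀ hρ']; linarith [min_le_right (2*ρ) (2 * ρ' + u)]
  · intro s hs
    have hs1 := (div_le_iff₀ hρ').1 hs.1
    have hs2 := (le_div_iff₀ hρ').1 hs.2
    have q1 : (s + u / ρ') / (ρ / ρ') = (s * ρ' + u) / ρ := by field_simp
    rw [q1, le_div_iff₀ hρ, div_le_iff₀ hρ]
    constructor
    · linarith [le_max_left ρ (ρ' + u)]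
    · linarith [min_le_left (2*ρ) (2 * ρ' + u)]

lemma J_half {δ ε m Λ ρ ρ' : ℝ} (hδ : 0 < δ) (hδ1 : δ < 1) (hε : δ < |ε|) (hε1 : δ < |ε - 1|)
    (hm : 1 ≤ m) (hΛ : |Λ| = m ^ 8) (hρ' : 0 < ρ') (hle : ρ' ≤ ρ) (u : ℝ) :
    ‖∫ y, kk Λ ε ρ y * (starRingEnd ℂ) (kk Λ ε ρ' (y - u))‖ ≤
      (50 * ((2:ℝ) ^ (|ε| + 1)) ^ 3 / δ / m) * pk ρ u + 2 / m * pk (ρ / m) u := by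
  have hρ : 0 < ρ := hρ'.trans_le hle
  have hm0 : 0 < m := by linarith
  have p1 := pk_nonneg hρ u
  have p2 := pk_nonneg (div_pos hρ hm0) u
  by_cases h1 : |u| ≤ ρ / m
  · have := (J_triv (Λ := Λ) (ε := ε) hρ hρ' u).trans (inv_le_pkm hρ hm0 h1)
    have : 0 ≤ (50 * ((2:ℝ) ^ (|ε| + 1)) ^ 3 / δ / m) * pk ρ u := by positivity
    linarith
  · push Not at h1
    have z : 0 ≤ 2 / m * pk (ρ / m) u := by positivity
    by_cases h2 : |u| ≤ 2 * ρ
    · have b := J_big hδ hδ1 hε hε1 hm hΛ hρ' hle h1.le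
      have c := inv_le_pk5 hρ h2
      calc _ ≤ _ := b
        _ ≤ (10 * ((2:ℝ) ^ (|ε| + 1)) ^ 3 / δ / m) * (5 * pk ρ u) := by gcongr
        _ = (50 * ((2:ℝ) ^ (|ε| + 1)) ^ 3 / δ / m) * pk ρ u := by ring
        _ ≤ _ := by linarith
    · rw [J_zero hρ' hle (not_le.1 h2), norm_zero]
      positivity

lemma J_symm {Λ ε ρ ρ' u : ℝ} :
    ‖∫ y, kk Λ ε ρ y * (starRingEnd ℂ) (kk Λ ε ρ' (y - u))‖ =
    ‖∫ y, kk Λ ε ρ' y * (starRingEnd ℂ) (kk Λ ε ρ (y - (-u)))‖ := by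
  rw [← RCLike.norm_conj (K := ℂ) (∫ y, kk Λ ε ρ' y * (starRingEnd ℂ) (kk Λ ε ρ (y - (-u)))),
    ← integral_conj, ← integral_add_right_eq_self _ u]
  congr 2
  ext y
  simp [mul_comm]

lemma J_all {δ ε m Λ ρ ρ' : ℝ} (hδ : 0 < δ) (hδ1 : δ < 1) (hε : δ < |ε|) (hε1 : δ < |ε - 1|)
    (hm : 1 ≤ m) (hΛ : |Λ| = m ^ 8) (hρ : 0 < ρ) (hρ' : 0 < ρ') (u : ℝ) :
    ‖∫ y, kk Λ ε ρ y * (starRingEnd ℂ) (kk Λ ε ρ' (y - u))‖ ≤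
      (50 * ((2:ℝ) ^ (|ε| + 1)) ^ 3 / δ / m) * (pk ρ u + pk ρ' u) +
      2 / m * (pk (ρ / m) u + pk (ρ' / m) u) := by
  have hm0 : 0 < m := by linarith
  have p1 := pk_nonneg hρ u
  have p2 := pk_nonneg (div_pos hρ hm0) u
  have p3 := pk_nonneg hρ' u
  have p4 := pk_nonneg (div_pos hρ' hm0) u
  rcases le_total ρ' ρ with h | h
  · refine (J_half hδ hδ1 hε hε1 hm hΛ hρ' h u).trans ?_
    gcongr <;> linarith
  · rw [J_symm]
    refine (J_half hδ hδ1 hε hε1 hm hΛ hρ h (-u)).trans ?_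
    rw [pk_neg, pk_neg]
    gcongr <;> linarith

lemma kk_bound {δ ε m Λ τ : ℝ} (hδ : 0 < δ) (hδ1 : δ < 1) (hε : δ < |ε|) (hε1 : δ < |ε - 1|)
    (hm : 1 ≤ m) (hΛ : |Λ| = m ^ 8) (hτ : τ = 1 ∨ τ = -1)
    {ρ : ℝ → ℝ} (hρ : Measurable ρ) {a b : ℝ} (ha : 0 < a)
    (hab : ∀ x, a ≤ ρ x ∧ ρ x ≤ b) {f : ℝ → ℂ} (hf : Measurable f) (hf2 : ∫⁻ z, ‖f z‖ₑ ^ 2 ≠ ∞) :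
    ∫⁻ x, ‖∫ z, kk Λ ε (ρ x) (τ * (x - z)) * f z‖ₑ ^ 2 ≤
      ENNReal.ofReal (120 * (50 * ((2:ℝ) ^ (|ε| + 1)) ^ 3 / δ / m + 2 / m)) *
        ∫⁻ z, ‖f z‖ₑ ^ 2 := by
  have hm0 : 0 < m := by linarith
  have h0 : ∀ x, 0 < ρ x := fun x => ha.trans_le (hab x).1
  have hpkτ : ∀ r y, pk r (τ * y) = pk r y := by
    intro r y; rcases hτ with rfl | rfl <;> simp [pk]
  refine master_pk (K := fun x z => kk Λ ε (ρ x) (τ * (x - z))) (by fun_prop)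
    (H := ENNReal.ofReal (a⁻¹ * 5 * Real.pi)) ENNReal.ofReal_ne_top ?_ hρ (ρ' := fun x => ρ x / m)
    (by fun_prop) ha (div_pos ha hm0) hab
    (b' := b / m) (fun x => ⟨?_, ?_⟩) (by positivity) (by positivity) ?_ hf hf2
  · intro x
    calc ∫⁻ z, ‖kk Λ ε (ρ x) (τ * (x - z))‖ₑ ^ 2 ≤
        ∫⁻ z, ENNReal.ofReal (a⁻¹ * 5) * ENNReal.ofReal (pk (ρ x) (x - z)) := by
          refine lintegral_mono fun z => ?_
          simp only
          rw [← ofReal_norm, ← ENNReal.ofReal_pow (norm_nonneg _),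
            ← ENNReal.ofReal_mul (by positivity)]
          apply ENNReal.ofReal_le_ofReal
          rw [sq, mul_assoc]
          have e1 : ‖kk Λ ε (ρ x) (τ * (x - z))‖ ≤ a⁻¹ := by
            refine (norm_kk_le (h0 x) _).trans ?_
            have : 0 < ρ x := h0 x
            refine (indicator_le_self' (fun _ _ => by positivity) _).trans ?_
            exact inv_anti₀ ha (hab x).1
          have e2 := norm_kk_le_pk (Λ := Λ) (ε := ε) (h0 x) (τ * (x - z))
          rw [hpkτ] at e2
          exact mul_le_mul e1 e2 (norm_nonneg _) (by positivity)
      _ = _ := by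
          rw [lintegral_const_mul _ (by fun_prop), lintegral_pk_sub_left (h0 x),
            ← ENNReal.ofReal_mul (by positivity)]
  · exact div_le_div_of_nonneg_right (hab x).1 hm0.le
  · exact div_le_div_of_nonneg_right (hab x).2 hm0.le
  · intro x x'
    have key := J_all hδ hδ1 hε hε1 hm hΛ (h0 x) (h0 x') (τ * (x - x'))
    simp only [hpkτ] at key
    refine le_trans (le_of_eq ?_) key
    congr 1
    rcases hτ with rfl | rfl
    · rw [← integral_sub_left_eq_self (fun y => kk Λ ε (ρ x) y *
        (starRingEnd ℂ) (kk Λ ε (ρ x') (y - 1 * (x - x')))) _ x]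
      congr 1; ext z
      congr 3 <;> ring_nf
    · rw [← integral_sub_right_eq_self (fun y => kk Λ ε (ρ x) y *
        (starRingEnd ℂ) (kk Λ ε (ρ x') (y - -1 * (x - x')))) x]
      congr 1; ext z
      congr 3 <;> ring_nf

end CE

namespace CE

/-- operator with kernel dominated by c * pk -/
lemma dom_pt {K : ℝ → ℝ → ℂ} {ρ : ℝ → ℝ} {c : ℝ} (hc : 0 ≤ c)
    (hK : ∀ x z, ‖K x z‖ ≤ c * pk (ρ x) (x - z)) {f : ℝ → ℂ} (x : ℝ) :
    ‖∫ z, K x z * f z‖ₑ ≤ ENNReal.ofReal c * PM ρ (fun z => ‖f z‖ₑ) x := by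
  refine (enorm_integral_le_lintegral_enorm _).trans ?_
  unfold PM
  rw [← lintegral_const_mul' _ _ ENNReal.ofReal_ne_top]
  refine lintegral_mono fun z => ?_
  simp only
  rw [enorm_mul, ← mul_assoc, ← ENNReal.ofReal_mul hc, ← ofReal_norm (K x z)]
  gcongr
  exact hK x z

lemma dom_bound {K : ℝ → ℝ → ℂ} {ρ : ℝ → ℝ} {c : ℝ} (hc : 0 ≤ c)
    (hρ : Measurable ρ) {a b : ℝ} (ha : 0 < a) (hab : ∀ x, a ≤ ρ x ∧ ρ x ≤ b)
    (hK : ∀ x z, ‖K x z‖ ≤ c * pk (ρ x) (x - z)) {f : ℝ → ℂ} (hf : Measurable f) :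
    ∫⁻ x, ‖∫ z, K x z * f z‖ₑ ^ 2 ≤ ENNReal.ofReal (c^2 * 60^2) * ∫⁻ z, ‖f z‖ₑ ^ 2 := by
  calc _ ≤ ∫⁻ x, (ENNReal.ofReal c * PM ρ (fun z => ‖f z‖ₑ) x)^2 := by
        refine lintegral_mono fun x => ?_
        simp only
        gcongr
        exact dom_pt hc hK x
    _ = ENNReal.ofReal c ^ 2 * ∫⁻ x, PM ρ (fun z => ‖f z‖ₑ) x ^ 2 := by
        simp_rw [mul_pow]
        rw [lintegral_const_mul' _ _ (by simp)]
    _ ≤ ENNReal.ofReal c ^ 2 * (ENNReal.ofReal (60^2) * ∫⁻ z, ‖f z‖ₑ ^ 2) := by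
        gcongr
        exact PB_main hρ ha hab _ hf.enorm
    _ = _ := by
        rw [← mul_assoc, ENNReal.ofReal_mul (by positivity), ENNReal.ofReal_pow hc]

def low (ε : ℝ) (j : ℤ) : Prop := (0 < ε ∧ j < 0) ∨ (ε < 0 ∧ 0 ≤ j)

open Classical in
noncomputable def kj (σ ε : ℝ) (j : ℤ) (ρ y : ℝ) : ℂ :=
  kk (σ * 2 ^ ((j:ℝ) * ε)) ε ρ y - (if low ε j then kk 0 ε ρ y else 0)

@[fun_prop]
lemma measurable_kj {α : Type*} [MeasurableSpace α] {σ ε : ℝ} {j : ℤ} {f g : α → ℝ}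
    (hf : Measurable f) (hg : Measurable g) : Measurable fun x => kj σ ε j (f x) (g x) := by
  unfold kj
  split_ifs <;> fun_prop

lemma norm_exp_sub_one_le (a : ℝ) : ‖Complex.exp (Complex.I * (a : ℂ)) - 1‖ ≤ |a| := by
  have := Real.norm_exp_I_mul_ofReal_sub_one_le (x := a)
  simpa using this

lemma two_rpow_mono {a b : ℝ} (h : a ≤ b) : (2:ℝ) ^ a ≤ 2 ^ b :=
  Real.rpow_le_rpow_of_exponent_le (by norm_num) h

lemma kj_low {δ ε σ ρ : ℝ} {j : ℤ} (hδ : 0 < δ) (hδ1 : δ < 1) (hε : δ < |ε|)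
    (hσ : |σ| = 1) (hρ : 0 < ρ) (hj : low ε j) (y : ℝ) :
    ‖kj σ ε j ρ y‖ ≤ 10 * 2 ^ (-(δ * |(j:ℝ)| / 8)) * pk ρ y := by
  unfold kj
  rw [if_pos hj]
  by_cases h : ρ < y ∧ y ≤ 2 * ρ
  · have hy : 0 < y := hρ.trans h.1
    unfold kk
    rw [if_pos h, if_pos h, ← sub_mul, norm_mul, Complex.norm_real, Real.norm_eq_abs,
      abs_of_pos (inv_pos.2 hy)]
    have e1 : y⁻¹ ≤ 5 * pk ρ y := (inv_anti₀ hρ h.1.le).trans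
      (inv_le_pk5 hρ (by rw [abs_of_pos hy]; exact h.2))
    have q1 : 1 ≤ y / ρ := (one_le_div hρ).2 h.1.le
    have q2 : y / ρ ≤ 2 := (div_le_iff₀ hρ).2 h.2
    have e2 : ‖Complex.exp (Complex.I * ((σ * 2 ^ ((j:ℝ) * ε) * (y / ρ) ^ ε : ℝ) : ℂ)) -
        Complex.exp (Complex.I * ((0 * (y / ρ) ^ ε : ℝ) : ℂ))‖ ≤
        2 * 2 ^ (-(δ * |(j:ℝ)| / 8)) := by
      simp only [zero_mul, Complex.ofReal_zero, mul_zero, Complex.exp_zero]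
      refine (norm_exp_sub_one_le _).trans ?_
      rw [abs_mul, abs_mul, hσ, one_mul, abs_of_pos (by positivity),
        abs_of_pos (by positivity)]
      rcases hj with ⟨he, hj⟩ | ⟨he, hj⟩
      · rw [abs_of_pos he] at hε
        have hj' : (j:ℝ) ≤ -1 := by exact_mod_cast Int.le_sub_one_of_lt hj
        rw [abs_of_neg (by linarith)]
        calc (2:ℝ) ^ ((j:ℝ) * ε) * (y / ρ) ^ ε ≤ 2 ^ ((j:ℝ) * ε) * 2 ^ ε := by gcongr
          _ = 2 ^ (((j:ℝ) + 1) * ε) := by rw [← Real.rpow_add two_pos]; congr 1; ring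
          _ ≤ 2 ^ (1 + -(δ * -(j:ℝ) / 8)) := by
              apply two_rpow_mono
              nlinarith
          _ = _ := by rw [Real.rpow_add two_pos, Real.rpow_one]
      · rw [abs_of_neg he] at hε
        have hj' : (0:ℝ) ≤ j := by exact_mod_cast hj
        rw [abs_of_nonneg hj']
        have : (y / ρ) ^ ε ≤ 1 := Real.rpow_le_one_of_one_le_of_nonpos q1 he.le
        calc (2:ℝ) ^ ((j:ℝ) * ε) * (y / ρ) ^ ε ≤ 2 ^ ((j:ℝ) * ε) * 1 := by gcongr
          _ ≤ 2 ^ (1 + -(δ * (j:ℝ) / 8)) := by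
              rw [mul_one]
              apply two_rpow_mono
              nlinarith
          _ = _ := by rw [Real.rpow_add two_pos, Real.rpow_one]
    calc _ ≤ (2 * 2 ^ (-(δ * |(j:ℝ)| / 8))) * (5 * pk ρ y) := by
          gcongr
      _ = _ := by ring
  · have e : ∀ Λ, kk Λ ε ρ y = 0 := fun Λ => by unfold kk; rw [if_neg h]
    rw [e, e, sub_zero, norm_zero]
    have := pk_nonneg hρ y; positivity

lemma kj_high {ε σ ρ : ℝ} {j : ℤ} (hj : ¬ low ε j) (y : ℝ) :
    kj σ ε j ρ y = kk (σ * 2 ^ ((j:ℝ) * ε)) ε ρ y := by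
  unfold kj; rw [if_neg hj, sub_zero]

lemma pk_tau {τ : ℝ} (hτ : τ = 1 ∨ τ = -1) (r y : ℝ) : pk r (τ * y) = pk r y := by
  rcases hτ with rfl | rfl <;> simp [pk]

lemma piece_bound {δ ε σ τ : ℝ} {j : ℤ} (hδ : 0 < δ) (hδ1 : δ < 1) (hε : δ < |ε|)
    (hε1 : δ < |ε - 1|) (hσ : |σ| = 1) (hτ : τ = 1 ∨ τ = -1)
    {ρ : ℝ → ℝ} (hρ : Measurable ρ) {a b : ℝ} (ha : 0 < a)
    (hab : ∀ x, a ≤ ρ x ∧ ρ x ≤ b) {f : ℝ → ℂ} (hf : Measurable f) (hf2 : ∫⁻ z, ‖f z‖ₑ ^ 2 ≠ ∞) :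
    ∫⁻ x, ‖∫ z, kj σ ε j (ρ x) (τ * (x - z)) * f z‖ₑ ^ 2 ≤
      ENNReal.ofReal (720000 / δ * 2 ^ (-(δ * |(j:ℝ)| / 8))) * ∫⁻ z, ‖f z‖ₑ ^ 2 := by
  have h0 : ∀ x, 0 < ρ x := fun x => ha.trans_le (hab x).1
  have hδi : 1 ≤ 1 / δ := by rw [one_le_div hδ]; exact hδ1.le
  by_cases hj : low ε j
  · refine (dom_bound (c := 10 * 2 ^ (-(δ * |(j:ℝ)| / 8))) (by positivity) hρ ha hab
      (fun x z => ?_) hf).trans ?_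
    · rw [← pk_tau hτ]
      exact kj_low hδ hδ1 hε hσ (h0 x) hj _
    · gcongr ENNReal.ofReal ?_ * _
      have q : (2:ℝ) ^ (-(δ * |(j:ℝ)| / 8)) ≤ 1 :=
        Real.rpow_le_one_of_one_le_of_nonpos (by norm_num) (by
          have : 0 ≤ δ * |(j:ℝ)| / 8 := by positivity
          linarith)
      have q0 : 0 < (2:ℝ) ^ (-(δ * |(j:ℝ)| / 8)) := by positivity
      have : 720000 / δ = 720000 * (1 / δ) := by ring
      rw [this]
      generalize (2:ℝ) ^ (-(δ * |(j:ℝ)| / 8)) = w at *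
      nlinarith
  · simp_rw [kj_high hj]
    have hjε : (j:ℝ) * ε = |(j:ℝ)| * |ε| := by
      have : 0 ≤ (j:ℝ) * ε := by
        unfold low at hj
        push Not at hj
        have hne : ε ≠ 0 := by rintro rfl; simp at hε; linarith
        rcases lt_or_gt_of_ne hne with h | h
        · have := hj.2 h
          have : (j:ℝ) ≤ 0 := by exact_mod_cast this.le
          nlinarith
        · have := hj.1 h
          have : (0:ℝ) ≤ j := by exact_mod_cast this
          positivity
      rw [← abs_mul, abs_of_nonneg this]
    rcases le_total |(j:ℝ)| 24 with h24 | h24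
    · refine (dom_bound (c := 5) (by positivity) hρ ha hab
        (fun x z => ?_) hf).trans ?_
      · rw [← pk_tau hτ]
        exact norm_kk_le_pk (h0 x) _
      · gcongr ENNReal.ofReal ?_ * _
        have q : (2:ℝ) ^ (-3 : ℝ) ≤ 2 ^ (-(δ * |(j:ℝ)| / 8)) := by
          apply two_rpow_mono
          nlinarith
        have q3 : (2:ℝ) ^ (-3 : ℝ) = 1 / 8 := by
          rw [show (-3:ℝ) = ((-3 : ℤ) : ℝ) by norm_num, Real.rpow_intCast]; norm_num
        have : 720000 / δ = 720000 * (1 / δ) := by ring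
        rw [this]
        rw [q3] at q
        nlinarith
    · set m : ℝ := 2 ^ (|(j:ℝ)| * |ε| / 8) with hm
      have hm1 : 1 ≤ m := Real.one_le_rpow (by norm_num) (by positivity)
      have hm0 : 0 < m := by positivity
      have hΛ : |σ * 2 ^ ((j:ℝ) * ε)| = m ^ 8 := by
        rw [abs_mul, hσ, one_mul, abs_of_pos (by positivity), hjε, hm, ← Real.rpow_natCast,
          ← Real.rpow_mul (by norm_num)]
        congr 1; push_cast; ring
      refine (kk_bound hδ hδ1 hε hε1 hm1 hΛ hτ hρ ha hab hf hf2).trans ?_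
      gcongr ENNReal.ofReal ?_ * _
      have d1 : ((2:ℝ) ^ (|ε| + 1)) ^ 3 = 8 * 2 ^ (3 * |ε|) := by
        rw [Real.rpow_add two_pos, mul_pow, ← Real.rpow_natCast, ← Real.rpow_mul (by norm_num)]
        norm_num; ring_nf
      have d2 : 1 ≤ (2:ℝ) ^ (3 * |ε|) := Real.one_le_rpow (by norm_num) (by positivity)
      have d3 : (2:ℝ) ^ (3 * |ε|) / m ≤ 8 * 2 ^ (-(δ * |(j:ℝ)| / 8)) := by
        rw [hm, ← Real.rpow_sub two_pos]
        have : (8:ℝ) = 2 ^ (3:ℝ) := by norm_num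
        rw [this, ← Real.rpow_add two_pos]
        apply two_rpow_mono
        nlinarith
      calc 120 * (50 * ((2:ℝ) ^ (|ε| + 1)) ^ 3 / δ / m + 2 / m)
          = 120 * (400 * (1 / δ) * (2 ^ (3 * |ε|) / m) + 2 * 1 * (1 / m)) := by rw [d1]; ring
        _ ≤ 120 * (400 * (1 / δ) * (2 ^ (3 * |ε|) / m) + 2 * (1 / δ) * (2 ^ (3 * |ε|) / m)) := by
            gcongr
        _ = 120 * 402 * (1 / δ) * (2 ^ (3 * |ε|) / m) := by ring
        _ ≤ 120 * 402 * (1 / δ) * (8 * 2 ^ (-(δ * |(j:ℝ)| / 8))) := by gcongr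
        _ = 385920 / δ * 2 ^ (-(δ * |(j:ℝ)| / 8)) := by ring
        _ ≤ _ := by gcongr; norm_num

lemma tsum_sq_le (w : ℤ → ℝ) (hw : ∀ j, 0 < w j) (a : ℤ → ℝ≥0∞) :
    (∑' j, a j) ^ 2 ≤ (∑' j, ENNReal.ofReal (w j) ^ 2) * ∑' j, ENNReal.ofReal ((w j)⁻¹ ^ 2) * a j ^ 2 := by
  have := cs_sq (μ := (Measure.count : Measure ℤ)) (f := fun j => ENNReal.ofReal (w j))
    (g := fun j => ENNReal.ofReal (w j)⁻¹ * a j) (by fun_prop) (by fun_prop)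
  simp only [lintegral_count] at this
  have e : ∀ j, ENNReal.ofReal (w j) * (ENNReal.ofReal (w j)⁻¹ * a j) = a j := by
    intro j
    rw [← mul_assoc, ← ENNReal.ofReal_mul (hw j).le, mul_inv_cancel₀ (hw j).ne']; simp
  simp_rw [e, mul_pow] at this
  refine this.trans (le_of_eq ?_)
  congr 2; ext j
  rw [ENNReal.ofReal_pow (by have := hw j; positivity)]

noncomputable def WW (δ : ℝ) : ℝ≥0∞ := ∑' j : ℤ, ENNReal.ofReal (2 ^ (-(δ * |(j:ℝ)| / 16)))

lemma WW_ne_top {δ : ℝ} (hδ : 0 < δ) : WW δ ≠ ∞ := by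
  unfold WW
  have : Summable fun j : ℤ => (2:ℝ) ^ (-(δ * |(j:ℝ)| / 16)) := by
    have hg : Summable fun n : ℕ => (2:ℝ) ^ (-(δ * (n:ℝ) / 16)) := by
      have : ∀ n : ℕ, (2:ℝ) ^ (-(δ * (n:ℝ) / 16)) = ((2:ℝ) ^ (-(δ/16))) ^ n := by
        intro n
        rw [← Real.rpow_natCast, ← Real.rpow_mul (by norm_num)]; congr 1; ring
      simp_rw [this]
      refine summable_geometric_of_lt_one (by positivity) ?_
      exact Real.rpow_lt_one_of_one_lt_of_neg (by norm_num) (by linarith [div_pos hδ (by norm_num : (0:ℝ) < 16)])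
    refine Summable.of_nat_of_neg ?_ ?_
    · simpa using hg
    · simpa using hg
  rw [← ENNReal.ofReal_tsum_of_nonneg (fun j => by positivity) this]
  exact ENNReal.ofReal_ne_top

lemma sum_bound {δ : ℝ} (B : ℝ) (hB : 0 ≤ B) {P : ℤ → ℝ → ℝ≥0∞} (hP : ∀ j, AEMeasurable (P j))
    {I : ℝ≥0∞}
    (hb : ∀ j, ∫⁻ x, P j x ^ 2 ≤ ENNReal.ofReal (B * 2 ^ (-(δ * |(j:ℝ)| / 8))) * I) :
    ∫⁻ x, (∑' j, P j x) ^ 2 ≤ ENNReal.ofReal B * WW δ ^ 2 * I := by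
  set w : ℤ → ℝ := fun j => 2 ^ (-(δ * |(j:ℝ)| / 32)) with hw
  have hw0 : ∀ j, 0 < w j := fun j => by positivity
  have hww : ∑' j, ENNReal.ofReal (w j) ^ 2 = WW δ := by
    unfold WW
    congr 1; ext j
    rw [← ENNReal.ofReal_pow (hw0 j).le, hw]
    simp only
    rw [← Real.rpow_natCast, ← Real.rpow_mul (by norm_num)]
    congr 2; push_cast; ring
  calc _ ≤ ∫⁻ x, WW δ * ∑' j, ENNReal.ofReal ((w j)⁻¹ ^ 2) * P j x ^ 2 := by
        refine lintegral_mono fun x => ?_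
        rw [← hww]
        exact tsum_sq_le w hw0 _
    _ = WW δ * ∑' j, ENNReal.ofReal ((w j)⁻¹ ^ 2) * ∫⁻ x, P j x ^ 2 := by
        rw [lintegral_const_mul'' _ (by fun_prop), lintegral_tsum (by fun_prop)]
        congr 2; ext j
        rw [lintegral_const_mul'' _ (by fun_prop)]
    _ ≤ WW δ * ∑' j : ℤ, ENNReal.ofReal (2 ^ (-(δ * |(j:ℝ)| / 16))) * (ENNReal.ofReal B * I) := by
        refine mul_le_mul_right (ENNReal.tsum_le_tsum fun j => ?_) _
        refine (mul_le_mul_right (hb j) _).trans (le_of_eq ?_)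
        rw [← mul_assoc, ← mul_assoc, ← ENNReal.ofReal_mul (by positivity),
          ← ENNReal.ofReal_mul (by positivity)]
        congr 2
        have : (w j)⁻¹ ^ 2 = 2 ^ (δ * |(j:ℝ)| / 16) := by
          rw [hw]; simp only
          rw [← Real.rpow_neg (by norm_num), ← Real.rpow_natCast, ← Real.rpow_mul (by norm_num)]
          congr 1; push_cast; ring
        rw [this, mul_left_comm, ← Real.rpow_add two_pos, mul_comm]
        congr 2; ring
    _ = _ := by
        rw [ENNReal.tsum_mul_right]
        change WW δ * (WW δ * _) = _
        ring

end CE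

namespace CE

lemma add_sq_le4 (a b : ℝ≥0∞) : (a + b) ^ 2 ≤ 4 * (a ^ 2 + b ^ 2) := by
  rcases le_total a b with h | h
  · calc (a + b) ^ 2 ≤ (b + b) ^ 2 := by gcongr
      _ = 4 * (b ^ 2) := by ring
      _ ≤ _ := by gcongr; exact le_add_self
  · calc (a + b) ^ 2 ≤ (a + a) ^ 2 := by gcongr
      _ = 4 * (a ^ 2) := by ring
      _ ≤ _ := by gcongr; exact le_self_add

lemma lint_add_sq {F G : ℝ → ℝ≥0∞} (hF : AEMeasurable F) {c d I : ℝ≥0∞}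
    (h1 : ∫⁻ x, F x ^ 2 ≤ c * I) (h2 : ∫⁻ x, G x ^ 2 ≤ d * I) :
    ∫⁻ x, (F x + G x) ^ 2 ≤ 4 * (c + d) * I := by
  calc _ ≤ ∫⁻ x, 4 * (F x ^ 2 + G x ^ 2) := lintegral_mono fun x => add_sq_le4 _ _
    _ = 4 * ((∫⁻ x, F x ^ 2) + ∫⁻ x, G x ^ 2) := by
        rw [lintegral_const_mul' _ _ (by simp), lintegral_add_left' (by fun_prop)]
    _ ≤ 4 * (c * I + d * I) := by gcongr
    _ = _ := by ring

noncomputable def gg (f : ℝ → ℂ) (x y : ℝ) : ℂ := (f (x - y) - f (x + y)) / (y : ℂ)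

structure Nice (f : ℝ → ℂ) : Prop where
  cont : Continuous f
  int : Integrable f
  l2 : ∫⁻ z, ‖f z‖ₑ ^ 2 ≠ ∞
  gint : ∀ x, IntegrableOn (gg f x) (Ioi 0)

lemma fold {h : ℝ → ℂ} (hh : Integrable h) : ∫ y, h y = ∫ y in Ioi 0, (h y + h (-y)) := by
  rw [← intervalIntegral.integral_Iic_add_Ioi (b := 0) hh.integrableOn hh.integrableOn,
    integral_add hh.integrableOn hh.comp_neg.integrableOn, integral_comp_neg_Ioi, neg_zero, add_comm]

lemma fold_ker {f k : ℝ → ℂ} (hf : Integrable f) (hk : Measurable k) {C s : ℝ} (hs : 0 < s)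
    (hC : ∀ y, ‖k y‖ ≤ C) (h0 : ∀ y, y < s → k y = 0) (x : ℝ) :
    Integrable (fun y => k |y| * f (x - y) / (y : ℂ)) ∧
    ∫ y, k |y| * f (x - y) / (y : ℂ) = ∫ y in Ioi 0, k y * gg f x y := by
  have hC0 : 0 ≤ C := (norm_nonneg _).trans (hC 0)
  have hi : Integrable (fun y => k |y| * f (x - y) / (y : ℂ)) := by
    have : (fun y => k |y| * f (x - y) / (y : ℂ)) = fun y => (k |y| / (y : ℂ)) * f (x - y) := by
      ext y; ring
    rw [this]
    refine (hf.comp_sub_left x).bdd_mul (c := C * s⁻¹) (Measurable.aestronglyMeasurable ?_)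
      (ae_of_all _ fun y => ?_)
    · exact (hk.comp measurable_norm).div (by fun_prop)
    · by_cases hy : |y| < s
      · rw [h0 _ hy]; simp; positivity
      · rw [norm_div, Complex.norm_real, div_eq_mul_inv]
        push Not at hy
        gcongr
        · exact hC _
        · exact hy
  refine ⟨hi, ?_⟩
  rw [fold hi]
  refine setIntegral_congr_fun measurableSet_Ioi fun y hy => ?_
  simp only [gg, abs_neg, abs_of_pos (mem_Ioi.1 hy), sub_neg_eq_add, Complex.ofReal_neg]
  rw [div_neg]; ring

noncomputable def tk (r y : ℝ) : ℂ := if r < |y| then ((y⁻¹ : ℝ) : ℂ) else 0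

@[fun_prop]
lemma measurable_tk {α : Type*} [MeasurableSpace α] {f g : α → ℝ} (hf : Measurable f)
    (hg : Measurable g) : Measurable fun x => tk (f x) (g x) := by
  unfold tk
  refine Measurable.ite ?_ (by fun_prop) measurable_const
  exact measurableSet_lt hf (hg.abs)

@[fun_prop]
lemma measurable_qk' {α : Type*} [MeasurableSpace α] {f g : α → ℝ} (hf : Measurable f)
    (hg : Measurable g) : Measurable fun x => qk (f x) (g x) := by
  unfold qk; fun_prop

lemma tk_sub_qk {r : ℝ} (hr : 0 < r) (y : ℝ) : ‖tk r y - (qk r y : ℂ)‖ ≤ 1 * pk r y := by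
  have hp : 0 < r^2 + y^2 := by positivity
  unfold tk qk pk
  rw [one_mul]
  split_ifs with h
  · have hy : y ≠ 0 := by rintro rfl; simp at h; linarith
    rw [← Complex.ofReal_sub, Complex.norm_real, Real.norm_eq_abs]
    have : y⁻¹ - y / (r^2 + y^2) = r * r / (y * (r^2 + y^2)) := by field_simp; ring
    rw [this, abs_div, abs_mul y, abs_of_pos hp, abs_of_pos (by positivity),
      div_le_div_iff₀ (by positivity) hp]
    have : 0 ≤ r * (r^2 + y^2) := by positivity
    nlinarith
  · rw [zero_sub, norm_neg, Complex.norm_real, Real.norm_eq_abs, abs_div, abs_of_pos hp]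
    push Not at h
    gcongr

lemma qk_le {r : ℝ} (hr : 0 < r) (y : ℝ) : |qk r y| ≤ r⁻¹ := by
  have hp : 0 < r^2 + y^2 := by positivity
  unfold qk
  rw [abs_div, abs_of_pos hp, inv_eq_one_div, div_le_div_iff₀ hp hr]
  nlinarith [sq_nonneg (|y| - r), sq_abs y, sq_nonneg y, sq_nonneg r, abs_nonneg y]

lemma tk_le {r : ℝ} (hr : 0 < r) (y : ℝ) : ‖tk r y‖ ≤ r⁻¹ := by
  unfold tk
  split_ifs with h
  · rw [Complex.norm_real, norm_inv]; exact inv_anti₀ hr h.le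
  · simp; positivity

lemma trunc_bound {ρ : ℝ → ℝ} (hρ : Measurable ρ) {a b : ℝ} (ha : 0 < a)
    (hab : ∀ x, a ≤ ρ x ∧ ρ x ≤ b) {f : ℝ → ℂ} (hf : Nice f) :
    ∫⁻ x, ‖∫ z, tk (ρ x) (x - z) * f z‖ₑ ^ 2 ≤ ENNReal.ofReal 30000 * ∫⁻ z, ‖f z‖ₑ ^ 2 := by
  have h0 : ∀ x, 0 < ρ x := fun x => ha.trans_le (hab x).1
  have hfm := hf.cont.measurable
  have b1 := qk_bound hρ ha hab hfm hf.l2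
  have b2 := dom_bound (K := fun x z => tk (ρ x) (x - z) - (qk (ρ x) (x - z) : ℂ)) (c := 1)
    zero_le_one hρ ha hab (fun x z => tk_sub_qk (h0 x) _) hfm
  have key := lint_add_sq (Measurable.aemeasurable ?_) b1 b2
  · calc _ ≤ _ := lintegral_mono fun x => ?_
      _ ≤ _ := key
      _ ≤ _ := ?_
    · simp only
      gcongr
      refine le_trans (le_of_eq ?_) (enorm_add_le _ _)
      rw [← integral_add]
      · congr 2; ext z; ring
      · refine hf.int.bdd_mul (c := (ρ x)⁻¹) (Measurable.aestronglyMeasurable (by fun_prop)) (ae_of_all _ fun z => ?_)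
        rw [Complex.norm_real]; exact qk_le (h0 x) _
      · refine hf.int.bdd_mul (c := (ρ x)⁻¹ + (ρ x)⁻¹) (Measurable.aestronglyMeasurable (by fun_prop)) (ae_of_all _ fun z => ?_)
        refine (norm_sub_le _ _).trans (add_le_add (tk_le (h0 x) _) ?_)
        rw [Complex.norm_real]; exact qk_le (h0 x) _
    · gcongr
      rw [← ENNReal.ofReal_add (by positivity) (by positivity),
        show (4:ℝ≥0∞) = ENNReal.ofReal 4 by simp, ← ENNReal.ofReal_mul (by norm_num)]
      apply ENNReal.ofReal_le_ofReal
      have := Real.pi_lt_four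
      nlinarith
  · refine Measurable.enorm (StronglyMeasurable.measurable ?_)
    exact StronglyMeasurable.integral_prod_right'
      (f := fun p : ℝ × ℝ => (qk (ρ p.1) (p.1 - p.2) : ℂ) * f p.2)
      (Measurable.stronglyMeasurable (by fun_prop))

lemma trunc_eq {f : ℝ → ℂ} (hf : Nice f) {r : ℝ} (hr : 0 < r) (x : ℝ) :
    ∫ z, tk r (x - z) * f z = ∫ y in Ioi r, gg f x y := by
  have h := (fold_ker (k := (Ioi r).indicator fun _ => 1) hf.int
    (measurable_const.indicator measurableSet_Ioi) (C := 1) (s := r) hr (fun y => ?_)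
    (fun y hy => ?_) x).2
  · rw [← integral_sub_left_eq_self _ volume x]
    have e1 : ∀ y, tk r (x - (x - y)) * f (x - y) =
        (Ioi r).indicator (fun _ => (1:ℂ)) |y| * f (x - y) / (y : ℂ) := by
      intro y
      rw [sub_sub_cancel]
      unfold tk
      by_cases h : r < |y|
      · rw [if_pos h, indicator_of_mem (mem_Ioi.2 h)]; push_cast; ring
      · rw [if_neg h, indicator_of_notMem (by simpa using h)]; simp
    simp_rw [e1]
    rw [h]
    have e2 : ∀ y, (Ioi r).indicator (fun _ => (1:ℂ)) y * gg f x y =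
        (Ioi r).indicator (gg f x) y := by
      intro y
      by_cases h : y ∈ Ioi r
      · rw [indicator_of_mem h, indicator_of_mem h, one_mul]
      · rw [indicator_of_notMem h, indicator_of_notMem h, zero_mul]
    simp_rw [e2]
    rw [setIntegral_indicator measurableSet_Ioi]
    congr 2
    ext y; simp only [mem_inter_iff, mem_Ioi]
    exact ⟨fun h => h.2, fun h => ⟨hr.trans h, h⟩⟩
  · by_cases h : y ∈ Ioi r
    · rw [indicator_of_mem h]; simp
    · rw [indicator_of_notMem h]; simp
  · exact indicator_of_notMem (by simpa using hy.le) _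

lemma measurable_gg {f : ℝ → ℂ} (hf : Continuous f) :
    Measurable (fun p : ℝ × ℝ => gg f p.1 p.2) := by
  unfold gg
  exact ((hf.measurable.comp (by fun_prop)).sub (hf.measurable.comp (by fun_prop))).div
    (by fun_prop)

lemma tail_bound {ρ : ℝ → ℝ} (hρ : Measurable ρ) {a b : ℝ} (ha : 0 < a)
    (hab : ∀ x, a ≤ ρ x ∧ ρ x ≤ b) {f : ℝ → ℂ} (hf : Nice f) :
    ∫⁻ x, ‖∫ y in Ioi (ρ x), gg f x y‖ₑ ^ 2 ≤ ENNReal.ofReal 30000 * ∫⁻ z, ‖f z‖ₑ ^ 2 := by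
  refine le_trans (le_of_eq ?_) (trunc_bound hρ ha hab hf)
  congr 1; ext x
  rw [trunc_eq hf (ha.trans_le (hab x).1)]

lemma hilbert_bound {f : ℝ → ℂ} (hf : Nice f) :
    ∫⁻ x, ‖∫ y in Ioi 0, gg f x y‖ₑ ^ 2 ≤ ENNReal.ofReal 30000 * ∫⁻ z, ‖f z‖ₑ ^ 2 := by
  set s : ℕ → ℝ := fun n => 1 / ((n:ℝ) + 1) with hs
  have s0 : ∀ n, 0 < s n := fun n => by positivity
  have hb : ∀ n, ∫⁻ x, ‖∫ y in Ioi (s n), gg f x y‖ₑ ^ 2 ≤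
      ENNReal.ofReal 30000 * ∫⁻ z, ‖f z‖ₑ ^ 2 := fun n =>
    tail_bound (ρ := fun _ => s n) measurable_const (s0 n) (fun x => ⟨le_rfl, le_rfl⟩) hf
  have hlim : ∀ x, Tendsto (fun n => ‖∫ y in Ioi (s n), gg f x y‖ₑ ^ 2) atTop
      (𝓝 (‖∫ y in Ioi 0, gg f x y‖ₑ ^ 2)) := by
    intro x
    have hU : ⋃ n, Ioi (s n) = Ioi 0 := by
      ext y; simp only [mem_iUnion, mem_Ioi]
      constructor
      · rintro ⟨n, h⟩; exact (s0 n).trans h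
      · intro h; exact exists_nat_one_div_lt h
    have := tendsto_setIntegral_of_monotone (μ := volume) (f := gg f x)
      (s := fun n => Ioi (s n)) (fun n => measurableSet_Ioi)
      (fun m n hmn => Ioi_subset_Ioi (by
        simp only [hs]; gcongr)) (by rw [hU]; exact hf.gint x)
    rw [hU] at this
    exact (ENNReal.continuous_pow 2).continuousAt.tendsto.comp
      ((continuous_enorm.tendsto _).comp this)
  calc _ = ∫⁻ x, liminf (fun n => ‖∫ y in Ioi (s n), gg f x y‖ₑ ^ 2) atTop := by
        congr 1; ext x; exact (hlim x).liminf_eq.symm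
    _ ≤ liminf (fun n => ∫⁻ x, ‖∫ y in Ioi (s n), gg f x y‖ₑ ^ 2) atTop := by
        refine lintegral_liminf_le fun n => ?_
        refine Measurable.pow_const (Measurable.enorm (StronglyMeasurable.measurable ?_)) _
        exact StronglyMeasurable.integral_prod_right' (f := fun p : ℝ × ℝ => gg f p.1 p.2)
          (measurable_gg hf.cont).stronglyMeasurable
    _ ≤ _ := by
        refine liminf_le_of_le (by isBoundedDefault) fun b hb' => ?_
        obtain ⟨n, hn⟩ := hb'.exists
        exact hn.trans (hb n)

end CE

namespace CE

open Classical in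
lemma kj_eq {σ ε r y : ℝ} {j : ℤ} (hr : 0 < r) (h : y ∈ Ioc ((2:ℝ)^j * r) ((2:ℝ)^(j+1) * r)) :
    kj σ ε j ((2:ℝ)^j * r) y = (Complex.exp (Complex.I * ((σ * (y / r) ^ ε : ℝ) : ℂ)) -
      (if low ε j then 1 else 0)) * ((y⁻¹ : ℝ) : ℂ) := by
  have h2 : (0:ℝ) < 2 ^ j := by positivity
  have hy : 0 < y := (by positivity : (0:ℝ) < 2 ^ j * r).trans h.1
  have hc : (2:ℝ)^j * r < y ∧ y ≤ 2 * ((2:ℝ)^j * r) := by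
    refine ⟨h.1, h.2.trans (le_of_eq ?_)⟩
    rw [zpow_add_one₀ (by norm_num)]; ring
  have e : σ * 2 ^ ((j:ℝ) * ε) * (y / ((2:ℝ)^j * r)) ^ ε = σ * (y / r) ^ ε := by
    rw [Real.rpow_mul (by norm_num), Real.rpow_intCast, mul_assoc, ← Real.mul_rpow (by positivity)
      (by positivity)]
    congr 2; field_simp
  unfold kj kk
  rw [if_pos hc, e, if_pos hc]
  split_ifs <;> simp [sub_mul]

lemma kj_out {σ ε r y : ℝ} {j : ℤ} (h : y ∉ Ioc ((2:ℝ)^j * r) ((2:ℝ)^(j+1) * r)) :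
    kj σ ε j ((2:ℝ)^j * r) y = 0 := by
  have hc : ¬ ((2:ℝ)^j * r < y ∧ y ≤ 2 * ((2:ℝ)^j * r)) := by
    intro hc; apply h
    refine ⟨hc.1, hc.2.trans (le_of_eq ?_)⟩
    rw [zpow_add_one₀ (by norm_num)]; ring
  unfold kj kk
  rw [if_neg hc, if_neg hc]; simp

lemma kj_le {σ ε ρ : ℝ} {j : ℤ} (hρ : 0 < ρ) (y : ℝ) : ‖kj σ ε j ρ y‖ ≤ ρ⁻¹ + ρ⁻¹ := by
  have h : ∀ Λ, ‖kk Λ ε ρ y‖ ≤ ρ⁻¹ := fun Λ => (norm_kk_le hρ y).trans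
    (indicator_le_self' (fun _ _ => by positivity) _)
  unfold kj
  refine (norm_sub_le _ _).trans (add_le_add (h _) ?_)
  split_ifs
  · exact h _
  · simp; positivity

lemma Ioc_union {r : ℝ} (hr : 0 < r) : ⋃ j : ℤ, Ioc ((2:ℝ)^j * r) ((2:ℝ)^(j+1) * r) = Ioi 0 := by
  ext y
  simp only [mem_iUnion, mem_Ioi]
  constructor
  · rintro ⟨j, h⟩; exact (by positivity : (0:ℝ) < 2 ^ j * r).trans h.1
  · intro h
    obtain ⟨n, hn⟩ := exists_mem_Ioc_zpow (div_pos h hr) (one_lt_two : (1:ℝ) < 2)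
    exact ⟨n, (lt_div_iff₀ hr).1 hn.1, (div_le_iff₀ hr).1 hn.2⟩

lemma Ioc_disj {r : ℝ} (hr : 0 < r) :
    Pairwise (Function.onFun Disjoint fun j : ℤ => Ioc ((2:ℝ)^j * r) ((2:ℝ)^(j+1) * r)) := by
  have key : ∀ i j : ℤ, i < j → Disjoint (Ioc ((2:ℝ)^i * r) ((2:ℝ)^(i+1) * r))
      (Ioc ((2:ℝ)^j * r) ((2:ℝ)^(j+1) * r)) := by
    intro i j hij
    rw [Set.disjoint_left]
    intro y h1 h2
    have : (2:ℝ)^(i+1) * r ≤ 2^j * r := by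
      gcongr
      · norm_num
      · omega
    linarith [h1.2, h2.1]
  intro i j hij
  rcases lt_or_gt_of_ne hij with h | h
  · exact key i j h
  · exact (key j i h).symm

open Classical in
noncomputable def lset (ε r : ℝ) : Set ℝ := if 0 < ε then Iic r else Ioi r

lemma measurableSet_lset (ε r : ℝ) : MeasurableSet (lset ε r) := by
  unfold lset; split_ifs
  · exact measurableSet_Iic
  · exact measurableSet_Ioi

lemma mem_lset {ε r y : ℝ} {j : ℤ} (hε : ε ≠ 0) (hr : 0 < r)
    (h : y ∈ Ioc ((2:ℝ)^j * r) ((2:ℝ)^(j+1) * r)) : y ∈ lset ε r ↔ low ε j := by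
  unfold lset low
  have a1 : 0 ≤ j → r < y := fun hj => by
    have : (1:ℝ) ≤ 2 ^ j := one_le_zpow₀ (by norm_num) hj
    nlinarith [h.1]
  have a2 : j < 0 → y ≤ r := fun hj => by
    have : (2:ℝ) ^ (j+1) ≤ 1 := zpow_le_one_of_nonpos₀ (by norm_num) (by omega)
    nlinarith [h.2]
  split_ifs with he
  · simp only [mem_Iic]
    constructor
    · intro hy
      left; refine ⟨he, ?_⟩
      by_contra hc
      linarith [a1 (not_lt.1 hc)]
    · rintro (⟨_, hj⟩ | ⟨h', _⟩)
      · exact a2 hj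
      · linarith
  · have he' : ε < 0 := lt_of_le_of_ne (not_lt.1 he) hε
    simp only [mem_Ioi]
    constructor
    · intro hy
      right; refine ⟨he', ?_⟩
      by_contra hc
      linarith [a2 (not_le.1 hc)]
    · rintro (⟨h', _⟩ | ⟨_, hj⟩)
      · linarith
      · exact a1 hj

noncomputable def Pj (σ ε : ℝ) (j : ℤ) (τ r : ℝ) (f : ℝ → ℂ) (x : ℝ) : ℂ :=
  ∫ z, kj σ ε j ((2:ℝ)^j * r) (τ * (x - z)) * f z

lemma piece_eq {σ ε r : ℝ} {j : ℤ} (hε : ε ≠ 0) (hr : 0 < r) {f : ℝ → ℂ} (hf : Nice f) (x : ℝ) :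
    ∫ y in Ioc ((2:ℝ)^j * r) ((2:ℝ)^(j+1) * r),
      (Complex.exp (Complex.I * ((σ * (y / r) ^ ε : ℝ) : ℂ)) -
        (lset ε r).indicator (fun _ => 1) y) * gg f x y = Pj σ ε j 1 r f x - Pj σ ε j (-1) r f x := by
  have hρ : (0:ℝ) < 2 ^ j * r := by positivity
  rw [← integral_indicator measurableSet_Ioc]
  have e1 : ∀ y, (Ioc ((2:ℝ)^j * r) ((2:ℝ)^(j+1) * r)).indicator (fun y =>
      (Complex.exp (Complex.I * ((σ * (y / r) ^ ε : ℝ) : ℂ)) -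
        (lset ε r).indicator (fun _ => 1) y) * gg f x y) y =
      kj σ ε j ((2:ℝ)^j * r) y * f (x - y) - kj σ ε j ((2:ℝ)^j * r) y * f (x + y) := by
    intro y
    by_cases h : y ∈ Ioc ((2:ℝ)^j * r) ((2:ℝ)^(j+1) * r)
    · rw [indicator_of_mem h, kj_eq hr h, ← mul_sub, mul_assoc]
      congr 1
      · congr 1
        by_cases hl : low ε j
        · rw [if_pos hl, indicator_of_mem ((mem_lset hε hr h).2 hl)]
        · rw [if_neg hl, indicator_of_notMem (fun h' => hl ((mem_lset hε hr h).1 h'))]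
      · unfold gg; push_cast; ring
    · rw [indicator_of_notMem h, kj_out h]; simp
  simp_rw [e1]
  rw [integral_sub]
  · congr 1
    · rw [← integral_sub_left_eq_self _ volume x]
      unfold Pj; congr 1; ext z
      rw [one_mul, sub_sub_cancel]
    · rw [← integral_sub_right_eq_self _ x]
      unfold Pj; congr 1; ext z
      congr 2 <;> ring
  · exact (hf.int.comp_sub_left x).bdd_mul (Measurable.aestronglyMeasurable (by fun_prop))
      (ae_of_all _ fun y => kj_le hρ y)
  · exact (hf.int.comp_add_left x).bdd_mul (Measurable.aestronglyMeasurable (by fun_prop))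
      (ae_of_all _ fun y => kj_le hρ y)

lemma W_pt {σ ε r : ℝ} (hε : ε ≠ 0) (hr : 0 < r) {f : ℝ → ℂ} (hf : Nice f) (x : ℝ) :
    ‖∫ y in Ioi 0, Complex.exp (Complex.I * ((σ * (y / r) ^ ε : ℝ) : ℂ)) * gg f x y‖ₑ ≤
    ((∑' j, ‖Pj σ ε j 1 r f x‖ₑ) + ∑' j, ‖Pj σ ε j (-1) r f x‖ₑ) +
      (‖∫ y in Ioi 0, gg f x y‖ₑ + ‖∫ y in Ioi r, gg f x y‖ₑ) := by
  have hg := hf.gint x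
  have hme : Measurable fun y : ℝ => Complex.exp (Complex.I * ((σ * (y / r) ^ ε : ℝ) : ℂ)) := by
    fun_prop
  have hmi : Measurable fun y : ℝ => (lset ε r).indicator (fun _ => (1:ℂ)) y :=
    measurable_const.indicator (measurableSet_lset ε r)
  have hbi : ∀ y, ‖(lset ε r).indicator (fun _ => (1:ℂ)) y‖ ≤ 1 := by
    intro y
    by_cases h : y ∈ lset ε r
    · rw [indicator_of_mem h]; simp
    · rw [indicator_of_notMem h]; simp
  have i2 : IntegrableOn (fun y => (lset ε r).indicator (fun _ => (1:ℂ)) y * gg f x y) (Ioi 0) :=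
    hg.bdd_mul hmi.aestronglyMeasurable (ae_of_all _ hbi)
  have i1 : IntegrableOn (fun y => (Complex.exp (Complex.I * ((σ * (y / r) ^ ε : ℝ) : ℂ)) -
        (lset ε r).indicator (fun _ => 1) y) * gg f x y) (Ioi 0) := by
    refine hg.bdd_mul (c := 1 + 1) (hme.sub hmi).aestronglyMeasurable (ae_of_all _ fun y => ?_)
    refine (norm_sub_le _ _).trans (add_le_add ?_ (hbi y))
    rw [norm_exp_I_mul]
  have e0 : ∫ y in Ioi 0, Complex.exp (Complex.I * ((σ * (y / r) ^ ε : ℝ) : ℂ)) * gg f x y =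
      (∫ y in Ioi 0, (Complex.exp (Complex.I * ((σ * (y / r) ^ ε : ℝ) : ℂ)) -
        (lset ε r).indicator (fun _ => 1) y) * gg f x y) +
      ∫ y in Ioi 0, (lset ε r).indicator (fun _ => (1:ℂ)) y * gg f x y := by
    rw [← integral_add i1 i2]
    congr 1; ext y; ring
  rw [e0]
  refine (enorm_add_le _ _).trans (add_le_add ?_ ?_)
  · rw [← Ioc_union hr] at i1 ⊢
    have hs := hasSum_integral_iUnion (fun j => measurableSet_Ioc) (Ioc_disj hr) i1
    rw [← ENNReal.tsum_add]
    refine le_trans ?_ (ENNReal.tsum_le_tsum fun j => enorm_sub_le)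
    simp_rw [piece_eq hε hr hf x] at hs
    rw [← hs.tsum_eq]
    by_cases ht : ∑' j, ‖Pj σ ε j 1 r f x - Pj σ ε j (-1) r f x‖ₑ = ∞
    · rw [ht]; exact le_top
    · exact enorm_tsum_le_tsum_enorm
  · have e2 : ∀ y, (lset ε r).indicator (fun _ => (1:ℂ)) y * gg f x y =
        (lset ε r).indicator (gg f x) y := by
      intro y
      by_cases h : y ∈ lset ε r
      · rw [indicator_of_mem h, indicator_of_mem h, one_mul]
      · rw [indicator_of_notMem h, indicator_of_notMem h, zero_mul]
    simp_rw [e2]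
    rw [setIntegral_indicator (measurableSet_lset ε r)]
    unfold lset
    split_ifs with he
    · have hd := integral_inter_add_diff (μ := volume) (s := Ioi (0:ℝ)) (t := Iic r)
        measurableSet_Iic hg
      have hset : Ioi (0:ℝ) \ Iic r = Ioi r := by
        ext y; simp only [mem_diff, mem_Ioi, mem_Iic, not_le]
        exact ⟨fun h => h.2, fun h => ⟨hr.trans h, h⟩⟩
      rw [hset] at hd
      rw [eq_sub_of_add_eq hd]
      exact enorm_sub_le
    · have hset : Ioi (0:ℝ) ∩ Ioi r = Ioi r := by
        ext y; simp only [mem_inter_iff, mem_Ioi]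
        exact ⟨fun h => h.2, fun h => ⟨hr.trans h, h⟩⟩
      rw [hset]
      exact le_add_self

noncomputable def CW (δ : ℝ) : ℝ≥0∞ :=
  4 * (4 * (ENNReal.ofReal (720000 / δ) * WW δ ^ 2 + ENNReal.ofReal (720000 / δ) * WW δ ^ 2) +
    4 * (ENNReal.ofReal 30000 + ENNReal.ofReal 30000))

lemma measurable_Pj {σ ε τ : ℝ} {j : ℤ} {r : ℝ → ℝ} (hr : Measurable r) {f : ℝ → ℂ}
    (hf : Measurable f) : Measurable fun x => ‖Pj σ ε j τ (r x) f x‖ₑ := by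
  refine Measurable.enorm (StronglyMeasurable.measurable ?_)
  exact StronglyMeasurable.integral_prod_right'
      (f := fun p : ℝ × ℝ => kj σ ε j ((2:ℝ)^j * r p.1) (τ * (p.1 - p.2)) * f p.2)
      (Measurable.stronglyMeasurable (by fun_prop))

lemma W_bound {δ ε σ : ℝ} (hδ : 0 < δ) (hδ1 : δ < 1) (hε : δ < |ε|)
    (hε1 : δ < |ε - 1|) (hσ : |σ| = 1)
    {r : ℝ → ℝ} (hr : Measurable r) {a b : ℝ} (ha : 0 < a)
    (hab : ∀ x, a ≤ r x ∧ r x ≤ b) {f : ℝ → ℂ} (hf : Nice f) :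
    ∫⁻ x, ‖∫ y in Ioi 0, Complex.exp (Complex.I * ((σ * (y / r x) ^ ε : ℝ) : ℂ)) * gg f x y‖ₑ ^ 2 ≤
      CW δ * ∫⁻ z, ‖f z‖ₑ ^ 2 := by
  have hne : ε ≠ 0 := by rintro rfl; simp at hε; linarith
  have h0 : ∀ x, 0 < r x := fun x => ha.trans_le (hab x).1
  have hfm := hf.cont.measurable
  have hP : ∀ τ : ℝ, (τ = 1 ∨ τ = -1) → ∫⁻ x, (∑' j, ‖Pj σ ε j τ (r x) f x‖ₑ) ^ 2 ≤
      ENNReal.ofReal (720000 / δ) * WW δ ^ 2 * ∫⁻ z, ‖f z‖ₑ ^ 2 := by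
    intro τ hτ
    refine sum_bound _ (by positivity) (fun j => (measurable_Pj hr hfm).aemeasurable) fun j => ?_
    have h2 : (0:ℝ) < 2 ^ j := by positivity
    exact piece_bound (ρ := fun x => (2:ℝ)^j * r x) hδ hδ1 hε hε1 hσ hτ (by fun_prop)
      (mul_pos h2 ha) (b := 2 ^ j * b) (fun x => ⟨by gcongr; exact (hab x).1, by gcongr; exact (hab x).2⟩) hfm hf.l2
  have m1 : ∀ τ, Measurable fun x => ∑' j, ‖Pj σ ε j τ (r x) f x‖ₑ := fun τ =>
    Measurable.ennreal_tsum fun j => measurable_Pj hr hfm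
  have mH : Measurable fun x => ‖∫ y in Ioi 0, gg f x y‖ₑ := by
    refine Measurable.enorm (StronglyMeasurable.measurable ?_)
    exact StronglyMeasurable.integral_prod_right' (f := fun p : ℝ × ℝ => gg f p.1 p.2)
          (measurable_gg hf.cont).stronglyMeasurable
  have k1 := lint_add_sq (m1 1).aemeasurable (hP 1 (Or.inl rfl)) (hP (-1) (Or.inr rfl))
  have k2 := lint_add_sq mH.aemeasurable (hilbert_bound hf) (tail_bound hr ha hab hf)
  have k3 := lint_add_sq ((m1 1).add (m1 (-1))).aemeasurable k1 k2
  refine le_trans (lintegral_mono fun x => ?_) k3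
  simp only
  gcongr
  exact W_pt hne (h0 x) hf x

end CE

namespace CE

lemma nice_schwartz (f : SchwartzMap ℝ ℂ) : Nice (fun y => f y) := by
  have hc : Continuous (fun y => f y) := f.continuous
  have hi : Integrable (fun y => f y) := f.integrable
  refine ⟨hc, hi, ?_, fun x => ?_⟩
  · have h := (f.memLp 2 volume).eLpNorm_lt_top
    have := lintegral_rpow_enorm_lt_top_of_eLpNorm_lt_top (by norm_num) (by norm_num) h
    simpa using this.ne
  · have hmeas : AEStronglyMeasurable (gg (fun y => f y) x) := by
      have := (measurable_gg hc).comp (measurable_const (a := x) |>.prodMk measurable_id)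
      exact this.aestronglyMeasurable
    rw [← Ioc_union_Ioi_eq_Ioi (zero_le_one : (0:ℝ) ≤ 1)]
    refine IntegrableOn.union ?_ ?_
    · obtain ⟨C, hC⟩ := f.decay 0 1
      have hL : ∀ u v : ℝ, ‖f u - f v‖ ≤ C * ‖u - v‖ := fun u v => by
        refine Convex.norm_image_sub_le_of_norm_deriv_le (s := univ) (fun z _ => f.differentiableAt)
          (fun z _ => ?_) convex_univ (mem_univ _) (mem_univ _)
        have := hC.2 z
        simpa [norm_iteratedFDeriv_eq_norm_iteratedDeriv, iteratedDeriv_one] using this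
      refine Integrable.mono' (g := fun _ => 2 * C) (integrableOn_const (by simp)) hmeas.restrict ?_
      filter_upwards [ae_restrict_mem measurableSet_Ioc] with y hy
      unfold gg
      rw [norm_div, Complex.norm_real, div_le_iff₀ (norm_pos_iff.2 hy.1.ne')]
      have := hL (x - y) (x + y)
      have e : ‖x - y - (x + y)‖ = 2 * ‖y‖ := by
        rw [show x - y - (x + y) = -2 * y by ring, norm_mul]; norm_num
      rw [e] at this
      linarith
    · have h1 : Integrable (fun y => f (x - y)) := hi.comp_sub_left x
      have h2 : Integrable (fun y => f (x + y)) := hi.comp_add_left x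
      refine Integrable.mono' (h1.norm.add h2.norm).integrableOn hmeas.restrict ?_
      filter_upwards [ae_restrict_mem measurableSet_Ioi] with y hy
      have hy' : (1:ℝ) < y := hy
      unfold gg
      rw [norm_div, Complex.norm_real, div_le_iff₀ (by simp; linarith)]
      have h3 : 1 ≤ ‖y‖ := hy'.le.trans (le_abs_self y)
      have h4 := norm_sub_le (f (x - y)) (f (x + y))
      simp only [Pi.add_apply]
      nlinarith [norm_nonneg (f (x - y)), norm_nonneg (f (x + y))]

noncomputable def JJ (ε : ℝ) (f : ℝ → ℂ) (A x : ℝ) : ℂ :=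
  ∫ y in Ioi 0, Complex.exp (Complex.I * ((A * y ^ ε : ℝ) : ℂ)) * gg f x y

lemma gg_aesm {f : ℝ → ℂ} (hf : Nice f) (x : ℝ) : AEStronglyMeasurable (gg f x) := by
  have := (measurable_gg hf.cont).comp (measurable_const (a := x) |>.prodMk measurable_id)
  exact this.aestronglyMeasurable

lemma pv_eq {f : ℝ → ℂ} (hf : Nice f) (ε A x : ℝ) :
    pvIntegral (fun y => Complex.exp (Complex.I * (A : ℂ) * ((|y| ^ ε : ℝ) : ℂ)) * f (x - y) / (y : ℂ))
      = JJ ε f A x := by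
  unfold pvIntegral
  refine Tendsto.limUnder_eq ?_
  let k : ℝ → ℂ := fun y => Complex.exp (Complex.I * ((A * y ^ ε : ℝ) : ℂ))
  have hk : Measurable k := by fun_prop
  have hk1 : ∀ y, ‖k y‖ = 1 := fun y => norm_exp_I_mul _
  have hkm : ∀ s t : ℝ, Measurable ((Icc s t).indicator k) := fun s t => hk.indicator measurableSet_Icc
  have hle : ∀ s t y, ‖(Icc s t).indicator k y‖ ≤ 1 := fun s t y => by
    refine (norm_indicator_le_norm_self _ _).trans (hk1 y).le
  have main : Tendsto (fun p : ℝ × ℝ => ∫ y in Ioi 0, (Icc p.1 p.2).indicator k y * gg f x y)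
      (𝓝[>] (0:ℝ) ×ˢ atTop) (𝓝 (∫ y in Ioi 0, k y * gg f x y)) := by
    refine tendsto_integral_filter_of_dominated_convergence (fun y => ‖gg f x y‖) ?_ ?_ ?_ ?_
    · exact Eventually.of_forall fun p => 
        ((hkm _ _).aestronglyMeasurable.mul (gg_aesm hf x)).restrict
    · refine Eventually.of_forall fun p => Eventually.of_forall fun y => ?_
      rw [norm_mul]
      exact mul_le_of_le_one_left (norm_nonneg _) (hle _ _ _)
    · exact (hf.gint x).norm
    · filter_upwards [ae_restrict_mem measurableSet_Ioi] with y hy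
      refine tendsto_const_nhds.congr' ?_
      have h1 : ∀ᶠ s in 𝓝[>] (0:ℝ), s ≤ y := 
        mem_nhdsWithin_of_mem_nhds (Iic_mem_nhds hy)
      filter_upwards [h1.prod_mk (eventually_ge_atTop y)] with p hp
      rw [indicator_of_mem (show y ∈ Icc p.1 p.2 from hp)]
  refine main.congr' ?_
  have h0 : ∀ᶠ s in 𝓝[>] (0:ℝ), 0 < s := eventually_mem_nhdsWithin
  filter_upwards [h0.prod_inl atTop] with p hp
  have := (fold_ker hf.int (hkm p.1 p.2) hp (hle _ _) (fun y hy => ?_) x).2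
  · rw [← this, ← integral_indicator]
    · congr 1
      ext y
      by_cases h : p.1 ≤ |y| ∧ |y| ≤ p.2
      · rw [indicator_of_mem (show |y| ∈ Icc p.1 p.2 from h), indicator_of_mem (by exact h)]
        simp only [k]
        push_cast
        rw [mul_assoc]
      · rw [indicator_of_notMem (show |y| ∉ Icc p.1 p.2 from h), indicator_of_notMem (by exact h)]
        simp
    · exact (measurableSet_le measurable_const measurable_abs).inter
        (measurableSet_le measurable_abs measurable_const)
  · exact indicator_of_notMem (fun h => absurd h.1 (not_le.2 hy)) _

lemma JJ_cont {f : ℝ → ℂ} (hf : Nice f) (ε x : ℝ) : Continuous fun A => JJ ε f A x := by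
  unfold JJ
  refine continuous_of_dominated (bound := fun y => ‖gg f x y‖) ?_ ?_ (hf.gint x).norm ?_
  · intro A
    refine (AEStronglyMeasurable.mul ?_ (gg_aesm hf x)).restrict
    exact Measurable.aestronglyMeasurable (by fun_prop)
  · refine fun A => Eventually.of_forall fun y => ?_
    rw [norm_mul, norm_exp_I_mul, one_mul]
  · refine Eventually.of_forall fun y => ?_
    fun_prop

lemma JJ_meas {f : ℝ → ℂ} (hf : Nice f) (ε : ℝ) {A : ℝ → ℝ} (hA : Measurable A) :
    Measurable fun x => ‖JJ ε f (A x) x‖ₑ := by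
  refine Measurable.enorm (StronglyMeasurable.measurable ?_)
  unfold JJ
  refine StronglyMeasurable.integral_prod_right (f := fun x y : ℝ =>
    Complex.exp (Complex.I * ((A x * y ^ ε : ℝ) : ℂ)) * gg f x y) ?_
  refine StronglyMeasurable.mul ?_ (measurable_gg hf.cont).stronglyMeasurable
  exact Measurable.stronglyMeasurable (by fun_prop)

lemma rpow_bounds {a b c t : ℝ} (ha : 0 < a) (h1 : a ≤ c) (h2 : c ≤ b) :
    min (a ^ t) (b ^ t) ≤ c ^ t ∧ c ^ t ≤ max (a ^ t) (b ^ t) := by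
  have hc := ha.trans_le h1
  rcases le_total 0 t with ht | ht
  · exact ⟨(min_le_left _ _).trans (Real.rpow_le_rpow ha.le h1 ht),
      (Real.rpow_le_rpow hc.le h2 ht).trans (le_max_right _ _)⟩
  · exact ⟨(min_le_right _ _).trans (Real.rpow_le_rpow_of_nonpos hc h2 ht),
      (Real.rpow_le_rpow_of_nonpos ha h1 ht).trans (le_max_left _ _)⟩

lemma sel_bound {δ ε : ℝ} (hδ : 0 < δ) (hδ1 : δ < 1) (hε : δ < |ε|) (hε1 : δ < |ε - 1|)
    {A : ℝ → ℝ} (hA : Measurable A) {a b : ℝ} (ha : 0 < a) (hab : ∀ x, a ≤ |A x| ∧ |A x| ≤ b)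
    {f : ℝ → ℂ} (hf : Nice f) :
    ∫⁻ x, ‖JJ ε f (A x) x‖ₑ ^ 2 ≤ 4 * (CW δ + CW δ) * ∫⁻ z, ‖f z‖ₑ ^ 2 := by
  have hε0 : ε ≠ 0 := by
    rintro rfl; simp at hε; linarith
  let r : ℝ → ℝ := fun x => |A x| ^ (-1 / ε)
  have hr : Measurable r := by fun_prop
  have hb : 0 < b := ha.trans_le ((hab 0).1.trans (hab 0).2)
  have hrb : ∀ x, min (a ^ (-1/ε)) (b ^ (-1/ε)) ≤ r x ∧ r x ≤ max (a ^ (-1/ε)) (b ^ (-1/ε)) :=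
    fun x => rpow_bounds ha (hab x).1 (hab x).2
  have ha' : 0 < min (a ^ (-1/ε)) (b ^ (-1/ε)) := lt_min (by positivity) (by positivity)
  have key : ∀ x y, 0 < y → (y / r x) ^ ε = |A x| * y ^ ε := fun x y hy => by
    have h0 : 0 < |A x| := ha.trans_le (hab x).1
    have hr0 : 0 ≤ r x := by positivity
    rw [Real.div_rpow hy.le hr0]
    simp only [r]
    rw [← Real.rpow_mul h0.le, div_mul_cancel₀ _ hε0, Real.rpow_neg_one, div_inv_eq_mul, mul_comm]
  have W := fun σ (hσ : |σ| = 1) => W_bound (σ := σ) hδ hδ1 hε hε1 hσ hr ha' hrb hf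
  have eq : ∀ σ x, ∫ y in Ioi 0, Complex.exp (Complex.I * ((σ * (y / r x)^ε : ℝ):ℂ)) * gg f x y
      = JJ ε f (σ * |A x|) x := fun σ x => by
    unfold JJ
    refine setIntegral_congr_fun measurableSet_Ioi fun y hy => ?_
    simp only [key x y hy, mul_assoc]
  simp only [eq] at W
  refine le_trans (lintegral_mono fun x => ?_)
    (lint_add_sq (JJ_meas hf ε (by fun_prop)).aemeasurable (W 1 (by simp)) (W (-1) (by simp)))
  gcongr
  rcases le_total 0 (A x) with h | h
  · rw [abs_of_nonneg h, one_mul]; exact le_self_add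
  · rw [abs_of_nonpos h, neg_one_mul, neg_neg]; exact le_add_self

noncomputable def BB (ε : ℝ) (f : ℝ → ℂ) (q : ℕ → ℝ) : ℕ → ℝ → ℝ
  | 0 => fun _ => q 0
  | n + 1 => fun x => by
      classical
      exact if ‖JJ ε f (BB ε f q n x) x‖ₑ < ‖JJ ε f (q (n+1)) x‖ₑ then q (n+1) else BB ε f q n x

lemma BB_meas {f : ℝ → ℂ} (hf : Nice f) (ε : ℝ) (q : ℕ → ℝ) (n : ℕ) : Measurable (BB ε f q n) := by
  induction n with
  | zero => exact measurable_const
  | succ n ih =>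
    exact Measurable.ite (measurableSet_lt (JJ_meas hf ε ih) (JJ_meas hf ε measurable_const))
      measurable_const ih

lemma BB_bd (ε : ℝ) (f : ℝ → ℂ) {q : ℕ → ℝ} (hq : ∀ n, q n ≠ 0) (n : ℕ) :
    ∃ a b : ℝ, 0 < a ∧ ∀ x, a ≤ |BB ε f q n x| ∧ |BB ε f q n x| ≤ b := by
  induction n with
  | zero => exact ⟨|q 0|, |q 0|, abs_pos.2 (hq 0), fun x => ⟨le_rfl, le_rfl⟩⟩
  | succ n ih =>
    obtain ⟨a, b, ha, h⟩ := ih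
    refine ⟨min a |q (n+1)|, max b |q (n+1)|, lt_min ha (abs_pos.2 (hq _)), fun x => ?_⟩
    simp only [BB]
    split_ifs
    · exact ⟨min_le_right _ _, le_max_right _ _⟩
    · exact ⟨(min_le_left _ _).trans (h x).1, (h x).2.trans (le_max_left _ _)⟩

lemma BB_step (ε : ℝ) (f : ℝ → ℂ) (q : ℕ → ℝ) (n : ℕ) (x : ℝ) :
    ‖JJ ε f (BB ε f q n x) x‖ₑ ≤ ‖JJ ε f (BB ε f q (n+1) x) x‖ₑ ∧
    ‖JJ ε f (q (n+1)) x‖ₑ ≤ ‖JJ ε f (BB ε f q (n+1) x) x‖ₑ := by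
  simp only [BB]
  split_ifs with h
  · exact ⟨h.le, le_rfl⟩
  · exact ⟨le_rfl, not_lt.1 h⟩

lemma sup_bound {δ ε : ℝ} (hδ : 0 < δ) (hδ1 : δ < 1) (hε : δ < |ε|) (hε1 : δ < |ε - 1|)
    {f : ℝ → ℂ} (hf : Nice f) :
    ∫⁻ x, (⨆ A : ℝ, ‖JJ ε f A x‖ₑ) ^ 2 ≤ 4 * (CW δ + CW δ) * ∫⁻ z, ‖f z‖ₑ ^ 2 := by
  obtain ⟨q, hqd, hq⟩ : ∃ q : ℕ → ℝ, DenseRange q ∧ ∀ n, q n ≠ 0 := by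
    have hd : Dense ({0}ᶜ : Set ℝ) := dense_compl_singleton 0
    have : Nonempty ({0}ᶜ : Set ℝ) := ⟨⟨1, by simp⟩⟩
    refine ⟨fun n => (TopologicalSpace.denseSeq ({0}ᶜ : Set ℝ) n : ℝ), ?_, fun n => ?_⟩
    · exact hd.denseRange_val.comp (TopologicalSpace.denseRange_denseSeq _) continuous_subtype_val
    · exact (TopologicalSpace.denseSeq ({0}ᶜ : Set ℝ) n).2
  have hmono : Monotone fun n x => ‖JJ ε f (BB ε f q n x) x‖ₑ ^ 2 :=
    monotone_nat_of_le_succ fun n x => by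
      have := (BB_step ε f q n x).1
      dsimp only
      gcongr
  have hsup : ∀ x, (⨆ A : ℝ, ‖JJ ε f A x‖ₑ) ^ 2 ≤ ⨆ n, ‖JJ ε f (BB ε f q n x) x‖ₑ ^ 2 := fun x => by
    have h2 : ∀ A : ℝ, ‖JJ ε f A x‖ₑ ^ 2 ≤ ⨆ n, ‖JJ ε f (BB ε f q n x) x‖ₑ ^ 2 := by
      intro A
      refine hqd.induction_on (p := fun A => ‖JJ ε f A x‖ₑ ^ 2 ≤ ⨆ n, ‖JJ ε f (BB ε f q n x) x‖ₑ ^ 2)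
        A ?_ ?_
      · refine isClosed_le ?_ continuous_const
        exact (ENNReal.continuous_pow 2).comp (JJ_cont hf ε x).enorm
      · intro n
        refine le_trans ?_ (le_iSup _ n)
        gcongr
        cases n with
        | zero => exact le_rfl
        | succ n => exact (BB_step ε f q n x).2
    rw [ENNReal.iSup_pow]
    exact iSup_le h2
  refine (lintegral_mono hsup).trans ?_
  rw [lintegral_iSup (fun n => (JJ_meas hf ε (BB_meas hf ε q n)).pow_const 2) hmono]
  refine iSup_le fun n => ?_
  obtain ⟨a, b, ha, h⟩ := BB_bd ε f hq n
  exact sel_bound hδ hδ1 hε hε1 (BB_meas hf ε q n) ha h hf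

lemma CW_ne_top {δ : ℝ} (hδ : 0 < δ) : CW δ ≠ ∞ := by
  have := WW_ne_top hδ
  unfold CW
  finiteness

end CE

open CE in
theorem stmt_2 (δ : ℝ) (hδ : δ ∈ Set.Ioo (0 : ℝ) 1) :
    ∃ C : ℝ, 0 < C ∧ ∀ ε : ℝ, δ < |ε| → δ < |ε - 1| → ∀ f : SchwartzMap ℝ ℂ,
      (∫⁻ x : ℝ, carlesonEven ε (fun y => f y) x ^ (2 : ℝ)) ^ (1 / 2 : ℝ)
        ≤ ENNReal.ofReal C * eLpNorm (fun y => f y) 2 volume := by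
  have hfin : (4 * (CW δ + CW δ)) ^ (1 / 2 : ℝ) ≠ ∞ := by
    have := CW_ne_top hδ.1
    exact ENNReal.rpow_ne_top_of_nonneg (by norm_num) (by finiteness)
  refine ⟨((4 * (CW δ + CW δ)) ^ (1 / 2 : ℝ)).toReal + 1, by positivity, fun ε hε hε1 f => ?_⟩
  have hf := nice_schwartz f
  have hS := sup_bound hδ.1 hδ.2 hε hε1 hf
  have hc : ∀ x, carlesonEven ε (fun y => f y) x = ⨆ A : ℝ, ‖JJ ε (fun y => f y) A x‖ₑ := fun x => by
    unfold carlesonEven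
    refine iSup_congr fun A => ?_
    rw [pv_eq hf]
    rfl
  have hn : eLpNorm (fun y => f y) 2 volume = (∫⁻ z, ‖f z‖ₑ ^ 2) ^ (1 / 2 : ℝ) := by
    rw [eLpNorm_eq_lintegral_rpow_enorm_toReal (by norm_num) (by norm_num)]
    simp
  simp only [hc, ENNReal.rpow_two]
  rw [hn]
  calc _ ≤ (4 * (CW δ + CW δ) * ∫⁻ z, ‖f z‖ₑ ^ 2) ^ (1 / 2 : ℝ) := by gcongr
    _ = (4 * (CW δ + CW δ)) ^ (1 / 2 : ℝ) * (∫⁻ z, ‖f z‖ₑ ^ 2) ^ (1 / 2 : ℝ) :=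
        ENNReal.mul_rpow_of_nonneg _ _ (by norm_num)
    _ ≤ _ := by
        gcongr
        rw [← ENNReal.ofReal_toReal hfin]
        refine ENNReal.ofReal_le_ofReal ?_
        rw [ENNReal.toReal_ofReal (by positivity)]
        linarith
end

section
/- There exists a universal constant C₀ > 0 such that for every real ε with |ε| < 1/2 and every λ ∈ ℝ, the principal value integral p.v. ∫_ℝ e^{i|t|^ε} e^{−iλt} dt/t exists and satisfies | p.v. ∫_ℝ e^{i|t|^ε} e^{−iλt} dt/t | ≤ C₀. -/
open MeasureTheory Filter Set
open scoped ENNReal Topology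

theorem aux_ibp (f g P : ℝ → ℂ) (q Q : ℝ → ℝ) (x y : ℝ) (hxy : x ≤ y)
    (hf : ContinuousOn f (Icc x y)) (hg : ContinuousOn g (Icc x y)) (hq : ContinuousOn q (Icc x y))
    (hP : ∀ t ∈ Icc x y, HasDerivAt P (f t + g t) t)
    (hQ : ∀ t ∈ Icc x y, HasDerivAt Q (q t) t)
    (hb : ∀ t ∈ Icc x y, ‖g t‖ ≤ q t) :
    ‖∫ t in x..y, f t‖ ≤ ‖P x‖ + ‖P y‖ + (Q y - Q x) := by
  have hu : uIcc x y = Icc x y := uIcc_of_le hxy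
  have fi : IntervalIntegrable f volume x y := ContinuousOn.intervalIntegrable (by rwa [hu])
  have gi : IntervalIntegrable g volume x y := ContinuousOn.intervalIntegrable (by rwa [hu])
  have qi : IntervalIntegrable q volume x y := ContinuousOn.intervalIntegrable (by rwa [hu])
  have h1 := intervalIntegral.integral_eq_sub_of_hasDerivAt (f := P) (a := x) (b := y)
    (f' := fun t => f t + g t) (by rwa [hu]) (fi.add gi)
  have h2 := intervalIntegral.integral_eq_sub_of_hasDerivAt (f := Q) (a := x) (b := y)
    (f' := q) (by rwa [hu]) qi
  rw [intervalIntegral.integral_add fi gi] at h1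
  have h3 : ‖∫ t in x..y, g t‖ ≤ ∫ t in x..y, q t := by
    apply intervalIntegral.norm_integral_le_of_norm_le hxy _ qi
    filter_upwards with t ht
    exact hb t ⟨ht.1.le, ht.2⟩
  have h4 : ∫ t in x..y, f t = P y - P x - ∫ t in x..y, g t := by
    rw [← h1]; ring
  rw [h4]
  have := norm_sub_le (P y - P x) (∫ t in x..y, g t)
  have := norm_sub_le (P y) (P x)
  linarith

noncomputable def auxE (ε t : ℝ) : ℂ := Complex.exp (Complex.I * ((|t| ^ ε : ℝ) : ℂ))

noncomputable def auxF (ε l t : ℝ) : ℂ := auxE ε t * ((Real.sin (l * t) / t : ℝ) : ℂ)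

theorem auxE_norm (ε t : ℝ) : ‖auxE ε t‖ = 1 := by
  unfold auxE; rw [mul_comm]; exact Complex.norm_exp_ofReal_mul_I _

theorem auxE_deriv (ε t : ℝ) (ht : 0 < t) :
    HasDerivAt (auxE ε) (auxE ε t * (Complex.I * ((ε * t ^ (ε - 1) : ℝ) : ℂ))) t := by
  have h1 : HasDerivAt (fun s : ℝ => s ^ ε) (ε * t ^ (ε - 1)) t :=
    Real.hasDerivAt_rpow_const (Or.inl ht.ne')
  have h2 := ((h1.ofReal_comp).const_mul Complex.I).cexp
  have h3 : HasDerivAt (auxE ε) (Complex.exp (Complex.I * ((t ^ ε : ℝ) : ℂ)) *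
      (Complex.I * ((ε * t ^ (ε - 1) : ℝ) : ℂ))) t := by
    apply h2.congr_of_eventuallyEq
    filter_upwards [lt_mem_nhds ht] with s hs
    simp only [auxE, abs_of_pos hs]
  simpa only [auxE, abs_of_pos ht] using h3

theorem auxE_cont (ε x y : ℝ) (hx : 0 < x) : ContinuousOn (auxE ε) (Icc x y) := fun t ht =>
  (auxE_deriv ε t (hx.trans_le ht.1)).continuousAt.continuousWithinAt

theorem auxF_cont (ε l x y : ℝ) (hx : 0 < x) : ContinuousOn (auxF ε l) (Icc x y) := by
  unfold auxF
  apply (auxE_cont ε x y hx).mul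
  apply Complex.continuous_ofReal.comp_continuousOn
  apply ContinuousOn.div (by fun_prop) (by fun_prop)
  intro t ht
  exact (hx.trans_le ht.1).ne'

theorem rpow_cont (a x y : ℝ) (hx : 0 < x) : ContinuousOn (fun t : ℝ => t ^ a) (Icc x y) :=
  fun t ht => (Real.continuousAt_rpow_const t a (Or.inl (hx.trans_le ht.1).ne')).continuousWithinAt

theorem aux_norm_mul (ε t r : ℝ) : ‖auxE ε t * (r : ℂ)‖ = |r| := by
  rw [norm_mul, auxE_norm, one_mul, Complex.norm_real, Real.norm_eq_abs]

theorem lemA (ε l x y : ℝ) (hε : |ε| < 1 / 2) (hl : 0 < l) (hx : 0 < x) (hxy : x ≤ y) :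
    ‖∫ t in x..y, auxF ε l t‖ ≤ (3 / x + 2 * |ε| * x ^ (ε - 1)) / l := by
  have hε' := abs_lt.1 hε
  have key := aux_ibp (auxF ε l)
    (fun t => auxE ε t * ((Real.cos (l * t) / (l * t ^ 2) : ℝ) : ℂ)
      + Complex.I * (auxE ε t * ((-(Real.cos (l * t) / (l * t) * (ε * t ^ (ε - 1))) : ℝ) : ℂ)))
    (fun t => auxE ε t * ((-(Real.cos (l * t) / (l * t)) : ℝ) : ℂ))
    (fun t => 1 / (l * t ^ 2) + |ε| * t ^ (ε - 2) / l)
    (fun t => -(1 / (l * t)) + |ε| * (t ^ (ε - 1) / (ε - 1)) / l) x y hxy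
    (auxF_cont ε l x y hx) ?_ ?_ ?_ ?_ ?_
  · refine key.trans ?_
    have hy : 0 < y := hx.trans_le hxy
    have e1 : ∀ t, 0 < t → ‖auxE ε t * ((-(Real.cos (l * t) / (l * t)) : ℝ) : ℂ)‖ ≤ 1 / (l * t) := by
      intro t ht
      rw [aux_norm_mul, abs_neg, abs_div, abs_of_pos (mul_pos hl ht)]
      gcongr
      exact Real.abs_cos_le_one _
    have h1 := e1 x hx
    have h2 := e1 y hy
    have h3 : |ε| * (y ^ (ε - 1) / (ε - 1)) / l ≤ 0 := by
      apply div_nonpos_of_nonpos_of_nonneg _ hl.le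
      apply mul_nonpos_of_nonneg_of_nonpos (abs_nonneg _)
      apply div_nonpos_of_nonneg_of_nonpos (Real.rpow_nonneg hy.le _) (by linarith)
    have h4 : -(|ε| * (x ^ (ε - 1) / (ε - 1)) / l) ≤ 2 * |ε| * x ^ (ε - 1) / l := by
      rw [← neg_div]
      gcongr
      have : x ^ (ε - 1) / (1 - ε) ≤ 2 * x ^ (ε - 1) := by
        rw [div_le_iff₀ (by linarith)]
        have := Real.rpow_nonneg hx.le (ε - 1)
        nlinarith
      have e : x ^ (ε - 1) / (ε - 1) = - (x ^ (ε - 1) / (1 - ε)) := by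
        rw [← div_neg]; congr 1; ring
      rw [e]
      have := mul_le_mul_of_nonneg_left this (abs_nonneg ε)
      linarith
    have h5 : 1 / (l * y) ≤ 1 / (l * x) := by gcongr
    have h6 : (3 / x + 2 * |ε| * x ^ (ε - 1)) / l = 3 * (1 / (l * x)) + 2 * |ε| * x ^ (ε - 1) / l := by
      field_simp
    have h7 : 0 ≤ 1 / (l * y) := by positivity
    rw [h6]
    linarith
  · have c1 := auxE_cont ε x y hx
    have c2 := rpow_cont (ε - 1) x y hx
    have hne : ∀ t ∈ Icc x y, l * t ≠ 0 := fun t ht => (mul_pos hl (hx.trans_le ht.1)).ne'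
    have hne2 : ∀ t ∈ Icc x y, l * t ^ 2 ≠ 0 := fun t ht =>
      (mul_pos hl (pow_pos (hx.trans_le ht.1) 2)).ne'
    apply ContinuousOn.add
    · apply c1.mul
      apply Complex.continuous_ofReal.comp_continuousOn
      exact ContinuousOn.div (by fun_prop) (by fun_prop) hne2
    · apply continuousOn_const.mul
      apply c1.mul
      apply Complex.continuous_ofReal.comp_continuousOn
      apply ContinuousOn.neg
      apply ContinuousOn.mul
      · exact ContinuousOn.div (by fun_prop) (by fun_prop) hne
      · exact continuousOn_const.mul c2
  · have c2 := rpow_cont (ε - 2) x y hx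
    have hne2 : ∀ t ∈ Icc x y, l * t ^ 2 ≠ 0 := fun t ht =>
      (mul_pos hl (pow_pos (hx.trans_le ht.1) 2)).ne'
    apply ContinuousOn.add
    · exact ContinuousOn.div (by fun_prop) (by fun_prop) hne2
    · exact (continuousOn_const.mul c2).div_const _
  · intro t ht
    have ht0 : 0 < t := hx.trans_le ht.1
    have d1 := auxE_deriv ε t ht0
    have d0 : HasDerivAt (fun s : ℝ => l * s) l t := by simpa using (hasDerivAt_id t).const_mul l
    have d2 : HasDerivAt (fun t : ℝ => -(Real.cos (l * t) / (l * t)))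
        (Real.sin (l * t) / t + Real.cos (l * t) / (l * t ^ 2)) t := by
      have := ((d0.cos).div d0 (mul_pos hl ht0).ne').neg
      refine this.congr_deriv ?_
      field_simp
      ring
    refine (d1.mul d2.ofReal_comp).congr_deriv ?_
    simp only [auxF]
    push_cast
    ring
  · intro t ht
    have ht0 : 0 < t := hx.trans_le ht.1
    have d0 : HasDerivAt (fun s : ℝ => l * s) l t := by simpa using (hasDerivAt_id t).const_mul l
    have d1 : HasDerivAt (fun s : ℝ => s ^ (ε - 1)) ((ε - 1) * t ^ (ε - 1 - 1)) t :=
      Real.hasDerivAt_rpow_const (Or.inl ht0.ne')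
    have d2 := ((d0.inv (mul_pos hl ht0).ne').neg).add
      (((d1.div_const (ε - 1)).const_mul |ε|).div_const l)
    have d3 := d2.congr_deriv (g' := 1 / (l * t ^ 2) + |ε| * t ^ (ε - 2) / l) (by
      have : ε - 1 ≠ 0 := by linarith
      rw [show ε - 1 - 1 = ε - 2 by ring]
      field_simp)
    refine d3.congr_of_eventuallyEq (Eventually.of_forall fun s => ?_)
    simp
  · intro t ht
    have ht0 : 0 < t := hx.trans_le ht.1
    refine (norm_add_le _ _).trans ?_
    rw [norm_mul Complex.I, Complex.norm_I, one_mul, aux_norm_mul, aux_norm_mul]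
    have hc := Real.abs_cos_le_one (l * t)
    have hr : t ^ (ε - 1) = t ^ (ε - 2) * t := by
      rw [show ε - 1 = ε - 2 + 1 by ring, Real.rpow_add_one ht0.ne']
    have hp := Real.rpow_pos_of_pos ht0 (ε - 2)
    apply add_le_add
    · rw [abs_div, abs_of_pos (by positivity : 0 < l * t ^ 2)]
      gcongr
    · rw [abs_neg, abs_mul, abs_div, abs_of_pos (by positivity : 0 < l * t), abs_mul, hr,
        abs_of_pos (by positivity : 0 < t ^ (ε - 2) * t)]
      have : |Real.cos (l * t)| / (l * t) * (|ε| * (t ^ (ε - 2) * t)) =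
        |Real.cos (l * t)| * (|ε| * t ^ (ε - 2) / l) := by field_simp
      rw [this]
      exact mul_le_of_le_one_left (by positivity) hc

theorem lemB (ε l x y : ℝ) (hε : |ε| < 1 / 2) (h0 : ε ≠ 0) (hl : 0 < l) (hx : 1 ≤ l * x)
    (hxy : x ≤ y) :
    ‖∫ t in x..y, auxF ε l t‖ ≤ 5 * (l * y ^ (1 - ε) / |ε|) := by
  have hε' := abs_lt.1 hε
  have hx0 : 0 < x := by
    by_contra h
    push Not at h
    nlinarith
  have ha : 0 < |ε| := abs_pos.2 h0
  have hp1 : ∀ t : ℝ, 0 < t → t ^ (1 - ε) = t ^ (-ε) * t := fun t ht => by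
    rw [show 1 - ε = -ε + 1 by ring, Real.rpow_add_one ht.ne']
  have hp2 : ∀ t : ℝ, 0 < t → t ^ (-ε) = t ^ (-ε - 1) * t := fun t ht => by
    rw [← Real.rpow_add_one ht.ne']; ring_nf
  have key := aux_ibp (auxF ε l)
    (fun t => -Complex.I * (auxE ε t * (((l * Real.cos (l * t) * t ^ (-ε)
      - ε * Real.sin (l * t) * t ^ (-ε - 1)) / ε : ℝ) : ℂ)))
    (fun t => -Complex.I * (auxE ε t * ((Real.sin (l * t) * t ^ (-ε) / ε : ℝ) : ℂ)))
    (fun t => 3 / 2 * l * t ^ (-ε) / |ε|)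
    (fun t => 3 / 2 * l * (t ^ (1 - ε) / (1 - ε)) / |ε|) x y hxy
    (auxF_cont ε l x y hx0) ?_ ?_ ?_ ?_ ?_
  · refine key.trans ?_
    have hy : 0 < y := hx0.trans_le hxy
    have hmono : x ^ (1 - ε) ≤ y ^ (1 - ε) := Real.rpow_le_rpow hx0.le hxy (by linarith)
    have e1 : ∀ t, x ≤ t → t ≤ y →
        ‖-Complex.I * (auxE ε t * ((Real.sin (l * t) * t ^ (-ε) / ε : ℝ) : ℂ))‖
          ≤ l * y ^ (1 - ε) / |ε| := by
      intro t ht hty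
      have ht0 : 0 < t := hx0.trans_le ht
      have hp := Real.rpow_pos_of_pos ht0 (-ε)
      rw [norm_mul, norm_neg, Complex.norm_I, one_mul, aux_norm_mul, abs_div, abs_mul, abs_of_pos hp]
      refine div_le_div_of_nonneg_right ?_ ha.le
      have h1 : t ^ (1 - ε) ≤ y ^ (1 - ε) := Real.rpow_le_rpow ht0.le hty (by linarith)
      have h2 : 1 ≤ l * t := by nlinarith
      calc |Real.sin (l * t)| * t ^ (-ε) ≤ 1 * t ^ (-ε) := by
            gcongr; exact Real.abs_sin_le_one _
        _ ≤ (l * t) * t ^ (-ε) := by gcongr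
        _ = l * t ^ (1 - ε) := by rw [hp1 t ht0]; ring
        _ ≤ _ := by gcongr
    have h1 := e1 x le_rfl hxy
    have h2 := e1 y hxy le_rfl
    have h3 : 0 ≤ 3 / 2 * l * (x ^ (1 - ε) / (1 - ε)) / |ε| := by
      have : 0 < 1 - ε := by linarith
      have := Real.rpow_pos_of_pos hx0 (1 - ε)
      positivity
    have h4 : 3 / 2 * l * (y ^ (1 - ε) / (1 - ε)) / |ε| ≤ 3 * (l * y ^ (1 - ε) / |ε|) := by
      have : y ^ (1 - ε) / (1 - ε) ≤ 2 * y ^ (1 - ε) := by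
        rw [div_le_iff₀ (by linarith)]
        have := Real.rpow_nonneg hy.le (1 - ε)
        nlinarith
      calc 3 / 2 * l * (y ^ (1 - ε) / (1 - ε)) / |ε| ≤ 3 / 2 * l * (2 * y ^ (1 - ε)) / |ε| := by
            gcongr
        _ = _ := by ring
    linarith
  · have c1 := auxE_cont ε x y hx0
    have c2 := rpow_cont (-ε) x y hx0
    have c3 := rpow_cont (-ε - 1) x y hx0
    apply continuousOn_const.mul
    apply c1.mul
    apply Complex.continuous_ofReal.comp_continuousOn
    apply ContinuousOn.div_const
    apply ContinuousOn.sub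
    · exact ContinuousOn.mul (by fun_prop) c2
    · exact ContinuousOn.mul (by fun_prop) c3
  · exact (continuousOn_const.mul (rpow_cont (-ε) x y hx0)).div_const _
  · intro t ht
    have ht0 : 0 < t := hx0.trans_le ht.1
    have d1 := auxE_deriv ε t ht0
    have d0 : HasDerivAt (fun s : ℝ => l * s) l t := by simpa using (hasDerivAt_id t).const_mul l
    have dr : HasDerivAt (fun s : ℝ => s ^ (-ε)) (-ε * t ^ (-ε - 1)) t :=
      Real.hasDerivAt_rpow_const (Or.inl ht0.ne')
    have d2 : HasDerivAt (fun t : ℝ => Real.sin (l * t) * t ^ (-ε) / ε)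
        ((l * Real.cos (l * t) * t ^ (-ε) - ε * Real.sin (l * t) * t ^ (-ε - 1)) / ε) t := by
      refine ((d0.sin.mul dr).div_const ε).congr_deriv ?_
      ring
    refine ((d1.mul d2.ofReal_comp).const_mul (-Complex.I)).congr_deriv ?_
    have hs : Real.sin (l * t) / t = (ε * t ^ (ε - 1)) * (Real.sin (l * t) * t ^ (-ε) / ε) := by
      have : t ^ (ε - 1) * t ^ (-ε) = t⁻¹ := by
        rw [← Real.rpow_add ht0, show ε - 1 + -ε = -1 by ring, Real.rpow_neg_one]
      calc Real.sin (l * t) / t = Real.sin (l * t) * (t ^ (ε - 1) * t ^ (-ε)) := by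
            rw [this, div_eq_mul_inv]
        _ = _ := by field_simp
    simp only [auxF]
    rw [hs, Complex.ofReal_mul (ε * t ^ (ε - 1))]
    linear_combination (-(auxE ε t * ((ε * t ^ (ε - 1) : ℝ) : ℂ) *
      ((Real.sin (l * t) * t ^ (-ε) / ε : ℝ) : ℂ))) * Complex.I_mul_I
  · intro t ht
    have ht0 : 0 < t := hx0.trans_le ht.1
    have d1 : HasDerivAt (fun s : ℝ => s ^ (1 - ε)) ((1 - ε) * t ^ (1 - ε - 1)) t :=
      Real.hasDerivAt_rpow_const (Or.inl ht0.ne')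
    refine (((d1.div_const (1 - ε)).const_mul (3 / 2 * l)).div_const |ε|).congr_deriv ?_
    have : 1 - ε ≠ 0 := by linarith
    rw [show 1 - ε - 1 = -ε by ring]
    field_simp
  · intro t ht
    have ht0 : 0 < t := hx0.trans_le ht.1
    rw [norm_mul, norm_neg, Complex.norm_I, one_mul, aux_norm_mul, abs_div]
    gcongr
    have hp := Real.rpow_pos_of_pos ht0 (-ε - 1)
    have h2 : 1 ≤ l * t := by nlinarith [ht.1]
    have hc := Real.abs_cos_le_one (l * t)
    have hs := Real.abs_sin_le_one (l * t)
    refine (abs_sub _ _).trans ?_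
    rw [abs_mul, abs_mul, abs_mul, abs_mul, abs_of_pos hl, abs_of_pos hp,
      abs_of_pos (Real.rpow_pos_of_pos ht0 _), hp2 t ht0]
    have a1 : l * |Real.cos (l * t)| * (t ^ (-ε - 1) * t) ≤ l * 1 * (t ^ (-ε - 1) * t) := by gcongr
    have a2 : |ε| * |Real.sin (l * t)| * t ^ (-ε - 1) ≤ (1 / 2) * 1 * t ^ (-ε - 1) := by gcongr
    have a3 : 1 * t ^ (-ε - 1) ≤ (l * t) * t ^ (-ε - 1) := by gcongr
    nlinarith

theorem auxF_bound (ε l t : ℝ) (hl : 0 < l) : ‖auxF ε l t‖ ≤ l := by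
  unfold auxF
  rw [aux_norm_mul, abs_div]
  have := Real.abs_sin_le_abs (x := l * t)
  rw [abs_mul, abs_of_pos hl] at this
  exact div_le_of_le_mul₀ (abs_nonneg _) hl.le this

theorem auxF_int (ε l : ℝ) (hl : 0 < l) (a b : ℝ) : IntervalIntegrable (auxF ε l) volume a b := by
  have hm : Measurable (auxF ε l) := by
    unfold auxF auxE
    fun_prop
  refine (intervalIntegrable_const (c := l)).mono_fun hm.aestronglyMeasurable ?_
  filter_upwards with t
  rw [Real.norm_of_nonneg hl.le]
  exact auxF_bound ε l t hl

theorem aux_bound (ε l : ℝ) (hε : |ε| < 1 / 2) (hl : 0 < l) (R : ℝ) (hR : 0 < R) :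
    ‖∫ t in 0..R, auxF ε l t‖ ≤ 11 := by
  have hε' := abs_lt.1 hε
  have hi := auxF_int ε l hl
  have h1 : ∀ r, 0 ≤ r → l * r ≤ 1 → ‖∫ t in 0..r, auxF ε l t‖ ≤ 1 := by
    intro r hr hr1
    have := intervalIntegral.norm_integral_le_of_norm_le_const (a := 0) (b := r) (C := l)
      (f := auxF ε l) (fun t _ => auxF_bound ε l t hl)
    rw [sub_zero, abs_of_nonneg hr] at this
    linarith
  rcases le_total (l * R) 1 with hc | hc
  · linarith [h1 R hR.le hc]
  set T : ℝ := (|ε| / l) ^ (1 / (1 - ε)) with hT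
  have hq : 0 ≤ |ε| / l := by positivity
  have hT0 : 0 ≤ T := Real.rpow_nonneg hq _
  have hTp : l * T ^ (1 - ε) = |ε| := by
    rw [hT, ← Real.rpow_mul hq, one_div, inv_mul_cancel₀ (by linarith), Real.rpow_one]
    field_simp
  have hla : 0 < 1 / l := by positivity
  have hll : l * (1 / l) = 1 := by field_simp
  have hRl : 1 / l ≤ R := by rw [div_le_iff₀ hl]; linarith
  have h2 := h1 (1 / l) hla.le hll.le
  -- tail
  have hA : ∀ x, 1 / l ≤ x → T ≤ x → x ≤ R → ‖∫ t in x..R, auxF ε l t‖ ≤ 5 := by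
    intro x hx1 hx2 hx3
    have hx0 : 0 < x := hla.trans_le hx1
    refine (lemA ε l x R hε hl hx0 hx3).trans ?_
    rw [div_le_iff₀ hl]
    have e1 : 3 / x ≤ 3 * l := by
      rw [div_le_iff₀ hx0]
      rw [div_le_iff₀ hl] at hx1
      linarith
    have e2 : |ε| * x ^ (ε - 1) ≤ l := by
      rw [show ε - 1 = -(1 - ε) by ring, Real.rpow_neg hx0.le, ← div_eq_mul_inv,
        div_le_iff₀ (Real.rpow_pos_of_pos hx0 _), ← hTp]
      gcongr
      linarith
    linarith
  have hB : ∀ y, 1 / l ≤ y → y ≤ T → ‖∫ t in (1 / l)..y, auxF ε l t‖ ≤ 5 := by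
    intro y hy1 hy2
    have hy0 : 0 < y := hla.trans_le hy1
    have h0 : ε ≠ 0 := by
      rintro rfl
      have : T = 0 := by rw [hT]; simp
      linarith
    refine (lemB ε l (1 / l) y hε h0 hl hll.ge hy1).trans ?_
    have : l * y ^ (1 - ε) / |ε| ≤ 1 := by
      rw [div_le_one (abs_pos.2 h0), ← hTp]
      gcongr
      linarith
    linarith
  rw [← intervalIntegral.integral_add_adjacent_intervals (hi 0 (1 / l)) (hi (1 / l) R)]
  have hn := norm_add_le (∫ t in 0..(1 / l), auxF ε l t) (∫ t in (1 / l)..R, auxF ε l t)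
  rcases le_total T (1 / l) with hc1 | hc1
  · linarith [hA (1 / l) le_rfl hc1 hRl]
  rcases le_total R T with hc2 | hc2
  · linarith [hB R hRl hc2]
  rw [← intervalIntegral.integral_add_adjacent_intervals (hi (1 / l) T) (hi T R)] at hn ⊢
  have hn2 := norm_add_le (∫ t in (1 / l)..T, auxF ε l t) (∫ t in T..R, auxF ε l t)
  linarith [hB T hc1 le_rfl, hA T hc1 le_rfl hc2]

theorem aux_lim_pos (ε l : ℝ) (hε : |ε| < 1 / 2) (hl : 0 < l) :
    ∃ J : ℂ, Tendsto (fun p : ℝ × ℝ => ∫ t in p.1..p.2, auxF ε l t)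
      ((𝓝[>] (0 : ℝ)) ×ˢ atTop) (𝓝 J) ∧ ‖J‖ ≤ 11 := by
  have hε' := abs_lt.1 hε
  have hi := auxF_int ε l hl
  have hlim : Tendsto (fun x : ℝ => (3 / x + 2 * |ε| * x ^ (ε - 1)) / l) atTop (𝓝 0) := by
    have e1 : Tendsto (fun x : ℝ => 3 / x) atTop (𝓝 0) := tendsto_const_nhds.div_atTop tendsto_id
    have e2 : Tendsto (fun x : ℝ => x ^ (ε - 1)) atTop (𝓝 0) := by
      have := tendsto_rpow_neg_atTop (y := 1 - ε) (by linarith)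
      simpa using this
    simpa using (e1.add (e2.const_mul (2 * |ε|))).div_const l
  have hc : Cauchy (map (fun R : ℝ => ∫ t in 0..R, auxF ε l t) atTop) := by
    change CauchySeq (fun R : ℝ => ∫ t in 0..R, auxF ε l t)
    rw [Metric.cauchySeq_iff']
    intro η hη
    obtain ⟨N, hN⟩ := ((hlim.eventually (gt_mem_nhds hη)).and (eventually_gt_atTop 0)).exists
    refine ⟨N, fun n hn => ?_⟩
    rw [dist_eq_norm, intervalIntegral.integral_interval_sub_left (hi _ _) (hi _ _)]
    exact (lemA ε l N n hε hl hN.2 hn).trans_lt hN.1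
  obtain ⟨J, hJ⟩ := cauchy_iff_exists_le_nhds.1 hc
  have hJ : Tendsto (fun R : ℝ => ∫ t in 0..R, auxF ε l t) atTop (𝓝 J) := hJ
  refine ⟨J, ?_, ?_⟩
  · have h0 : Tendsto (fun δ : ℝ => ∫ t in 0..δ, auxF ε l t) (𝓝[>] 0) (𝓝 0) := by
      have := (intervalIntegral.continuous_primitive hi 0).tendsto 0
      simp only [intervalIntegral.integral_same] at this
      exact this.mono_left nhdsWithin_le_nhds
    have := (hJ.comp (tendsto_snd (f := 𝓝[>] (0 : ℝ)))).sub
      (h0.comp (tendsto_fst (g := (atTop : Filter ℝ))))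
    rw [sub_zero] at this
    refine this.congr fun p => ?_
    exact intervalIntegral.integral_interval_sub_left (hi _ _) (hi _ _)
  · refine le_of_tendsto hJ.norm ?_
    filter_upwards [eventually_gt_atTop 0] with R hR
    exact aux_bound ε l hε hl R hR

theorem aux_lim (ε l : ℝ) (hε : |ε| < 1 / 2) :
    ∃ J : ℂ, Tendsto (fun p : ℝ × ℝ => ∫ t in p.1..p.2, auxF ε l t)
      ((𝓝[>] (0 : ℝ)) ×ˢ atTop) (𝓝 J) ∧ ‖J‖ ≤ 11 := by
  rcases lt_trichotomy l 0 with hl | hl | hl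
  · obtain ⟨J, h1, h2⟩ := aux_lim_pos ε (-l) hε (by linarith)
    refine ⟨-J, ?_, by rwa [norm_neg]⟩
    refine h1.neg.congr fun p => ?_
    rw [← intervalIntegral.integral_neg]
    congr 1
    funext t
    simp [auxF, neg_div]
  · subst hl
    refine ⟨0, ?_, by simp⟩
    have : ∀ t, auxF ε 0 t = 0 := fun t => by simp [auxF]
    simp only [this, intervalIntegral.integral_zero]
    exact tendsto_const_nhds
  · exact aux_lim_pos ε l hε hl

theorem aux_eq (ε l a b : ℝ) (ha : 0 < a) (hab : a ≤ b) :
    (∫ t in {t : ℝ | a ≤ |t| ∧ |t| ≤ b},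
          Complex.exp (Complex.I * ((|t| ^ ε : ℝ) : ℂ)) *
            Complex.exp (-(Complex.I * (l : ℂ) * (t : ℂ))) / (t : ℂ))
      = (-2 * Complex.I) * ∫ t in a..b, auxF ε l t := by
  set g : ℝ → ℂ := fun t => Complex.exp (Complex.I * ((|t| ^ ε : ℝ) : ℂ)) *
            Complex.exp (-(Complex.I * (l : ℂ) * (t : ℂ))) / (t : ℂ) with hg
  have hset : {t : ℝ | a ≤ |t| ∧ |t| ≤ b} = Icc a b ∪ Icc (-b) (-a) := by
    ext t
    simp only [mem_ofPred_eq, mem_union, mem_Icc]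
    rcases le_total 0 t with h | h
    · rw [abs_of_nonneg h]
      constructor
      · exact fun h => Or.inl h
      · rintro (h | h)
        · exact h
        · constructor <;> linarith
    · rw [abs_of_nonpos h]
      constructor
      · exact fun h => Or.inr ⟨by linarith, by linarith⟩
      · rintro (h | h) <;> constructor <;> linarith
  have hdis : Disjoint (Icc a b) (Icc (-b) (-a)) := by
    rw [Set.disjoint_left]
    intro t h1 h2
    linarith [h1.1, h2.2]
  have hcont : ∀ s : Set ℝ, (∀ t ∈ s, t ≠ 0) → ContinuousOn g s := by
    intro s hs t ht
    have h0 := hs t ht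
    have h1 : ContinuousAt (fun t : ℝ => |t| ^ ε) t :=
      (continuous_abs.continuousAt).rpow_const (Or.inl (by simpa using h0))
    have h2 : ContinuousAt (fun t : ℝ => ((|t| ^ ε : ℝ) : ℂ)) t :=
      Complex.continuous_ofReal.continuousAt.comp h1
    apply ContinuousAt.continuousWithinAt
    apply ContinuousAt.div
    · apply ContinuousAt.mul
      · exact (continuousAt_const.mul h2).cexp
      · fun_prop
    · fun_prop
    · exact_mod_cast h0
  have c1 : ContinuousOn g (Icc a b) := hcont _ fun t ht => (ha.trans_le ht.1).ne'
  have c2 : ContinuousOn g (Icc (-b) (-a)) := hcont _ fun t ht => by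
    have := ht.2
    linarith
  have i1 : IntervalIntegrable g volume a b :=
    ContinuousOn.intervalIntegrable (by rwa [uIcc_of_le hab])
  have c3 : ContinuousOn (fun t => g (-t)) (Icc a b) := by
    apply c2.comp continuousOn_neg
    intro t ht
    exact ⟨by linarith [ht.2], by linarith [ht.1]⟩
  have i2 : IntervalIntegrable (fun t => g (-t)) volume a b :=
    ContinuousOn.intervalIntegrable (by rwa [uIcc_of_le hab])
  rw [hset, setIntegral_union hdis measurableSet_Icc c1.integrableOn_Icc c2.integrableOn_Icc,
    integral_Icc_eq_integral_Ioc, integral_Icc_eq_integral_Ioc,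
    ← intervalIntegral.integral_of_le hab, ← intervalIntegral.integral_of_le (by linarith),
    ← intervalIntegral.integral_comp_neg, ← intervalIntegral.integral_add i1 i2,
    ← intervalIntegral.integral_const_mul]
  congr 1
  funext t
  simp only [hg, auxF, auxE, abs_neg]
  push_cast
  rw [Complex.sin]
  have e1 : -(Complex.I * (l : ℂ) * (t : ℂ)) = -((l : ℂ) * t) * Complex.I := by ring
  have e2 : -(Complex.I * (l : ℂ) * (-(t : ℂ))) = ((l : ℂ) * t) * Complex.I := by ring
  rw [e1, e2, div_neg]
  linear_combination (Complex.exp (Complex.I * ((|t| ^ ε : ℝ) : ℂ)) / (t : ℂ) * (Complex.exp (-((l : ℂ) * t) * Complex.I) - Complex.exp (((l : ℂ) * t) * Complex.I))) * Complex.I_mul_I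

theorem stmt_4 :
    ∃ C₀ : ℝ, 0 < C₀ ∧ ∀ ε : ℝ, |ε| < 1 / 2 → ∀ l : ℝ, ∃ I : ℂ,
      Filter.Tendsto
        (fun p : ℝ × ℝ => ∫ t in {t : ℝ | p.1 ≤ |t| ∧ |t| ≤ p.2},
          Complex.exp (Complex.I * ((|t| ^ ε : ℝ) : ℂ)) *
            Complex.exp (-(Complex.I * (l : ℂ) * (t : ℂ))) / (t : ℂ))
        ((nhdsWithin (0 : ℝ) (Set.Ioi 0)) ×ˢ Filter.atTop) (nhds I) ∧ ‖I‖ ≤ C₀ := by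
  refine ⟨22, by norm_num, fun ε hε l => ?_⟩
  obtain ⟨J, h1, h2⟩ := aux_lim ε l hε
  refine ⟨(-2 * Complex.I) * J, ?_, ?_⟩
  · refine (h1.const_mul (-2 * Complex.I)).congr' ?_
    have ev1 : ∀ᶠ x in 𝓝[>] (0 : ℝ), x ∈ Ioo (0 : ℝ) 1 := Ioo_mem_nhdsGT one_pos
    filter_upwards [ev1.prod_mk (eventually_ge_atTop (1 : ℝ))] with p hp
    exact (aux_eq ε l p.1 p.2 hp.1.1 (hp.1.2.le.trans hp.2)).symm
  · rw [norm_mul, norm_mul, norm_neg, Complex.norm_I]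
    norm_num
    linarith
end
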